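/- arXiv:2002.03359 — 4 statements merged into one kernel-verified Lean document; each statement's English description precedes it below -/
import Mathlib

section
/- Let (f_t)_{t∈I} be a Loewner chain over parallel slit half-planes (D_t)_{t∈I} with some codomain D, and let ℓ(t) denote the angular residue of f_t. For s ≤ t in I define φ_{t,s} := f_t^{-1} ∘ f_s on D_s (well-defined since f_s(D_s) ⊆ f_t(D_t)). Then (φ_{t,s})_{s≤t∈I} is an evolution family over (D_t)_{t∈I}, the angular residue of φ_{t,0} is λ(t) = ℓ(0) − ℓ(t), and λ is bounded on I, indeed λ(t) ≤ ℓ(0) for all t ∈ I. -/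
open Complex Set Filter Topology Bornology MeasureTheory Metric

noncomputable section

/-- The upper half-plane `ℍ = {z : ℂ | 0 < Im z}`. -/
def UHP : Set ℂ := {z : ℂ | 0 < z.im}

/-- The half-plane `ℍ_η = {z : ℂ | η < Im z}`. -/
def HP (η : ℝ) : Set ℂ := {z : ℂ | η < z.im}

/-- The sector `△_θ = {z : ℂ | θ < arg z < π - θ}`. -/
def Sector (θ : ℝ) : Set ℂ :=
  {z : ℂ | θ < Complex.arg z ∧ Complex.arg z < Real.pi - θ}

/-- A closed horizontal line segment of positive length contained in `ℍ`. -/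
def IsHorizontalSlit (C : Set ℂ) : Prop :=
  ∃ y xl xr : ℝ, 0 < y ∧ xl < xr ∧
    C = {z : ℂ | z.im = y ∧ z.re ∈ Set.Icc xl xr}

/-- A parallel slit half-plane with `N` slits: `ℍ` minus `N` pairwise disjoint
closed horizontal segments of positive length. -/
def IsParallelSlitHalfPlaneN (N : ℕ) (D : Set ℂ) : Prop :=
  ∃ C : Fin N → Set ℂ,
    (∀ j, IsHorizontalSlit (C j)) ∧
    (Pairwise fun i j => Disjoint (C i) (C j)) ∧
    D = UHP \ ⋃ j, C j

/-- A parallel slit half-plane (with some number of slits). -/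
def IsParallelSlitHalfPlane (D : Set ℂ) : Prop :=
  ∃ N : ℕ, IsParallelSlitHalfPlaneN N D

/-- (H.1): hydrodynamic normalization at infinity. -/
def SatisfiesH1 (D : Set ℂ) (f : ℂ → ℂ) : Prop :=
  ∃ η : ℝ, 0 ≤ η ∧ HP η ⊆ D ∧
    Tendsto (fun z => f z - z) (cobounded ℂ ⊓ 𝓟 (HP η)) (𝓝 0)

/-- (H.2): `f` has angular residue `c` at infinity, i.e. `z (f z - z) → -c`
as `z → ∞` within every sector `△_θ`. -/
def SatisfiesH2 (f : ℂ → ℂ) (c : ℂ) : Prop :=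
  ∀ θ : ℝ, 0 < θ → θ < Real.pi / 2 →
    Tendsto (fun z => z * (f z - z)) (cobounded ℂ ⊓ 𝓟 (Sector θ)) (𝓝 (-c))

/-- `F` is an ℍ-hull: relatively closed in `ℍ` with `ℍ \ F` a simply connected
domain. -/
def IsHHull (F : Set ℂ) : Prop :=
  F ⊆ UHP ∧ closure F ∩ UHP ⊆ F ∧
    IsConnected (UHP \ F) ∧ SimplyConnectedSpace ↥(UHP \ F)

/-- `η_D = min {Im w | w ∈ ℍ \ D}`. -/
def etaD (D : Set ℂ) : ℝ := sInf (Complex.im '' (UHP \ D))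

/-- A (chordal) evolution family `φ t s : D s → D t` (for `s ≤ t` in `I`) over
parallel slit half-planes `D t`, where `lam t` is the angular residue of
`φ t 0` at infinity. -/
structure IsEvolutionFamily (I : Set ℝ) (D : ℝ → Set ℂ)
    (φ : ℝ → ℝ → ℂ → ℂ) (lam : ℝ → ℂ) : Prop where
  slit : ∀ t ∈ I, IsParallelSlitHalfPlane (D t)
  mapsTo : ∀ s ∈ I, ∀ t ∈ I, s ≤ t → Set.MapsTo (φ t s) (D s) (D t)
  holo : ∀ s ∈ I, ∀ t ∈ I, s ≤ t → DifferentiableOn ℂ (φ t s) (D s)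
  inj : ∀ s ∈ I, ∀ t ∈ I, s ≤ t → Set.InjOn (φ t s) (D s)
  h1 : ∀ s ∈ I, ∀ t ∈ I, s ≤ t → SatisfiesH1 (D s) (φ t s)
  h2 : ∀ s ∈ I, ∀ t ∈ I, s ≤ t → ∃ c : ℂ, SatisfiesH2 (φ t s) c
  h3 : ∀ s ∈ I, ∀ t ∈ I, s ≤ t → IsHHull (D t \ φ t s '' D s)
  ef1 : ∀ t ∈ I, Set.EqOn (φ t t) id (D t)
  ef2 : ∀ s ∈ I, ∀ t ∈ I, ∀ u ∈ I, s ≤ t → t ≤ u →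
    ∀ z ∈ D s, φ u s z = φ u t (φ t s z)
  lam_res : ∀ t ∈ I, SatisfiesH2 (φ t 0) (lam t)
  ef3 : ContinuousOn lam I

/-- A (chordal) Loewner chain `f t : D t → Dcod` over parallel slit
half-planes `D t` with codomain `Dcod`, where `ell t` is the angular residue
of `f t` at infinity. -/
structure IsLoewnerChain (I : Set ℝ) (D : ℝ → Set ℂ) (Dcod : Set ℂ)
    (f : ℝ → ℂ → ℂ) (ell : ℝ → ℂ) : Prop where
  slit : ∀ t ∈ I, IsParallelSlitHalfPlane (D t)
  slitcod : IsParallelSlitHalfPlane Dcod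
  mapsTo : ∀ t ∈ I, Set.MapsTo (f t) (D t) Dcod
  holo : ∀ t ∈ I, DifferentiableOn ℂ (f t) (D t)
  inj : ∀ t ∈ I, Set.InjOn (f t) (D t)
  h1 : ∀ t ∈ I, SatisfiesH1 (D t) (f t)
  h2 : ∀ t ∈ I, SatisfiesH2 (f t) (ell t)
  h3 : ∀ t ∈ I, IsHHull (Dcod \ f t '' D t)
  lc1 : ∀ s ∈ I, ∀ t ∈ I, s ≤ t → f s '' D s ⊆ f t '' D t
  lc2 : ContinuousOn ell I

/-- `(Lip)_μ`: Lipschitz continuity of `t ↦ f t` w.r.t. the measure `μ`,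
uniformly on compact subsets of `D`. -/
def SatisfiesLip (I : Set ℝ) (μ : Measure ℝ) (D : Set ℂ)
    (f : ℝ → ℂ → ℂ) : Prop :=
  ∀ K : Set ℂ, K ⊆ D → IsCompact K → ∃ L : ℝ,
    ∀ s ∈ I, ∀ t ∈ I, s ≤ t → ∀ z ∈ K,
      ‖f t z - f s z‖ ≤ L * (μ (Set.Ioc s t)).toReal

/-- `(AC)_μ`: absolute continuity of `t ↦ f t` w.r.t. the measure `μ`,
uniformly on compact subsets of `D`. -/
def SatisfiesAC (I : Set ℝ) (μ : Measure ℝ) (D : Set ℂ)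
    (f : ℝ → ℂ → ℂ) : Prop :=
  ∀ K : Set ℂ, K ⊆ D → IsCompact K →
    ∃ ν : Measure ℝ, ν ≪ μ ∧
      (∀ a ∈ I, ∀ b ∈ I, ν (Set.Icc a b) < ⊤) ∧
      ∀ s ∈ I, ∀ t ∈ I, s ≤ t → ∀ z ∈ K,
        ‖f t z - f s z‖ ≤ (ν (Set.Ioc s t)).toReal

/-- The symmetric difference quotient
`(f (t+δ) z - f (t-δ) z) / μ((t-δ, t+δ))`. -/
def symmQuot (μ : Measure ℝ) (f : ℝ → ℂ → ℂ) (t δ : ℝ) (z : ℂ) : ℂ :=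
  (f (t + δ) z - f (t - δ) z) / ((μ (Set.Ioo (t - δ) (t + δ))).toReal : ℂ)

/-- A cross-cut of a domain `G`. -/
def IsCrossCut (G C : Set ℂ) : Prop :=
  ∃ c : ℝ → ℂ, ContinuousOn c (Set.Icc 0 1) ∧ Set.InjOn c (Set.Icc 0 1) ∧
    c 0 ∈ frontier G ∧ c 1 ∈ frontier G ∧ c '' Set.Ioo 0 1 ⊆ G ∧
    C = c '' Set.Icc 0 1

/-- `C` separates `S` from `∞` in `G`: `S` is disjoint from the unbounded
connected component of `G \ C`. -/
def SeparatesFromInfty (G C S : Set ℂ) : Prop :=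
  ∀ z ∈ S ∩ (G \ C), Bornology.IsBounded (connectedComponentIn (G \ C) z)

/-- The local growth property of a family of hulls `(F t)_{t ∈ [0,T]}` in `D`. -/
def LocalGrowth (T : ℝ) (D : Set ℂ) (F : ℝ → Set ℂ) : Prop :=
  ∀ ε : ℝ, 0 < ε → ∃ δ ∈ Set.Ioo 0 T, ∀ t ∈ Set.Icc 0 (T - δ),
    ∃ C : Set ℂ, IsCrossCut (D \ F t) C ∧ Metric.diam C < ε ∧
      SeparatesFromInfty (D \ F t) C (F (t + δ) \ F t)

/-- Carathéodory kernel of a sequence of domains w.r.t. the point `a`. -/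
def kernelAt (a : ℂ) (G : ℕ → Set ℂ) : Set ℂ :=
  connectedComponentIn
    {z : ℂ | ∃ r > 0, ∃ N : ℕ, ∀ n ≥ N, Metric.ball z r ⊆ G n} a

/-- Left continuity in Carathéodory's sense of `(F t)` at `t₀`. -/
def CaratheodoryLeftContinuousAt (D : Set ℂ) (F : ℝ → Set ℂ)
    (T t₀ : ℝ) : Prop :=
  ∀ a ∈ D \ F T, ∀ s : ℕ → ℝ,
    Monotone s → (∀ n, s n ∈ Set.Ico 0 t₀) → Tendsto s atTop (𝓝 t₀) →
      kernelAt a (fun n => D \ F (s n)) = D \ F t₀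

/-- a Loewner chain induces an evolution family
`φ t s = f t⁻¹ ∘ f s`, with angular residues `λ(t) = ℓ(0) - ℓ(t)` bounded by
`ℓ(0)`. -/

theorem not_eventually_const_of_injOn {Ω : Set ℂ} {f : ℂ → ℂ} (hΩ : IsOpen Ω)
    (hi : InjOn f Ω) {z : ℂ} (hz : z ∈ Ω) (c : ℂ) : ¬ ∀ᶠ w in 𝓝 z, f w = c := by
  intro h
  have h1 : ∀ᶠ w in 𝓝 z, w = z := by
    filter_upwards [h, hΩ.mem_nhds hz] with w hw hwΩ
    exact hi hwΩ hz (hw.trans h.self_of_nhds.symm)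
  have h2 : ∀ᶠ w in 𝓝[≠] z, w = z := h1.filter_mono nhdsWithin_le_nhds
  obtain ⟨w, hw, hw'⟩ := (h2.and self_mem_nhdsWithin).exists
  exact hw' hw

theorem nhds_le_map_of_injOn {Ω : Set ℂ} {f : ℂ → ℂ} (hΩ : IsOpen Ω)
    (hf : DifferentiableOn ℂ f Ω) (hi : InjOn f Ω) {z : ℂ} (hz : z ∈ Ω) :
    𝓝 (f z) ≤ map f (𝓝 z) :=
  (hf.analyticAt (hΩ.mem_nhds hz)).eventually_constant_or_nhds_le_map_nhds.resolve_left
    (not_eventually_const_of_injOn hΩ hi hz _)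

theorem isOpen_image_of_injOn {Ω : Set ℂ} {f : ℂ → ℂ} (hΩ : IsOpen Ω)
    (hf : DifferentiableOn ℂ f Ω) (hi : InjOn f Ω) {S : Set ℂ} (hS : IsOpen S) (hSΩ : S ⊆ Ω) :
    IsOpen (f '' S) := by
  rw [isOpen_iff_mem_nhds]
  rintro _ ⟨z, hz, rfl⟩
  exact nhds_le_map_of_injOn hΩ hf hi (hSΩ hz) (image_mem_map (hS.mem_nhds hz))

/-- A left inverse of a univalent function is continuous. -/
theorem continuousAt_of_leftInvOn {Ω : Set ℂ} {f g : ℂ → ℂ} (hΩ : IsOpen Ω)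
    (hf : DifferentiableOn ℂ f Ω) (hi : InjOn f Ω) (hg : ∀ z ∈ Ω, g (f z) = z) {z : ℂ}
    (hz : z ∈ Ω) : ContinuousAt g (f z) := by
  unfold ContinuousAt
  rw [hg z hz]
  refine (map_mono (nhds_le_map_of_injOn hΩ hf hi hz)).trans ?_
  rw [map_map]
  refine (tendsto_id (x := 𝓝 z)).congr' ?_
  filter_upwards [hΩ.mem_nhds hz] with w hw
  exact (hg w hw).symm

/-- A left inverse of a univalent function is holomorphic. -/
theorem differentiableOn_of_leftInvOn {Ω : Set ℂ} {f g : ℂ → ℂ} (hΩ : IsOpen Ω)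
    (hf : DifferentiableOn ℂ f Ω) (hi : InjOn f Ω) (hg : ∀ z ∈ Ω, g (f z) = z) :
    DifferentiableOn ℂ g (f '' Ω) := by
  have hopen : IsOpen (f '' Ω) := isOpen_image_of_injOn hΩ hf hi hΩ subset_rfl
  have key : ∀ z ∈ Ω, deriv f z ≠ 0 → DifferentiableAt ℂ g (f z) := by
    intro z hz hd
    have h1 : HasDerivAt f (deriv f z) z := (hf.differentiableAt (hΩ.mem_nhds hz)).hasDerivAt
    have hfg : ∀ᶠ w in 𝓝 (f z), f (g w) = w := by
      filter_upwards [hopen.mem_nhds (mem_image_of_mem f hz)]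
      rintro _ ⟨x, hx, rfl⟩
      rw [hg x hx]
    exact (HasDerivAt.of_local_left_inverse (continuousAt_of_leftInvOn hΩ hf hi hg hz)
      (by rwa [hg z hz]) hd hfg).differentiableAt
  rintro _ ⟨z, hz, rfl⟩
  refine DifferentiableAt.differentiableWithinAt ?_
  have han : AnalyticAt ℂ (deriv f) z := (hf.analyticAt (hΩ.mem_nhds hz)).deriv
  rcases han.eventually_eq_zero_or_eventually_ne_zero with h0 | h0
  · exfalso
    obtain ⟨r, hr, hr'⟩ := Metric.eventually_nhds_iff_ball.1 (h0.and (hΩ.mem_nhds hz))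
    refine not_eventually_const_of_injOn hΩ hi hz (f z) ?_
    filter_upwards [Metric.ball_mem_nhds z hr] with w hw
    refine (convex_ball z r).is_const_of_fderivWithin_eq_zero (𝕜 := ℂ)
      (hf.mono fun x hx => (hr' x hx).2) ?_ hw (mem_ball_self hr)
    intro x hx
    rw [fderivWithin_of_isOpen isOpen_ball hx]
    ext
    simpa using (hr' x hx).1
  · have h1 : ∀ᶠ w in 𝓝 (f z), w ≠ f z → DifferentiableAt ℂ g w := by
      rw [eventually_nhdsWithin_iff] at h0
      apply nhds_le_map_of_injOn hΩ hf hi hz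
      rw [mem_map]
      filter_upwards [h0, hΩ.mem_nhds hz] with w hw hwΩ hne
      exact key w hwΩ (hw fun h => hne (by rw [h]))
    exact (analyticAt_of_differentiable_on_punctured_nhds_of_continuousAt
      (eventually_nhdsWithin_iff.2 h1)
      (continuousAt_of_leftInvOn hΩ hf hi hg hz)).differentiableAt

theorem deriv_ne_zero_of_injOn {Ω : Set ℂ} {f : ℂ → ℂ} (hΩ : IsOpen Ω)
    (hf : DifferentiableOn ℂ f Ω) (hi : InjOn f Ω) {z : ℂ} (hz : z ∈ Ω) : deriv f z ≠ 0 := by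
  have hg : ∀ z ∈ Ω, Function.invFunOn f Ω (f z) = z := fun z hz => hi.leftInvOn_invFunOn hz
  have hd := (differentiableOn_of_leftInvOn hΩ hf hi hg).differentiableAt
    ((isOpen_image_of_injOn hΩ hf hi hΩ subset_rfl).mem_nhds (mem_image_of_mem f hz))
  have h1 := hd.hasDerivAt.comp z (hf.differentiableAt (hΩ.mem_nhds hz)).hasDerivAt
  have h2 : HasDerivAt (Function.invFunOn f Ω ∘ f) 1 z := by
    refine (hasDerivAt_id z).congr_of_eventuallyEq ?_
    filter_upwards [hΩ.mem_nhds hz] with w hw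
    exact hg w hw
  intro h
  simpa [h] using h1.unique h2

/-- `2πi` times the winding number about `p` of the image under `F` of the circle of radius `r`. -/
def windInt (F : ℂ → ℂ) (r : ℝ) (p : ℂ) : ℂ := ∮ ζ in C(0, r), deriv F ζ / (F ζ - p)

section Wind

variable {F : ℂ → ℂ} {r : ℝ}

theorem circleIntegrable_windInt (hr : 0 ≤ r) (hF : ∀ ζ ∈ sphere (0 : ℂ) r, AnalyticAt ℂ F ζ)
    {p : ℂ} (hp : p ∉ F '' sphere 0 r) :
    CircleIntegrable (fun ζ => deriv F ζ / (F ζ - p)) 0 r := by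
  refine ContinuousOn.circleIntegrable hr fun ζ hζ => ContinuousAt.continuousWithinAt ?_
  exact (hF ζ hζ).deriv.continuousAt.div ((hF ζ hζ).continuousAt.sub continuousAt_const)
    (sub_ne_zero.2 fun h => hp ⟨ζ, hζ, h⟩)

theorem windInt_eventually_eq (hr : 0 ≤ r) (hF : ∀ ζ ∈ sphere (0 : ℂ) r, AnalyticAt ℂ F ζ)
    {p : ℂ} (hp : p ∉ F '' sphere 0 r) : ∀ᶠ q in 𝓝 p, windInt F r q = windInt F r p := by
  have hcpt : IsCompact (F '' sphere 0 r) :=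
    (isCompact_sphere _ _).image_of_continuousOn
      fun ζ hζ => (hF ζ hζ).continuousAt.continuousWithinAt
  obtain ⟨ε, hε, hball⟩ := Metric.mem_nhds_iff.1 (hcpt.isClosed.isOpen_compl.mem_nhds hp)
  filter_upwards [Metric.ball_mem_nhds p hε] with q hq
  have hq' : q ∉ F '' sphere 0 r := hball hq
  rw [← sub_eq_zero, windInt, windInt, ← circleIntegral.integral_sub
    (circleIntegrable_windInt hr hF hq') (circleIntegrable_windInt hr hF hp)]
  refine circleIntegral.integral_eq_zero_of_hasDerivWithinAt
    (f := fun ζ => Complex.log ((F ζ - q) / (F ζ - p))) hr fun ζ hζ => ?_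
  have h1 : F ζ - p ≠ 0 := sub_ne_zero.2 fun h => hp ⟨ζ, hζ, h⟩
  have h2 : F ζ - q ≠ 0 := sub_ne_zero.2 fun h => hq' ⟨ζ, hζ, h⟩
  have hd := (hF ζ hζ).differentiableAt.hasDerivAt
  have hdist : ε ≤ ‖F ζ - p‖ := by
    by_contra! h
    exact hball (mem_ball_iff_norm.2 h) ⟨ζ, hζ, rfl⟩
  have hslit : (F ζ - q) / (F ζ - p) ∈ slitPlane := by
    have : (F ζ - q) / (F ζ - p) = 1 + (p - q) / (F ζ - p) := by field_simp; ring
    rw [this]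
    refine mem_slitPlane_of_norm_lt_one ?_
    rw [norm_div, div_lt_one (hε.trans_le hdist), norm_sub_rev]
    exact (mem_ball_iff_norm.1 hq).trans_le hdist
  refine HasDerivAt.hasDerivWithinAt ?_
  convert! (((hd.sub_const q).div (hd.sub_const p) h1).clog hslit) using 1
  simp only [Pi.div_apply]
  field_simp

theorem windInt_eq_of_isPreconnected (hr : 0 ≤ r)
    (hF : ∀ ζ ∈ sphere (0 : ℂ) r, AnalyticAt ℂ F ζ) {Y : Set ℂ} (hY : IsPreconnected Y)
    (hd : Disjoint Y (F '' sphere 0 r)) {p q : ℂ} (hp : p ∈ Y) (hq : q ∈ Y) :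
    windInt F r p = windInt F r q := by
  have : PreconnectedSpace Y := Subtype.preconnectedSpace hY
  have hl : IsLocallyConstant fun x : Y => windInt F r x := by
    rw [IsLocallyConstant.iff_eventually_eq]
    intro x
    exact continuous_subtype_val.continuousAt.eventually
      (windInt_eventually_eq hr hF (disjoint_left.1 hd x.2))
  exact hl.apply_eq_of_preconnectedSpace ⟨p, hp⟩ ⟨q, hq⟩

theorem windInt_eq_zero_of_lt_norm (hr : 0 ≤ r)
    (hF : ∀ ζ ∈ sphere (0 : ℂ) r, AnalyticAt ℂ F ζ) {p : ℂ}
    (hp : ∀ ζ ∈ sphere (0 : ℂ) r, ‖F ζ‖ < ‖p‖) : windInt F r p = 0 := by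
  refine circleIntegral.integral_eq_zero_of_hasDerivWithinAt
    (f := fun ζ => Complex.log (1 - F ζ / p)) hr fun ζ hζ => ?_
  have hp0 : 0 < ‖p‖ := (norm_nonneg _).trans_lt (hp ζ hζ)
  have hpne : p ≠ 0 := norm_pos_iff.1 hp0
  have h1 : F ζ - p ≠ 0 := sub_ne_zero.2 fun h => (hp ζ hζ).ne (by rw [h])
  have hslit : 1 - F ζ / p ∈ slitPlane := by
    rw [sub_eq_add_neg]
    refine mem_slitPlane_of_norm_lt_one ?_
    rw [norm_neg, norm_div, div_lt_one hp0]
    exact hp ζ hζ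
  refine HasDerivAt.hasDerivWithinAt ?_
  convert! ((((hF ζ hζ).differentiableAt.hasDerivAt.div_const p).const_sub 1).clog hslit) using 1
  have h2 : p - F ζ ≠ 0 := fun h => h1 (by linear_combination -h)
  field_simp
  ring

theorem windInt_eq_zero_of_simplyConnected (hr : 0 ≤ r)
    (hF : ∀ ζ ∈ sphere (0 : ℂ) r, AnalyticAt ℂ F ζ) {V : Set ℂ} (hV : IsOpen V)
    (hVs : IsSimplyConnected V) (hFV : MapsTo F (sphere 0 r) V) {p : ℂ} (hp : p ∉ V) :
    windInt F r p = 0 := by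
  obtain ⟨L, hLc, hL⟩ := exists_continuousOn_eqOn_exp_comp hVs hV
    (g := fun w => w - p) (by fun_prop) (by
      rintro ⟨w, hw, h⟩
      exact hp (sub_eq_zero.1 h ▸ hw))
  refine circleIntegral.integral_eq_zero_of_hasDerivWithinAt
    (f := fun ζ => L (F ζ)) hr fun ζ hζ => ?_
  have hmem : F ζ ∈ V := hFV hζ
  have hne : F ζ - p ≠ 0 := sub_ne_zero.2 fun h => hp (h ▸ hmem)
  have hLd : HasDerivAt (fun w => L (w + p)) (F ζ - p)⁻¹ (F ζ - p) := by
    have he : cexp (L (F ζ - p + p)) = F ζ - p := by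
      simpa using hL hmem
    have := HasDerivAt.of_local_left_inverse (f := cexp) (g := fun w => L (w + p))
      (f' := cexp (L (F ζ - p + p))) (a := F ζ - p) ?_ (Complex.hasDerivAt_exp _)
      (Complex.exp_ne_zero _) ?_
    · rwa [he] at this
    · refine ContinuousAt.comp (g := L) ?_ (by fun_prop)
      simpa using hLc.continuousAt (hV.mem_nhds hmem)
    · have : Tendsto (fun w => w + p) (𝓝 (F ζ - p)) (𝓝 (F ζ)) := by
        have : ContinuousAt (fun w => w + p) (F ζ - p) := by fun_prop
        simpa [ContinuousAt] using this
      filter_upwards [this (hV.mem_nhds hmem)] with w hw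
      simpa using hL hw
  have := hLd.comp ζ ((hF ζ hζ).differentiableAt.hasDerivAt.sub_const p)
  refine HasDerivAt.hasDerivWithinAt ?_
  convert! this using 1
  · ext w; simp
  · rw [div_eq_inv_mul]

/-- The argument principle for a univalent function on an annulus. -/
theorem windInt_sub_windInt {R r₁ r₂ : ℝ}
    (hF : DifferentiableOn ℂ F {ζ | 1 < ‖ζ‖ ∧ ‖ζ‖ < R}) (hi : InjOn F {ζ | 1 < ‖ζ‖ ∧ ‖ζ‖ < R})
    {ζ₀ : ℂ} (h1 : 1 < r₁) (h2 : r₁ < ‖ζ₀‖) (h3 : ‖ζ₀‖ < r₂) (h4 : r₂ < R) :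
    windInt F r₂ (F ζ₀) - windInt F r₁ (F ζ₀) = 2 * Real.pi * I := by
  set A : Set ℂ := {ζ | 1 < ‖ζ‖ ∧ ‖ζ‖ < R} with hA
  have hAo : IsOpen A :=
    (isOpen_lt continuous_const continuous_norm).inter (isOpen_lt continuous_norm continuous_const)
  have hζ₀ : ζ₀ ∈ A := ⟨h1.trans h2, h3.trans h4⟩
  set G := dslope F ζ₀ with hG
  have hGd : DifferentiableOn ℂ G A :=
    (Complex.differentiableOn_dslope (hAo.mem_nhds hζ₀)).2 hF
  have hG0 : ∀ ζ ∈ A, G ζ ≠ 0 := by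
    intro ζ hζ
    by_cases h : ζ = ζ₀
    · rw [h, hG, dslope_same]
      exact deriv_ne_zero_of_injOn hAo hF hi hζ₀
    · rw [hG, dslope_of_ne _ h, slope_def_field]
      exact div_ne_zero (sub_ne_zero.2 fun e => h (hi hζ hζ₀ e)) (sub_ne_zero.2 h)
  have hq : DifferentiableOn ℂ (fun ζ => deriv G ζ / G ζ) A :=
    (hGd.deriv hAo).div hGd hG0
  have hsub : ∀ r, r₁ ≤ r → r ≤ r₂ → sphere (0 : ℂ) r ⊆ A := by
    intro r hr hr' ζ hζ
    rw [mem_sphere_zero_iff_norm] at hζ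
    exact ⟨by linarith, by linarith⟩
  have hsplit : ∀ r, r₁ ≤ r → r ≤ r₂ → r ≠ ‖ζ₀‖ → windInt F r (F ζ₀) =
      (∮ ζ in C(0, r), (ζ - ζ₀)⁻¹) + ∮ ζ in C(0, r), deriv G ζ / G ζ := by
    intro r hr hr' hne
    have hr0 : 0 ≤ r := by linarith
    have hne' : ∀ ζ ∈ sphere (0 : ℂ) r, ζ - ζ₀ ≠ 0 := by
      intro ζ hζ h
      rw [sub_eq_zero.1 h, mem_sphere_zero_iff_norm] at hζ
      exact hne hζ.symm
    have hc : ContinuousOn (fun ζ => (ζ - ζ₀)⁻¹) (sphere 0 r) :=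
      ContinuousOn.inv₀ (by fun_prop) hne'
    rw [← circleIntegral.integral_add (hc.circleIntegrable hr0)
      (ContinuousOn.circleIntegrable hr0 (hq.continuousOn.mono (hsub r hr hr')))]
    refine circleIntegral.integral_congr hr0 fun ζ hζ => ?_
    have hζA := hsub r hr hr' hζ
    have hz := hne' ζ hζ
    have hfe : ∀ w, F w = (w - ζ₀) * G w + F ζ₀ := by
      intro w
      have := sub_smul_dslope F ζ₀ w
      simp only [smul_eq_mul] at this
      rw [hG, this]; ring
    have hd : HasDerivAt F (1 * G ζ + (ζ - ζ₀) * deriv G ζ) ζ := by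
      have h := (((hasDerivAt_id ζ).sub_const ζ₀).mul
        (hGd.differentiableAt (hAo.mem_nhds hζA)).hasDerivAt).add_const (F ζ₀)
      exact h.congr_of_eventuallyEq (Eventually.of_forall fun w => by simpa using hfe w)
    have hGz := hG0 ζ hζA
    rw [hd.deriv, show F ζ - F ζ₀ = (ζ - ζ₀) * G ζ by rw [hfe ζ]; ring]
    field_simp
  have hr0 : 0 < r₁ := by linarith
  have hle : r₁ ≤ r₂ := by linarith
  have hann : (∮ ζ in C(0, r₂), deriv G ζ / G ζ) = ∮ ζ in C(0, r₁), deriv G ζ / G ζ := by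
    have hsubA : closedBall (0 : ℂ) r₂ \ ball 0 r₁ ⊆ A := by
      intro ζ hζ
      simp only [Set.mem_sdiff, mem_closedBall_zero_iff, mem_ball_zero_iff, not_lt] at hζ
      exact ⟨by linarith, by linarith⟩
    refine Complex.circleIntegral_eq_of_differentiable_on_annulus_off_countable hr0 hle
      countable_empty (hq.continuousOn.mono hsubA) ?_
    intro ζ hζ
    refine hq.differentiableAt (hAo.mem_nhds (hsubA ?_))
    have := hζ.1
    simp only [Set.mem_sdiff, mem_closedBall_zero_iff, mem_ball_zero_iff, not_lt, not_le] at this ⊢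
    exact ⟨this.1.le, this.2.le⟩
  have hin : (∮ ζ in C(0, r₂), (ζ - ζ₀)⁻¹) = 2 * Real.pi * I :=
    circleIntegral.integral_sub_inv_of_mem_ball (by simpa using h3)
  have hout : (∮ ζ in C(0, r₁), (ζ - ζ₀)⁻¹) = 0 := by
    refine Complex.circleIntegral_eq_zero_of_differentiable_on_off_countable hr0.le
      countable_empty (ContinuousOn.inv₀ (by fun_prop) ?_) ?_
    · intro ζ hζ h
      rw [sub_eq_zero.1 h, mem_closedBall_zero_iff] at hζ
      linarith
    · intro ζ hζ
      have : ζ - ζ₀ ≠ 0 := by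
        intro h
        have := hζ.1
        rw [sub_eq_zero.1 h, mem_ball_zero_iff] at this
        linarith
      exact (differentiableAt_id.sub_const ζ₀).inv this
  rw [hsplit r₂ hle le_rfl h3.ne', hsplit r₁ le_rfl hle h2.ne, hann, hin, hout]
  ring

end Wind

/-- The sum of the distances to the foci `a`, `b`, normalised by the focal distance. -/
def focal (a b z : ℂ) : ℝ := (‖z - a‖ + ‖z - b‖) / ‖b - a‖

/-- The closed elliptical disc with foci `a`, `b`; for `s = 1` it is the segment `[a, b]`. -/
def ell (a b : ℂ) (s : ℝ) : Set ℂ := {z | focal a b z ≤ s}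

/-- The Joukowski map from `{1 < |ζ|}` onto the complement of the segment `[a, b]`. -/
def jouk (a b ζ : ℂ) : ℂ := (a + b) / 2 + (b - a) / 4 * (ζ + ζ⁻¹)

/-- The level of `focal` on the image under `jouk` of the circle of radius `r`. -/
def jlev (r : ℝ) : ℝ := (r + r⁻¹) / 2

theorem continuous_focal (a b : ℂ) : Continuous (focal a b) := by
  unfold focal
  fun_prop

theorem isClosed_ell (a b : ℂ) (s : ℝ) : IsClosed (ell a b s) :=
  isClosed_le (continuous_focal a b) continuous_const

theorem isOpen_focal_lt (a b : ℂ) (s : ℝ) : IsOpen {z | focal a b z < s} :=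
  isOpen_lt (continuous_focal a b) continuous_const

theorem ell_mono {a b : ℂ} {s t : ℝ} (h : s ≤ t) : ell a b s ⊆ ell a b t :=
  fun z hz => le_trans (show focal a b z ≤ s from hz) h

theorem isCompact_ell {a b : ℂ} (hab : a ≠ b) (s : ℝ) : IsCompact (ell a b s) := by
  refine Metric.isCompact_of_isClosed_isBounded (isClosed_ell a b s) ?_
  refine (Metric.isBounded_closedBall (x := a) (r := s * ‖b - a‖)).subset fun z hz => ?_
  have h0 : 0 < ‖b - a‖ := norm_pos_iff.2 (sub_ne_zero.2 hab.symm)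
  have hz' : (‖z - a‖ + ‖z - b‖) / ‖b - a‖ ≤ s := hz
  rw [div_le_iff₀ h0] at hz'
  rw [mem_closedBall_iff_norm]
  linarith [norm_nonneg (z - b)]

theorem one_le_focal {a b : ℂ} (hab : a ≠ b) (z : ℂ) : 1 ≤ focal a b z := by
  have h0 : 0 < ‖b - a‖ := norm_pos_iff.2 (sub_ne_zero.2 hab.symm)
  rw [focal, le_div_iff₀ h0, one_mul]
  calc ‖b - a‖ = ‖(z - a) - (z - b)‖ := by congr 1; ring
    _ ≤ _ := norm_sub_le _ _

theorem convexOn_focal (a b : ℂ) : ConvexOn ℝ univ (focal a b) := by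
  have h : ∀ c : ℂ, ConvexOn ℝ univ fun z : ℂ => ‖z - c‖ := fun c => by
    simpa [dist_eq_norm] using convexOn_univ_dist c
  have := ((h a).add (h b)).smul (inv_nonneg.2 (norm_nonneg (b - a)))
  refine this.congr fun z _ => ?_
  simp [focal, div_eq_inv_mul]

theorem convex_ell (a b : ℂ) (s : ℝ) : Convex ℝ (ell a b s) := by
  simpa [ell] using (convexOn_focal a b).convex_le s

theorem jouk_sub_left {a b ζ : ℂ} (hζ : ζ ≠ 0) :
    jouk a b ζ - a = (b - a) / 4 * ((ζ + 1) ^ 2 / ζ) := by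
  rw [jouk]; field_simp; ring

theorem jouk_sub_right {a b ζ : ℂ} (hζ : ζ ≠ 0) :
    jouk a b ζ - b = (b - a) / 4 * ((ζ - 1) ^ 2 / ζ) := by
  rw [jouk]; field_simp; ring

theorem focal_jouk {a b ζ : ℂ} (hab : a ≠ b) (hζ : ζ ≠ 0) :
    focal a b (jouk a b ζ) = jlev ‖ζ‖ := by
  have h0 : ‖b - a‖ ≠ 0 := norm_ne_zero_iff.2 (sub_ne_zero.2 hab.symm)
  have h1 : ‖ζ‖ ≠ 0 := norm_ne_zero_iff.2 hζ
  rw [focal, jouk_sub_left hζ, jouk_sub_right hζ, jlev]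
  simp only [norm_mul, norm_div, norm_pow]
  have hp := parallelogram_law_with_norm ℝ ζ 1
  simp only [norm_one] at hp
  have h4 : ‖(4 : ℂ)‖ = 4 := by simp
  rw [h4]
  field_simp
  linarith

theorem jlev_lt_jlev {r s : ℝ} (hr : 1 ≤ r) (hrs : r < s) : jlev r < jlev s := by
  have h1 : 0 < r := by linarith
  have h2 : 0 < s := by linarith
  have : jlev s - jlev r = (s - r) * (r * s - 1) / (2 * r * s) := by
    rw [jlev, jlev]; field_simp; ring
  have h3 : 0 < r * s - 1 := by nlinarith
  have h4 : 0 < jlev s - jlev r := by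
    rw [this]
    have : 0 < s - r := by linarith
    positivity
  linarith

theorem jlev_le_jlev {r s : ℝ} (hr : 1 ≤ r) (hrs : r ≤ s) : jlev r ≤ jlev s := by
  rcases hrs.eq_or_lt with h | h
  · rw [h]
  · exact (jlev_lt_jlev hr h).le

theorem jlev_one : jlev 1 = 1 := by norm_num [jlev]

theorem one_lt_jlev {r : ℝ} (hr : 1 < r) : 1 < jlev r := by
  simpa [jlev_one] using jlev_lt_jlev le_rfl hr

theorem jlev_lt_self {s : ℝ} (hs : 1 < s) : jlev s < s := by
  have : s⁻¹ < 1 := inv_lt_one_of_one_lt₀ hs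
  rw [jlev]; linarith

theorem lt_of_jlev_lt {r s : ℝ} (hs : 1 ≤ s) (h : jlev r < jlev s) : r < s := by
  by_contra! h'
  exact absurd (jlev_le_jlev hs h') (not_le.2 h)

theorem exists_jouk_eq {a b z : ℂ} (hab : a ≠ b) (hz : 1 < focal a b z) :
    ∃ ζ : ℂ, 1 < ‖ζ‖ ∧ jouk a b ζ = z := by
  have hba : b - a ≠ 0 := sub_ne_zero.2 hab.symm
  set w : ℂ := 4 * (z - (a + b) / 2) / (b - a) with hw
  obtain ⟨t, ht⟩ : ∃ t : ℂ, t ^ 2 = w ^ 2 - 4 := IsAlgClosed.exists_pow_nat_eq _ two_pos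
  set ζ : ℂ := (w + t) / 2 with hζ
  have hprod : ζ * (w - ζ) = 1 := by
    rw [hζ]; linear_combination -ht / 4
  have hζ0 : ζ ≠ 0 := left_ne_zero_of_mul_eq_one hprod
  have hinv : ζ⁻¹ = w - ζ := inv_eq_of_mul_eq_one_right hprod
  have hj : jouk a b ζ = z := by
    rw [jouk, hinv, hw]; field_simp; ring
  have hj' : jouk a b ζ⁻¹ = z := by
    rw [← hj, jouk, jouk, inv_inv, add_comm ζ⁻¹]
  rcases lt_trichotomy ‖ζ‖ 1 with h | h | h
  · refine ⟨ζ⁻¹, ?_, hj'⟩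
    rw [norm_inv]
    exact (one_lt_inv₀ (norm_pos_iff.2 hζ0)).2 h
  · rw [← hj, focal_jouk hab hζ0, h, jlev_one] at hz
    exact absurd hz (lt_irrefl _)
  · exact ⟨ζ, h, hj⟩

theorem injOn_jouk {a b : ℂ} (hab : a ≠ b) : InjOn (jouk a b) {ζ | 1 < ‖ζ‖} := by
  intro ζ hζ ξ hξ h
  have hba : b - a ≠ 0 := sub_ne_zero.2 hab.symm
  have h1 : ζ ≠ 0 := norm_pos_iff.1 (one_pos.trans hζ)
  have h2 : ξ ≠ 0 := norm_pos_iff.1 (one_pos.trans hξ)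
  have h3 : ζ + ζ⁻¹ = ξ + ξ⁻¹ := by
    rw [jouk, jouk] at h
    exact mul_left_cancel₀ (div_ne_zero hba (by norm_num)) (add_left_cancel h)
  have h4 : (ζ - ξ) * (ζ * ξ - 1) = 0 := by
    field_simp at h3
    linear_combination h3
  rcases mul_eq_zero.1 h4 with h5 | h5
  · exact sub_eq_zero.1 h5
  · exfalso
    have h6 : ‖ζ‖ * ‖ξ‖ = 1 := by rw [← norm_mul, sub_eq_zero.1 h5, norm_one]
    have hζ' : 1 < ‖ζ‖ := hζ
    have hξ' : 1 < ‖ξ‖ := hξ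
    nlinarith

theorem differentiableAt_jouk (a b : ℂ) {ζ : ℂ} (hζ : ζ ≠ 0) :
    DifferentiableAt ℂ (jouk a b) ζ := by
  unfold jouk
  fun_prop (disch := assumption)

theorem isPreconnected_norm_mem {S : Set ℝ} (hS : S.OrdConnected) (hpos : S ⊆ Ioi 0) :
    IsPreconnected {ζ : ℂ | ‖ζ‖ ∈ S} := by
  have : {ζ : ℂ | ‖ζ‖ ∈ S} =
      (fun p : ℝ × ℝ => (p.1 : ℂ) * cexp (p.2 * I)) '' (S ×ˢ univ) := by
    ext ζ
    constructor
    · intro h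
      exact ⟨(‖ζ‖, arg ζ), ⟨h, mem_univ _⟩, norm_mul_exp_arg_mul_I ζ⟩
    · rintro ⟨⟨r, θ⟩, ⟨hr, -⟩, rfl⟩
      have : 0 < r := hpos hr
      simpa [norm_exp_ofReal_mul_I, abs_of_pos this] using hr
  rw [this]
  exact (hS.isPreconnected.prod isPreconnected_univ).image _ (by fun_prop)

theorem isPreconnected_focal_mem {a b : ℂ} (hab : a ≠ b) {S : Set ℝ} (hS : S.OrdConnected)
    (hS1 : S ⊆ Ioi 1) : IsPreconnected {z : ℂ | focal a b z ∈ S} := by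
  have hset : {z : ℂ | focal a b z ∈ S} =
      jouk a b '' {ζ | ‖ζ‖ ∈ {r : ℝ | 1 < r ∧ jlev r ∈ S}} := by
    ext z
    constructor
    · intro h
      obtain ⟨ζ, hζ, rfl⟩ := exists_jouk_eq hab (hS1 h)
      refine ⟨ζ, ⟨hζ, ?_⟩, rfl⟩
      rw [← focal_jouk hab (norm_pos_iff.1 (one_pos.trans hζ))]
      exact h
    · rintro ⟨ζ, ⟨hζ, h⟩, rfl⟩
      rw [mem_ofPred_eq, focal_jouk hab (norm_pos_iff.1 (one_pos.trans hζ))]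
      exact h
  rw [hset]
  refine (isPreconnected_norm_mem ⟨?_⟩ fun r hr => one_pos.trans hr.1).image _ ?_
  · intro r hr s hs t ht
    have h1 : 1 < t := hr.1.trans_le ht.1
    exact ⟨h1, hS.out hr.2 hs.2 ⟨jlev_le_jlev hr.1.le ht.1, jlev_le_jlev h1.le ht.2⟩⟩
  · intro ζ hζ
    exact (differentiableAt_jouk a b
      (norm_pos_iff.1 (one_pos.trans hζ.1))).continuousAt.continuousWithinAt

theorem exists_ell_subset {a b : ℂ} (hab : a ≠ b) {s : ℝ} {O : Set ℂ} (hO : IsOpen O)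
    (h : ell a b s ⊆ O) : ∃ t > s, ell a b t ⊆ O := by
  have hc : IsCompact (ell a b (s + 1) \ O) := (isCompact_ell hab _).diff hO
  rcases (ell a b (s + 1) \ O).eq_empty_or_nonempty with he | hne
  · exact ⟨s + 1, by linarith, sdiff_eq_empty.1 he⟩
  · obtain ⟨z, hz, hmin⟩ := hc.exists_isMinOn hne (continuous_focal a b).continuousOn
    have hzs : s < focal a b z := by
      by_contra! h'
      exact hz.2 (h h')
    have hz1 : focal a b z ≤ s + 1 := hz.1
    refine ⟨(s + focal a b z) / 2, by linarith, fun w hw => ?_⟩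
    by_contra hwO
    have hw' : focal a b w ≤ (s + focal a b z) / 2 := hw
    have h2 : focal a b z ≤ focal a b w := hmin ⟨by change focal a b w ≤ s + 1; linarith, hwO⟩
    linarith

theorem isPreconnected_sdiff {U E O : Set ℂ} (hU : IsOpen U) (hUp : IsPreconnected U)
    (hE : IsClosed E) (hO : IsOpen O) (hEO : E ⊆ O) (hOU : O ⊆ U) (hOE : IsPreconnected (O \ E)) :
    IsPreconnected (U \ E) := by
  have aux : ∀ u v : Set ℂ, IsOpen u → IsOpen v → U \ E ⊆ u ∪ v → (U \ E) ∩ (u ∩ v) = ∅ →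
      O \ E ⊆ u → U \ E ⊆ u ∨ U \ E ⊆ v := by
    intro u v hu hv huv hd hOu
    have hUE : IsOpen (U \ E) := hU.sdiff hE
    have hcov : U ⊆ (u ∩ (U \ E) ∪ O) ∪ v ∩ (U \ E) := by
      intro z hz
      by_cases hzE : z ∈ E
      · exact Or.inl (Or.inr (hEO hzE))
      · rcases huv ⟨hz, hzE⟩ with h | h
        · exact Or.inl (Or.inl ⟨h, hz, hzE⟩)
        · exact Or.inr ⟨h, hz, hzE⟩
    have hdisj : U ∩ ((u ∩ (U \ E) ∪ O) ∩ (v ∩ (U \ E))) = ∅ := by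
      rw [eq_empty_iff_forall_notMem]
      rintro z ⟨hz, h1 | h1, h2⟩
      · exact eq_empty_iff_forall_notMem.1 hd z ⟨h1.2, h1.1, h2.1⟩
      · exact eq_empty_iff_forall_notMem.1 hd z ⟨h2.2, hOu ⟨h1, h2.2.2⟩, h2.1⟩
    rcases isPreconnected_iff_subset_of_disjoint.1 hUp _ _
      ((hu.inter hUE).union hO) (hv.inter hUE) hcov hdisj with h | h
    · left
      intro z hz
      rcases h hz.1 with h' | h'
      · exact h'.1
      · exact hOu ⟨h', hz.2⟩
    · right
      intro z hz
      exact (h hz.1).1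
  rw [isPreconnected_iff_subset_of_disjoint]
  intro u v hu hv huv hd
  have hsub : O \ E ⊆ U \ E := sdiff_subset_sdiff_left hOU
  rcases isPreconnected_iff_subset_of_disjoint.1 hOE u v hu hv (hsub.trans huv)
    (subset_empty_iff.1 (hd ▸ inter_subset_inter_left _ hsub)) with h | h
  · exact aux u v hu hv huv hd h
  · exact (aux v u hv hu (union_comm u v ▸ huv) (inter_comm u v ▸ hd) h).symm

theorem isPreconnected_sdiff_iUnion_ell {ι : Type*} [Finite ι] {V : Set ℂ} (hV : IsOpen V)
    (hVp : IsPreconnected V) {a b : ι → ℂ} {s : ι → ℝ} (hab : ∀ j, a j ≠ b j)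
    (hs : ∀ j, 1 ≤ s j) (hsub : ∀ j, ell (a j) (b j) (s j) ⊆ V)
    (hd : Pairwise fun i j => Disjoint (ell (a i) (b i) (s i)) (ell (a j) (b j) (s j))) :
    IsPreconnected (V \ ⋃ j, ell (a j) (b j) (s j)) := by
  classical
  have := Fintype.ofFinite ι
  have key : ∀ S : Finset ι, IsPreconnected (V \ ⋃ j ∈ S, ell (a j) (b j) (s j)) := by
    intro S
    induction S using Finset.induction_on with
    | empty => simpa using hVp
    | insert i S hi ih =>
      have hU : IsOpen (V \ ⋃ j ∈ S, ell (a j) (b j) (s j)) :=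
        hV.sdiff (S.finite_toSet.isClosed_biUnion fun j _ => isClosed_ell _ _ _)
      have hsubU : ell (a i) (b i) (s i) ⊆ V \ ⋃ j ∈ S, ell (a j) (b j) (s j) := by
        intro z hz
        refine ⟨hsub i hz, fun h => ?_⟩
        simp only [mem_iUnion] at h
        obtain ⟨j, hj, hzj⟩ := h
        exact disjoint_left.1 (hd (show i ≠ j from fun e => hi (e ▸ hj))) hz hzj
      obtain ⟨t, ht, htU⟩ := exists_ell_subset (hab i) hU hsubU
      rw [Finset.set_biUnion_insert, union_comm, ← sdiff_sdiff]
      refine isPreconnected_sdiff hU ih (isClosed_ell _ _ _) (isOpen_focal_lt (a i) (b i) t)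
        (fun z hz => lt_of_le_of_lt (show _ ≤ s i from hz) ht)
        (fun z hz => htU (show focal _ _ z ≤ t from le_of_lt hz)) ?_
      have : {z | focal (a i) (b i) z < t} \ ell (a i) (b i) (s i) =
          {z | focal (a i) (b i) z ∈ Ioo (s i) t} := by
        ext z
        simp [ell, and_comm]
      rw [this]
      exact isPreconnected_focal_mem (hab i) ordConnected_Ioo
        fun x hx => (hs i).trans_lt hx.1
  simpa using key Finset.univ

/-- The segments `[a j, b j]` are nondegenerate, pairwise disjoint and contained in `V`. -/
structure IsSlitFamily {ι : Type*} (V : Set ℂ) (a b : ι → ℂ) : Prop where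
  ne : ∀ j, a j ≠ b j
  sub : ∀ j, ell (a j) (b j) 1 ⊆ V
  disj : Pairwise fun i j => Disjoint (ell (a i) (b i) 1) (ell (a j) (b j) 1)

/-- The union of the segments `[a j, b j]`. -/
def slits {ι : Type*} (a b : ι → ℂ) : Set ℂ := ⋃ j, ell (a j) (b j) 1

theorem ell_sdiff_subset {ι : Type*} {V : Set ℂ} {a b : ι → ℂ} {s : ι → ℝ} (hs : ∀ j, 1 ≤ s j)
    (hsub : ∀ j, ell (a j) (b j) (s j) ⊆ V)
    (hd : Pairwise fun i j => Disjoint (ell (a i) (b i) (s i)) (ell (a j) (b j) (s j))) (j : ι) :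
    ell (a j) (b j) (s j) \ ell (a j) (b j) 1 ⊆ V \ slits a b := by
  refine fun z hz => ⟨hsub j hz.1, fun hmem => ?_⟩
  obtain ⟨i, hi⟩ := mem_iUnion.1 hmem
  by_cases hij : i = j
  · exact hz.2 (hij ▸ hi)
  · exact disjoint_left.1 (hd hij) (ell_mono (hs i) hi) hz.1

namespace IsSlitFamily

variable {ι : Type*} [Finite ι] {V : Set ℂ} {a b : ι → ℂ}

theorem isCompact_slits (h : IsSlitFamily V a b) : IsCompact (slits a b) :=
  isCompact_iUnion fun j => isCompact_ell (h.ne j) 1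

theorem isOpen_sdiff (h : IsSlitFamily V a b) (hV : IsOpen V) : IsOpen (V \ slits a b) :=
  hV.sdiff h.isCompact_slits.isClosed

/-- Arbitrarily thin pairwise disjoint elliptical neighbourhoods of the slits. -/
theorem exists_disjoint_ells (h : IsSlitFamily V a b) {O : ι → Set ℂ} (hO : ∀ j, IsOpen (O j))
    (hsub : ∀ j, ell (a j) (b j) 1 ⊆ O j) :
    ∃ s : ι → ℝ, (∀ j, 1 < s j) ∧ (∀ j, ell (a j) (b j) (s j) ⊆ O j) ∧
      Pairwise fun i j => Disjoint (ell (a i) (b i) (s i)) (ell (a j) (b j) (s j)) := by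
  have hsep : ∀ i j, ∃ U W : Set ℂ, IsOpen U ∧ IsOpen W ∧ ell (a i) (b i) 1 ⊆ U ∧
      ell (a j) (b j) 1 ⊆ W ∧ (i ≠ j → Disjoint U W) := by
    intro i j
    by_cases hij : i = j
    · exact ⟨univ, univ, isOpen_univ, isOpen_univ, subset_univ _, subset_univ _,
        fun h => absurd hij h⟩
    · obtain ⟨U, W, hU, hW, h1, h2, h3⟩ := SeparatedNhds.of_isCompact_isCompact
        (isCompact_ell (h.ne i) 1) (isCompact_ell (h.ne j) 1) (h.disj hij)
      exact ⟨U, W, hU, hW, h1, h2, fun _ => h3⟩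
  choose U W hU hW hUs hWs hUW using hsep
  have hex : ∀ j, ∃ t > 1, ell (a j) (b j) t ⊆ O j ∩ ((⋂ i, U j i) ∩ ⋂ i, W i j) := by
    intro j
    refine exists_ell_subset (h.ne j) ((hO j).inter ((isOpen_iInter_of_finite fun i => hU j i).inter
      (isOpen_iInter_of_finite fun i => hW i j))) ?_
    exact subset_inter (hsub j) (subset_inter (subset_iInter fun i => hUs j i)
      (subset_iInter fun i => hWs i j))
  choose s hs1 hs using hex
  refine ⟨s, hs1, fun j => (hs j).trans inter_subset_left, fun i j hij => ?_⟩
  refine (hUW i j hij).mono (fun z hz => ?_) (fun z hz => ?_)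
  · exact mem_iInter.1 (hs i hz).2.1 j
  · exact mem_iInter.1 (hs j hz).2.2 i

theorem isPreconnected_sdiff (h : IsSlitFamily V a b) (hV : IsOpen V) (hVp : IsPreconnected V) :
    IsPreconnected (V \ slits a b) :=
  isPreconnected_sdiff_iUnion_ell hV hVp h.ne (fun _ => le_rfl) h.sub h.disj

/-- The complement of one elliptical neighbourhood of a slit, and of the other slits. -/
theorem isPreconnected_sdiff_ell (h : IsSlitFamily V a b) (hV : IsOpen V) (hVp : IsPreconnected V)
    {s : ι → ℝ} (hs : ∀ j, 1 ≤ s j) (hsub : ∀ j, ell (a j) (b j) (s j) ⊆ V)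
    (hd : Pairwise fun i j => Disjoint (ell (a i) (b i) (s i)) (ell (a j) (b j) (s j))) (j : ι)
    {t : ℝ} (ht : 1 ≤ t) (hts : t ≤ s j) :
    IsPreconnected ((V \ slits a b) \ ell (a j) (b j) t) := by
  classical
  have heq : (V \ slits a b) \ ell (a j) (b j) t =
      V \ ⋃ i, ell (a i) (b i) (Function.update (fun _ => (1 : ℝ)) j t i) := by
    ext z
    simp only [slits, Set.mem_sdiff, mem_iUnion, not_exists, and_assoc]
    refine and_congr_right fun _ => ⟨fun hz i => ?_, fun hz => ⟨fun i hi => ?_, ?_⟩⟩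
    · by_cases hij : i = j
      · subst hij; simpa using hz.2
      · simpa [hij] using hz.1 i
    · refine hz i (ell_mono ?_ hi)
      by_cases hij : i = j
      · subst hij; simpa using ht
      · simp [hij]
    · simpa using hz j
  have hle : ∀ i, Function.update (fun _ => (1 : ℝ)) j t i ≤ s i := by
    intro i
    by_cases hij : i = j
    · subst hij; simpa using hts
    · simpa [hij] using hs i
  rw [heq]
  refine isPreconnected_sdiff_iUnion_ell hV hVp h.ne (fun i => ?_)
    (fun i => (ell_mono (hle i)).trans (hsub i))
    (fun i k hik => (hd hik).mono (ell_mono (hle i)) (ell_mono (hle k)))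
  by_cases hij : i = j
  · subst hij; simpa using ht
  · simp [hij]

/-- A univalent map from a slit domain, unbounded at infinity, onto the complement of `K` in a
simply connected domain sends a neighbourhood of each slit into a prescribed neighbourhood
of `K`. -/
theorem exists_mapsTo_nhds (h : IsSlitFamily V a b) (hV : IsOpen V) (hVp : IsPreconnected V)
    {V' K : Set ℂ} (hV' : IsOpen V') (hV's : IsSimplyConnected V') {f : ℂ → ℂ}
    (hf : DifferentiableOn ℂ f (V \ slits a b)) (hi : InjOn f (V \ slits a b))
    (him : f '' (V \ slits a b) = V' \ K)
    (hinf : ∀ M : ℝ, ∃ z ∈ V \ slits a b, M < ‖z‖ ∧ M < ‖f z‖) (j : ι) {O : Set ℂ}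
    (hO : IsOpen O) (hKO : K ⊆ O) :
    ∃ t > 1, MapsTo f (ell (a j) (b j) t \ ell (a j) (b j) 1) O := by
  obtain ⟨s, hs1, hsV, hsd⟩ := h.exists_disjoint_ells (fun _ => hV) h.sub
  have hs1' : ∀ j, 1 ≤ s j := fun j => (hs1 j).le
  set X := V \ slits a b with hX
  have hXo : IsOpen X := h.isOpen_sdiff hV
  set J := jouk (a j) (b j) with hJ
  have hne0 : ∀ {ζ : ℂ}, 1 < ‖ζ‖ → ζ ≠ 0 := fun h => norm_pos_iff.1 (one_pos.trans h)
  have hfoc : ∀ ζ : ℂ, 1 < ‖ζ‖ → focal (a j) (b j) (J ζ) = jlev ‖ζ‖ :=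
    fun ζ hζ => focal_jouk (h.ne j) (hne0 hζ)
  have hmaps : MapsTo J {ζ | 1 < ‖ζ‖ ∧ ‖ζ‖ < s j} X := by
    intro ζ hζ
    refine ell_sdiff_subset hs1' hsV hsd j ⟨?_, ?_⟩
    · change focal _ _ _ ≤ _
      rw [hfoc ζ hζ.1]
      exact (jlev_le_jlev hζ.1.le hζ.2.le).trans (jlev_lt_self (hs1 j)).le
    · change ¬ focal _ _ _ ≤ _
      rw [hfoc ζ hζ.1, not_le]
      exact one_lt_jlev hζ.1
  set F := f ∘ J with hFdef
  have hAo : IsOpen {ζ : ℂ | 1 < ‖ζ‖ ∧ ‖ζ‖ < s j} :=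
    (isOpen_lt continuous_const continuous_norm).inter (isOpen_lt continuous_norm continuous_const)
  have hFd : DifferentiableOn ℂ F {ζ | 1 < ‖ζ‖ ∧ ‖ζ‖ < s j} :=
    hf.comp (fun ζ hζ => (differentiableAt_jouk _ _ (hne0 hζ.1)).differentiableWithinAt) hmaps
  have hFi : InjOn F {ζ | 1 < ‖ζ‖ ∧ ‖ζ‖ < s j} :=
    hi.comp ((injOn_jouk (h.ne j)).mono fun ζ hζ => hζ.1) hmaps
  have hFa : ∀ r, 1 < r → r < s j → ∀ ζ ∈ sphere (0 : ℂ) r, AnalyticAt ℂ F ζ := by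
    intro r hr hr' ζ hζ
    rw [mem_sphere_zero_iff_norm] at hζ
    exact hFd.analyticAt (hAo.mem_nhds ⟨by linarith, by linarith⟩)
  have hbdd : ∀ r, 1 < r → r < s j → ∃ M, ∀ ζ ∈ sphere (0 : ℂ) r, ‖F ζ‖ ≤ M := fun r hr hr' =>
    (isCompact_sphere (0 : ℂ) r).exists_bound_of_continuousOn
      fun ζ hζ => (hFa r hr hr' ζ hζ).continuousAt.continuousWithinAt
  set r₂ := (1 + s j) / 2 with hr₂
  have hr₂1 : 1 < r₂ := by linarith [hs1 j]
  have hr₂s : r₂ < s j := by linarith [hs1 j]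
  have claim : ∀ ζ : ℂ, 1 < ‖ζ‖ → ‖ζ‖ < r₂ → windInt F r₂ (F ζ) = 2 * Real.pi * I := by
    intro ζ hζ hζ'
    set r₁ := (1 + ‖ζ‖) / 2 with hr₁
    have h1 : 1 < r₁ := by linarith
    have h2 : r₁ < ‖ζ‖ := by linarith
    have h3 : r₁ < s j := by linarith
    rw [← windInt_sub_windInt hFd hFi h1 h2 hζ' hr₂s, eq_comm, sub_eq_self]
    have hYp : IsPreconnected (X \ ell (a j) (b j) (jlev r₁)) :=
      h.isPreconnected_sdiff_ell hV hVp hs1' hsV hsd j (one_lt_jlev h1).le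
        (((jlev_lt_jlev h1.le h3).trans (jlev_lt_self (hs1 j))).le)
    obtain ⟨M, hM⟩ := hbdd r₁ h1 h3
    obtain ⟨M', hM'⟩ := (isCompact_ell (h.ne j) (jlev r₁)).isBounded.exists_norm_le
    obtain ⟨z, hzX, hz1, hz2⟩ := hinf (max M M')
    have hzY : z ∈ X \ ell (a j) (b j) (jlev r₁) :=
      ⟨hzX, fun hmem => absurd (hM' z hmem) (not_le.2 ((le_max_right _ _).trans_lt hz1))⟩
    have hζY : J ζ ∈ X \ ell (a j) (b j) (jlev r₁) := by
      refine ⟨hmaps ⟨hζ, hζ'.trans hr₂s⟩, ?_⟩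
      change ¬ focal _ _ _ ≤ _
      rw [hfoc ζ hζ, not_le]
      exact jlev_lt_jlev h1.le h2
    have hpre : IsPreconnected (f '' (X \ ell (a j) (b j) (jlev r₁))) :=
      hYp.image f (hf.continuousOn.mono sdiff_subset)
    have hdis : Disjoint (f '' (X \ ell (a j) (b j) (jlev r₁))) (F '' sphere 0 r₁) := by
      rw [disjoint_left]
      rintro _ ⟨x, hx, rfl⟩ ⟨ξ, hξ, hξx⟩
      rw [mem_sphere_zero_iff_norm] at hξ
      have hξA : J ξ ∈ X := hmaps ⟨by linarith, by linarith⟩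
      have hxx := hi hξA hx.1 hξx
      refine hx.2 ?_
      rw [← hxx]
      change focal _ _ _ ≤ _
      rw [hfoc ξ (by linarith), hξ]
    change windInt F r₁ (f (J ζ)) = 0
    rw [windInt_eq_of_isPreconnected (by linarith) (hFa r₁ h1 h3) hpre hdis
      (mem_image_of_mem f hζY) (mem_image_of_mem f hzY)]
    exact windInt_eq_zero_of_lt_norm (by linarith) (hFa r₁ h1 h3)
      fun ξ hξ => (hM ξ hξ).trans_lt ((le_max_left _ _).trans_lt hz2)
  by_contra! hcon
  have hseq : ∀ n : ℕ, ∃ z, 1 < focal (a j) (b j) z ∧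
      focal (a j) (b j) z ≤ 1 + (jlev r₂ - 1) / (n + 2) ∧ f z ∉ O := by
    intro n
    have hpos : 0 < (jlev r₂ - 1) / (n + 2 : ℝ) :=
      div_pos (by linarith [one_lt_jlev hr₂1]) (by positivity)
    have := hcon (1 + (jlev r₂ - 1) / (n + 2)) (by linarith)
    simp only [MapsTo, not_forall] at this
    obtain ⟨z, hz, hzO⟩ := this
    exact ⟨z, not_le.1 hz.2, hz.1, hzO⟩
  choose z hz1 hz2 hzO using hseq
  have hzζ : ∀ n, ∃ ζ : ℂ, 1 < ‖ζ‖ ∧ ‖ζ‖ < r₂ ∧ J ζ = z n := by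
    intro n
    obtain ⟨ζ, hζ, hζz⟩ := exists_jouk_eq (h.ne j) (hz1 n)
    refine ⟨ζ, hζ, lt_of_jlev_lt hr₂1.le ?_, hζz⟩
    rw [← hfoc ζ hζ, hJ, hζz]
    refine (hz2 n).trans_lt ?_
    have hp : 0 < jlev r₂ - 1 := by linarith [one_lt_jlev hr₂1]
    have : (jlev r₂ - 1) / (n + 2 : ℝ) < jlev r₂ - 1 :=
      div_lt_self hp (by linarith [(Nat.cast_nonneg n : (0 : ℝ) ≤ n)])
    linarith
  choose ζ hζ1 hζ2 hζz using hzζ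
  have hzX : ∀ n, z n ∈ X := fun n => hζz n ▸ hmaps ⟨hζ1 n, (hζ2 n).trans hr₂s⟩
  have hwind : ∀ n, windInt F r₂ (f (z n)) = 2 * Real.pi * I := by
    intro n
    rw [← claim (ζ n) (hζ1 n) (hζ2 n), hFdef, Function.comp, hζz]
  obtain ⟨M, hM⟩ := hbdd r₂ hr₂1 hr₂s
  have hbd : ∀ n, f (z n) ∈ closedBall (0 : ℂ) M := by
    intro n
    by_contra hn
    rw [mem_closedBall_zero_iff, not_le] at hn
    have := windInt_eq_zero_of_lt_norm (by linarith) (hFa r₂ hr₂1 hr₂s)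
      (fun ξ hξ => (hM ξ hξ).trans_lt hn)
    rw [hwind n] at this
    exact two_pi_I_ne_zero this
  obtain ⟨p, -, φ, hφ, hlim⟩ := tendsto_subseq_of_bounded isBounded_closedBall hbd
  have hpO : p ∉ O := by
    have : p ∈ Oᶜ := hO.isClosed_compl.mem_of_tendsto hlim (Eventually.of_forall fun n => hzO _)
    exact this
  have hpim : p ∉ f '' X := by
    rintro ⟨x, hx, rfl⟩
    have hg : ∀ z ∈ X, Function.invFunOn f X (f z) = z := fun z hz => hi.leftInvOn_invFunOn hz
    have hcont := continuousAt_of_leftInvOn hXo hf hi hg hx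
    have h1 := hcont.tendsto.comp hlim
    rw [hg x hx] at h1
    have h2 : Tendsto (fun n => z (φ n)) atTop (𝓝 x) :=
      h1.congr fun n => hg _ (hzX _)
    have h3 : Tendsto (fun n => focal (a j) (b j) (z (φ n))) atTop (𝓝 (focal (a j) (b j) x)) :=
      ((continuous_focal _ _).tendsto x).comp h2
    have h4 : Tendsto (fun n : ℕ => 1 + (jlev r₂ - 1) / (n + 2 : ℝ)) atTop (𝓝 (1 + 0)) := by
      refine tendsto_const_nhds.add ?_
      exact tendsto_const_nhds.div_atTop
        (tendsto_atTop_add_const_right _ _ tendsto_natCast_atTop_atTop)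
    have h5 := le_of_tendsto_of_tendsto' h3 (h4.comp hφ.tendsto_atTop) fun n => hz2 (φ n)
    rw [add_zero] at h5
    exact hx.2 (mem_iUnion.2 ⟨j, h5⟩)
  have hps : p ∉ F '' sphere 0 r₂ := by
    rintro ⟨ξ, hξ, hξp⟩
    rw [mem_sphere_zero_iff_norm] at hξ
    exact hpim ⟨J ξ, hmaps ⟨by linarith, by linarith⟩, hξp⟩
  have hpw : windInt F r₂ p = 2 * Real.pi * I := by
    obtain ⟨n, hn⟩ :=
      (hlim.eventually (windInt_eventually_eq (by linarith) (hFa r₂ hr₂1 hr₂s) hps)).exists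
    rw [← hn]
    exact hwind _
  have hpV : p ∈ V' := by
    by_contra hpV
    have hFV : MapsTo F (sphere 0 r₂) V' := by
      intro ξ hξ
      rw [mem_sphere_zero_iff_norm] at hξ
      have : f (J ξ) ∈ f '' X := mem_image_of_mem f (hmaps ⟨by linarith, by linarith⟩)
      rw [him] at this
      exact this.1
    rw [windInt_eq_zero_of_simplyConnected (by linarith) (hFa r₂ hr₂1 hr₂s) hV' hV's hFV hpV]
      at hpw
    exact two_pi_I_ne_zero hpw.symm
  exact hpim (him ▸ ⟨hpV, fun hpK => hpO (hKO hpK)⟩)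

/-- Each slit of the domain corresponds to a single slit of the target. -/
theorem exists_slit_correspondence (h : IsSlitFamily V a b) (hV : IsOpen V)
    (hVp : IsPreconnected V) {κ : Type*} [Finite κ] {V' : Set ℂ} {c d : κ → ℂ}
    (h' : IsSlitFamily V' c d) (hV' : IsOpen V') (hV's : IsSimplyConnected V') {f : ℂ → ℂ}
    (hf : DifferentiableOn ℂ f (V \ slits a b)) (hi : InjOn f (V \ slits a b))
    (him : f '' (V \ slits a b) = V' \ slits c d)
    (hinf : ∀ M : ℝ, ∃ z ∈ V \ slits a b, M < ‖z‖ ∧ M < ‖f z‖) (j : ι) :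
    ∃ k, ∀ O, IsOpen O → ell (c k) (d k) 1 ⊆ O →
      ∃ t > 1, MapsTo f (ell (a j) (b j) t \ ell (a j) (b j) 1) O := by
  obtain ⟨s, hs1, hsV, hsd⟩ := h'.exists_disjoint_ells (fun _ => hV') h'.sub
  obtain ⟨s', hs1', hsV', hsd'⟩ := h.exists_disjoint_ells (fun _ => hV) h.sub
  set U : κ → Set ℂ := fun k => {z | focal (c k) (d k) z < s k} with hU
  have hUo : ∀ k, IsOpen (U k) := fun k => isOpen_focal_lt _ _ _
  have hUd : ∀ {k l z}, z ∈ U k → z ∈ U l → k = l := by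
    intro k l z hz hz'
    by_contra hkl
    exact disjoint_left.1 (hsd hkl) (show focal _ _ z ≤ s k from le_of_lt hz)
      (show focal _ _ z ≤ s l from le_of_lt hz')
  have hUs : ∀ k, ell (c k) (d k) 1 ⊆ U k := fun k z hz => lt_of_le_of_lt hz (hs1 k)
  have hcut : ∀ {t : ℝ}, 1 < t → t ≤ s' j → IsPreconnected
      (f '' (ell (a j) (b j) t \ ell (a j) (b j) 1)) := by
    intro t ht hts
    refine IsPreconnected.image ?_ f (hf.continuousOn.mono ?_)
    · have : ell (a j) (b j) t \ ell (a j) (b j) 1 = {z | focal (a j) (b j) z ∈ Ioc 1 t} := by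
        ext z
        simp [ell, and_comm]
      rw [this]
      exact isPreconnected_focal_mem (h.ne j) ordConnected_Ioc fun x hx => hx.1
    · exact (sdiff_subset_sdiff_left (ell_mono hts)).trans
        (ell_sdiff_subset (fun j => (hs1' j).le) hsV' hsd' j)
  obtain ⟨t₀, ht₀, hm₀⟩ := h.exists_mapsTo_nhds hV hVp hV' hV's hf hi him hinf j
    (isOpen_iUnion hUo) (iUnion_mono hUs)
  set t₁ := min t₀ (s' j)
  have ht₁ : 1 < t₁ := lt_min ht₀ (hs1' j)
  have hsub₁ : f '' (ell (a j) (b j) t₁ \ ell (a j) (b j) 1) ⊆ ⋃ k, U k :=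
    (hm₀.mono_left (sdiff_subset_sdiff_left (ell_mono (min_le_left _ _)))).image_subset
  have hne : ∀ {t : ℝ}, 1 < t → (ell (a j) (b j) t \ ell (a j) (b j) 1).Nonempty := by
    intro t ht
    have ht0 : (t : ℂ) ≠ 0 := ofReal_ne_zero.2 (by linarith)
    have hf := focal_jouk (h.ne j) ht0
    rw [norm_real, Real.norm_eq_abs, abs_of_pos (by linarith)] at hf
    refine ⟨jouk (a j) (b j) t, ?_, ?_⟩
    · change focal _ _ _ ≤ _
      rw [hf]
      exact (jlev_lt_self ht).le
    · change ¬ focal _ _ _ ≤ _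
      rw [hf, not_le]
      exact one_lt_jlev ht
  obtain ⟨z₀, hz₀⟩ := hne ht₁
  obtain ⟨k, hk⟩ := mem_iUnion.1 (hsub₁ (mem_image_of_mem f hz₀))
  have hsubk : f '' (ell (a j) (b j) t₁ \ ell (a j) (b j) 1) ⊆ U k := by
    refine (hcut ht₁ (min_le_right _ _)).subset_left_of_subset_union (hUo k)
      (v := ⋃ l ∈ {l | l ≠ k}, U l) (isOpen_biUnion fun l _ => hUo l) ?_ ?_
      ⟨_, mem_image_of_mem f hz₀, hk⟩
    · rw [disjoint_left]
      intro z hz hz'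
      obtain ⟨l, hl, hzl⟩ := mem_iUnion₂.1 hz'
      exact hl (hUd hzl hz)
    · intro z hz
      obtain ⟨l, hl⟩ := mem_iUnion.1 (hsub₁ hz)
      by_cases hlk : l = k
      · exact Or.inl (hlk ▸ hl)
      · exact Or.inr (mem_iUnion₂.2 ⟨l, hlk, hl⟩)
  refine ⟨k, fun O hO hkO => ?_⟩
  have hcov : slits c d ⊆ O ∪ ⋃ l ∈ {l | l ≠ k}, U l := by
    intro z hz
    obtain ⟨l, hl⟩ := mem_iUnion.1 hz
    by_cases hlk : l = k
    · exact Or.inl (hkO (hlk ▸ hl))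
    · exact Or.inr (mem_iUnion₂.2 ⟨l, hlk, hUs l hl⟩)
  obtain ⟨t, ht, hm⟩ := h.exists_mapsTo_nhds hV hVp hV' hV's hf hi him hinf j
    (hO.union (isOpen_biUnion fun l _ => hUo l)) hcov
  refine ⟨min t t₁, lt_min ht ht₁, fun z hz => ?_⟩
  have h1 : f z ∈ U k := hsubk
    (mem_image_of_mem f ⟨ell_mono (min_le_right _ _) hz.1, hz.2⟩)
  rcases hm ⟨ell_mono (min_le_left _ _) hz.1, hz.2⟩ with h2 | h2
  · exact h2
  · obtain ⟨l, hl, hzl⟩ := mem_iUnion₂.1 h2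
    exact absurd (hUd hzl h1) hl

end IsSlitFamily

/-- A homotopy retract of a simply connected space is simply connected. -/
theorem simplyConnectedSpace_of_homotopy {X Y : Type*} [TopologicalSpace X] [TopologicalSpace Y]
    [SimplyConnectedSpace Y] (χ : C(X, Y)) (ψ : C(Y, X))
    (H : ContinuousMap.Homotopy (ψ.comp χ) (ContinuousMap.id X)) : SimplyConnectedSpace X := by
  open CategoryTheory FundamentalGroupoidFunctor in
  have hiso : FundamentalGroupoid.map χ ⋙ FundamentalGroupoid.map ψ ≅ 𝟭 _ := by
    simpa only [FundamentalGroupoid.map_id, FundamentalGroupoid.map_comp] using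
      asIso (homotopicMapsNatIso H)
  have hfaith := CategoryTheory.Functor.Faithful.of_comp_iso hiso
  rw [simply_connected_iff_paths_homotopic]
  refine ⟨⟨(inferInstance : Nonempty Y).map ψ, fun x y => ?_⟩, fun x y => ⟨fun p q => ?_⟩⟩
  · have h1 : Joined (ψ (χ x)) x := ⟨H.evalAt x⟩
    have h2 : Joined (ψ (χ y)) y := ⟨H.evalAt y⟩
    have h3 : Joined (ψ (χ x)) (ψ (χ y)) :=
      ⟨(PathConnectedSpace.somePath (χ x) (χ y)).map ψ.continuous⟩
    exact h1.symm.trans (h3.trans h2)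
  · have h1 : Function.Injective ((FundamentalGroupoid.map χ).map :
        ((⟨x⟩ : FundamentalGroupoid X) ⟶ ⟨y⟩) → _) := hfaith.map_injective
    exact h1 (Subsingleton.elim (α := Path.Homotopic.Quotient (χ x) (χ y)) _ _)

/-- If `ψ ∘ χ` is homotopic to the identity of `W` along straight segments, simple connectedness
passes from the intermediate set to `W`. -/
theorem simplyConnectedSpace_of_segment {W W' : Set ℂ} (hW' : SimplyConnectedSpace W')
    {χ ψ : ℂ → ℂ} (hχ : ContinuousOn χ W) (hψ : ContinuousOn ψ W') (hχm : MapsTo χ W W')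
    (hψm : MapsTo ψ W' W) (hseg : ∀ z ∈ W, segment ℝ (ψ (χ z)) z ⊆ W) :
    SimplyConnectedSpace W := by
  refine simplyConnectedSpace_of_homotopy ⟨hχm.restrict, hχ.mapsToRestrict hχm⟩
    ⟨hψm.restrict, hψ.mapsToRestrict hψm⟩
    { toFun := fun p => ⟨AffineMap.lineMap (ψ (χ p.2)) (p.2 : ℂ) (p.1 : ℝ),
        hseg p.2 p.2.2 (by rw [segment_eq_image_lineMap]; exact mem_image_of_mem _ p.1.2)⟩
      continuous_toFun := ?_
      map_zero_left := fun x => ?_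
      map_one_left := fun x => ?_ }
  · refine Continuous.subtype_mk ?_ _
    have h1 : Continuous fun p : unitInterval × W => ψ (χ p.2) :=
      (continuousOn_iff_continuous_domRestrict.1 (hψ.comp hχ hχm)).comp continuous_snd
    have h2 : Continuous fun p : unitInterval × W => (p.2 : ℂ) :=
      continuous_subtype_val.comp continuous_snd
    have h3 : Continuous fun p : unitInterval × W => (p.1 : ℝ) :=
      continuous_subtype_val.comp continuous_fst
    simp only [AffineMap.lineMap_apply_module]
    exact ((continuous_const.sub h3).smul h1).add (h3.smul h2)
  · ext; simp
  · ext; simp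

theorem ell_sdiff_ell_one_nonempty {a b : ℂ} (hab : a ≠ b) {t : ℝ} (ht : 1 < t) :
    (ell a b t \ ell a b 1).Nonempty := by
  have ht0 : (t : ℂ) ≠ 0 := ofReal_ne_zero.2 (by linarith)
  have hf := focal_jouk hab ht0
  rw [norm_real, Real.norm_eq_abs, abs_of_pos (by linarith)] at hf
  refine ⟨jouk a b t, ?_, ?_⟩
  · change focal _ _ _ ≤ _
    rw [hf]
    exact (jlev_lt_self ht).le
  · change ¬ focal _ _ _ ≤ _
    rw [hf, not_le]
    exact one_lt_jlev ht

/-- A continuous cutoff function, `1` near the segment `[a, b]` and `0` off `ell a b s`. -/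
def cutoff (a b : ℂ) (s : ℝ) (z : ℂ) : ℝ := max 0 (min 1 (2 * (s - focal a b z) / (s - 1)))

theorem continuous_cutoff (a b : ℂ) (s : ℝ) : Continuous (cutoff a b s) := by
  have := continuous_focal a b
  unfold cutoff
  fun_prop

theorem cutoff_mem (a b : ℂ) (s : ℝ) (z : ℂ) : 0 ≤ cutoff a b s z ∧ cutoff a b s z ≤ 1 :=
  ⟨le_max_left _ _, max_le zero_le_one (min_le_left _ _)⟩

theorem cutoff_eq_one {a b z : ℂ} {s : ℝ} (hs : 1 < s) (hz : focal a b z < (1 + s) / 2) :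
    cutoff a b s z = 1 := by
  have : 1 ≤ 2 * (s - focal a b z) / (s - 1) := by
    rw [le_div_iff₀ (by linarith)]; linarith
  rw [cutoff, min_eq_left this, max_eq_right zero_le_one]

theorem cutoff_eq_zero {a b z : ℂ} {s : ℝ} (hs : 1 < s) (hz : z ∉ ell a b s) :
    cutoff a b s z = 0 := by
  have hz' : s < focal a b z := not_le.1 hz
  have : 2 * (s - focal a b z) / (s - 1) ≤ 0 :=
    div_nonpos_of_nonpos_of_nonneg (by linarith) (by linarith)
  rw [cutoff, max_eq_left ((min_le_right _ _).trans this)]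

/-- A continuous function off the slits is modified near the slits to a continuous function
on the whole set. -/
theorem exists_extension_slits {ι : Type*} [Finite ι] {W : Set ℂ} {a b : ι → ℂ}
    (h : IsSlitFamily W a b) (hW : IsOpen W) {f : ℂ → ℂ} (hf : ContinuousOn f (W \ slits a b))
    {s : ι → ℝ} (hs : ∀ j, 1 < s j)
    (hd : Pairwise fun i j => Disjoint (ell (a i) (b i) (s i)) (ell (a j) (b j) (s j)))
    {Q : ι → Set ℂ} (hQ : ∀ j, Convex ℝ (Q j))
    (hm : ∀ j, MapsTo f (ell (a j) (b j) (s j) \ ell (a j) (b j) 1) (Q j)) :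
    ∃ χ : ℂ → ℂ, ContinuousOn χ W ∧ (∀ z, (∀ j, z ∉ ell (a j) (b j) (s j)) → χ z = f z) ∧
      ∀ j, MapsTo χ (ell (a j) (b j) (s j)) (Q j) := by
  classical
  have := Fintype.ofFinite ι
  have hQne : ∀ j, ∃ c, c ∈ Q j := fun j =>
    let ⟨z, hz⟩ := ell_sdiff_ell_one_nonempty (h.ne j) (hs j)
    ⟨f z, hm j hz⟩
  choose c hc using hQne
  have hin : ∀ j, ∀ z ∈ ell (a j) (b j) (s j),
      f z + ∑ i, (cutoff (a i) (b i) (s i) z : ℂ) * (c i - f z) =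
        f z + (cutoff (a j) (b j) (s j) z : ℂ) * (c j - f z) := by
    intro j z hz
    rw [Finset.sum_eq_single j]
    · intro i _ hij
      rw [cutoff_eq_zero (hs i) (disjoint_left.1 (hd hij.symm) hz), ofReal_zero, zero_mul]
    · simp
  refine ⟨fun z => f z + ∑ j, (cutoff (a j) (b j) (s j) z : ℂ) * (c j - f z), ?_, ?_, ?_⟩
  · intro z hz
    refine ContinuousAt.continuousWithinAt ?_
    by_cases hzs : z ∈ slits a b
    · obtain ⟨j, hj⟩ := mem_iUnion.1 hzs
      refine (continuousAt_const (y := c j)).congr ?_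
      have hnear : ∀ᶠ w in 𝓝 z, focal (a j) (b j) w < (1 + s j) / 2 :=
        (isOpen_focal_lt _ _ _).mem_nhds
          (lt_of_le_of_lt (show focal _ _ z ≤ 1 from hj) (by linarith [hs j]))
      filter_upwards [hnear] with w hw
      rw [hin j w (show focal _ _ w ≤ s j by linarith [hs j]), cutoff_eq_one (hs j) hw]
      simp
    · have hfz : ContinuousAt f z := hf.continuousAt ((h.isOpen_sdiff hW).mem_nhds ⟨hz, hzs⟩)
      have hcut : ∀ j, ContinuousAt (fun z => (cutoff (a j) (b j) (s j) z : ℂ)) z := fun j =>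
        (continuous_ofReal.comp (continuous_cutoff _ _ _)).continuousAt
      exact hfz.add (tendsto_finsetSum _ fun j _ => (hcut j).mul (continuousAt_const.sub hfz))
  · intro z hz
    simp [fun j => cutoff_eq_zero (hs j) (hz j)]
  · intro j z hz
    simp only [hin j z hz]
    by_cases hz1 : z ∈ ell (a j) (b j) 1
    · rw [cutoff_eq_one (hs j) (lt_of_le_of_lt hz1 (by linarith [hs j]))]
      simpa using hc j
    · have hmem := cutoff_mem (a j) (b j) (s j) z
      have := (hQ j).add_smul_sub_mem (hm j ⟨hz, hz1⟩) (hc j) ⟨hmem.1, hmem.2⟩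
      simpa [real_smul] using this

/-- The slit `j` of the domain corresponds, under the boundary behaviour of `f`, to the
slit `k` of the target. -/
def SlitCorr {ι κ : Type*} (f : ℂ → ℂ) (a b : ι → ℂ) (c d : κ → ℂ) (j : ι) (k : κ) : Prop :=
  ∀ O, IsOpen O → ell (c k) (d k) 1 ⊆ O →
    ∃ t > 1, MapsTo f (ell (a j) (b j) t \ ell (a j) (b j) 1) O

/-- Simple connectedness is transferred between slit domains whose complements of the slits are
homeomorphic, provided that slits correspond to slits. -/
theorem simplyConnectedSpace_of_slitCorr {ι κ : Type*} [Finite ι] [Finite κ] {W W' : Set ℂ}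
    {a b : ι → ℂ} {c d : κ → ℂ} (h : IsSlitFamily W a b) (h' : IsSlitFamily W' c d)
    (hW : IsOpen W) (hW' : IsOpen W') {f g : ℂ → ℂ} (hf : ContinuousOn f (W \ slits a b))
    (hg : ContinuousOn g (W' \ slits c d)) (hfm : MapsTo f (W \ slits a b) (W' \ slits c d))
    (hgm : MapsTo g (W' \ slits c d) (W \ slits a b)) (hgf : ∀ z ∈ W \ slits a b, g (f z) = z)
    (hcf : ∀ j, ∃ k, SlitCorr f a b c d j k) (hcg : ∀ k, ∃ j, SlitCorr g c d a b k j)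
    (hs : SimplyConnectedSpace W') : SimplyConnectedSpace W := by
  obtain ⟨r, hr1, hrW, hrd⟩ := h.exists_disjoint_ells (fun _ => hW) h.sub
  choose J hJ using hcg
  have hg1 : ∀ k, ∃ t > 1, MapsTo g (ell (c k) (d k) t \ ell (c k) (d k) 1)
      {z | focal (a (J k)) (b (J k)) z < r (J k)} := fun k =>
    hJ k _ (isOpen_focal_lt _ _ _) fun z hz => lt_of_le_of_lt hz (hr1 _)
  choose t' ht1' ht' using hg1
  obtain ⟨s', hs1', hsO', hsd'⟩ := h'.exists_disjoint_ells
    (O := fun k => W' ∩ {z | focal (c k) (d k) z < t' k})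
    (fun k => hW'.inter (isOpen_focal_lt _ _ _))
    (fun k => subset_inter (h'.sub k) fun z hz => lt_of_le_of_lt hz (ht1' k))
  have hgs : ∀ k, MapsTo g (ell (c k) (d k) (s' k) \ ell (c k) (d k) 1)
      (ell (a (J k)) (b (J k)) (r (J k))) := fun k z hz =>
    (show focal _ _ _ ≤ _ from (ht' k ⟨(show focal _ _ z ≤ t' k from (hsO' k hz.1).2.le), hz.2⟩).le)
  choose K hK using hcf
  have hf1 : ∀ j, ∃ t > 1, MapsTo f (ell (a j) (b j) t \ ell (a j) (b j) 1)
      {z | focal (c (K j)) (d (K j)) z < s' (K j)} := fun j =>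
    hK j _ (isOpen_focal_lt _ _ _) fun z hz => lt_of_le_of_lt hz (hs1' _)
  choose t ht1 ht using hf1
  set s : ι → ℝ := fun j => min (t j) (r j)
  have hs1 : ∀ j, 1 < s j := fun j => lt_min (ht1 j) (hr1 j)
  have hsr : ∀ j, ell (a j) (b j) (s j) ⊆ ell (a j) (b j) (r j) := fun j =>
    ell_mono (min_le_right _ _)
  have hsd : Pairwise fun i j => Disjoint (ell (a i) (b i) (s i)) (ell (a j) (b j) (s j)) :=
    fun i j hij => (hrd hij).mono (hsr i) (hsr j)
  have hsW : ∀ j, ell (a j) (b j) (s j) ⊆ W := fun j => (hsr j).trans (hrW j)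
  have hfs : ∀ j, MapsTo f (ell (a j) (b j) (s j) \ ell (a j) (b j) 1)
      (ell (c (K j)) (d (K j)) (s' (K j))) := fun j z hz =>
    (show focal _ _ _ ≤ _ from (ht j ⟨ell_mono (min_le_left _ _) hz.1, hz.2⟩).le)
  have hJK : ∀ j, J (K j) = j := by
    intro j
    by_contra hne
    obtain ⟨z, hz⟩ := ell_sdiff_ell_one_nonempty (h.ne j) (hs1 j)
    have hzX := ell_sdiff_subset (fun j => (hs1 j).le) hsW hsd j hz
    have h1 := hgs (K j) ⟨hfs j hz, fun hmem => (hfm hzX).2 (mem_iUnion.2 ⟨_, hmem⟩)⟩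
    rw [hgf z hzX] at h1
    exact disjoint_left.1 (hrd hne) h1 (hsr j hz.1)
  obtain ⟨χ, hχc, hχf, hχm⟩ := exists_extension_slits h hW hf hs1 hsd
    (fun j => convex_ell _ _ _) hfs
  obtain ⟨ψ, hψc, hψg, hψm⟩ := exists_extension_slits h' hW' hg hs1' hsd'
    (fun k => convex_ell _ _ _) hgs
  have hoff : ∀ {z}, z ∈ W → (∀ j, z ∉ ell (a j) (b j) (s j)) → z ∈ W \ slits a b :=
    fun hz hn => ⟨hz, fun hmem =>
      let ⟨j, hj⟩ := mem_iUnion.1 hmem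
      hn j (ell_mono (hs1 j).le hj)⟩
  have hoff' : ∀ {z}, z ∈ W' → (∀ k, z ∉ ell (c k) (d k) (s' k)) → z ∈ W' \ slits c d :=
    fun hz hn => ⟨hz, fun hmem =>
      let ⟨j, hj⟩ := mem_iUnion.1 hmem
      hn j (ell_mono (hs1' j).le hj)⟩
  refine simplyConnectedSpace_of_segment hs hχc hψc (fun z hz => ?_) (fun z hz => ?_)
    fun z hz => ?_
  · by_cases hn : ∀ j, z ∉ ell (a j) (b j) (s j)
    · rw [hχf z hn]
      exact (hfm (hoff hz hn)).1
    · push Not at hn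
      obtain ⟨j, hj⟩ := hn
      exact (hsO' _ (hχm j hj)).1
  · by_cases hn : ∀ k, z ∉ ell (c k) (d k) (s' k)
    · rw [hψg z hn]
      exact (hgm (hoff' hz hn)).1
    · push Not at hn
      obtain ⟨k, hk⟩ := hn
      exact hrW _ (hψm k hk)
  · by_cases hn : ∀ j, z ∉ ell (a j) (b j) (s j)
    · have hzX := hoff hz hn
      rw [hχf z hn]
      by_cases hn' : ∀ k, f z ∉ ell (c k) (d k) (s' k)
      · rw [hψg _ hn', hgf z hzX, segment_same]
        exact singleton_subset_iff.2 hz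
      · push Not at hn'
        obtain ⟨k, hk⟩ := hn'
        have h1 := hgs k ⟨hk, fun hmem => (hfm hzX).2 (mem_iUnion.2 ⟨_, hmem⟩)⟩
        rw [hgf z hzX] at h1
        exact ((convex_ell _ _ _).segment_subset (hψm k hk) h1).trans (hrW _)
    · push Not at hn
      obtain ⟨j, hj⟩ := hn
      have h1 := hψm _ (hχm j hj)
      rw [hJK j] at h1
      exact ((convex_ell _ _ _).segment_subset h1 (hsr j hj)).trans (hrW _)

theorem ell_one_eq_segment {a b : ℂ} (hab : a ≠ b) : ell a b 1 = segment ℝ a b := by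
  have h0 : 0 < ‖b - a‖ := norm_pos_iff.2 (sub_ne_zero.2 hab.symm)
  ext z
  rw [mem_segment_iff_wbtw, ← dist_add_dist_eq_iff]
  have : z ∈ ell a b 1 ↔ focal a b z = 1 := ⟨fun h => le_antisymm h (one_le_focal hab z), fun h => h.le⟩
  rw [this, focal, div_eq_one_iff_eq h0.ne', dist_eq_norm, dist_eq_norm, dist_eq_norm,
    norm_sub_rev a z, norm_sub_rev a b]

theorem ell_one_horizontal {y xl xr : ℝ} (hx : xl < xr) :
    ell ⟨xl, y⟩ ⟨xr, y⟩ 1 = {z : ℂ | z.im = y ∧ z.re ∈ Icc xl xr} := by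
  have hne : (⟨xl, y⟩ : ℂ) ≠ ⟨xr, y⟩ := fun h => hx.ne (congrArg Complex.re h)
  rw [ell_one_eq_segment hne, segment_eq_image_lineMap]
  ext z
  simp only [mem_image, mem_ofPred_eq, AffineMap.lineMap_apply_module']
  constructor
  · rintro ⟨t, ht, rfl⟩
    refine ⟨by simp, ?_, ?_⟩ <;> simp <;> nlinarith [ht.1, ht.2]
  · rintro ⟨h1, h2⟩
    have h3 : 0 < xr - xl := by linarith
    obtain ⟨t, ht⟩ : ∃ t : ℝ, t = (z.re - xl) / (xr - xl) := ⟨_, rfl⟩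
    have ht' : t * (xr - xl) = z.re - xl := by rw [ht, div_mul_cancel₀ _ h3.ne']
    refine ⟨t, ⟨ht ▸ div_nonneg (by linarith [h2.1]) h3.le,
      ht ▸ (div_le_one h3).2 (by linarith [h2.2])⟩, ?_⟩
    apply Complex.ext
    · simp [ht']
    · simp [h1]

theorem isOpen_UHP : IsOpen UHP := isOpen_lt continuous_const continuous_im

theorem convex_UHP : Convex ℝ UHP := convex_halfSpace_im_gt 0

theorem simplyConnectedSpace_UHP : SimplyConnectedSpace UHP := by
  have := convex_UHP.contractibleSpace ⟨I, by simp [UHP]⟩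
  infer_instance

theorem IsParallelSlitHalfPlane.exists_slits {D : Set ℂ} (h : IsParallelSlitHalfPlane D) :
    ∃ (N : ℕ) (a b : Fin N → ℂ), IsSlitFamily UHP a b ∧
      (∀ j, ∀ z ∈ ell (a j) (b j) 1, z.im = (a j).im) ∧ D = UHP \ slits a b := by
  obtain ⟨N, C, hC, hd, rfl⟩ := h
  choose y xl xr hy hx hCe using hC
  have hell : ∀ j, ell ⟨xl j, y j⟩ ⟨xr j, y j⟩ 1 = C j := fun j => by
    rw [ell_one_horizontal (hx j), hCe]
  refine ⟨N, fun j => ⟨xl j, y j⟩, fun j => ⟨xr j, y j⟩,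
    ⟨fun j h => (hx j).ne (congrArg Complex.re h), fun j z hz => ?_, fun i j hij => ?_⟩,
    fun j z hz => ?_, ?_⟩
  · rw [hell, hCe] at hz
    change 0 < z.im
    rw [hz.1]
    exact hy j
  · simpa only [hell] using hd hij
  · rw [hell, hCe] at hz
    exact hz.1
  · simp only [slits, hell]

/-- The complement of a hull is open. -/
theorem IsHHull.isOpen_sdiff {F : Set ℂ} (h : IsHHull F) : IsOpen (UHP \ F) := by
  have : UHP \ F = UHP \ closure F := by
    ext z
    exact ⟨fun hz => ⟨hz.1, fun hc => hz.2 (h.2.1 ⟨hc, hz.1⟩)⟩,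
      fun hz => ⟨hz.1, fun hc => hz.2 (subset_closure hc)⟩⟩
  rw [this]
  exact isOpen_UHP.sdiff isClosed_closure

/-- A set with an open connected and simply connected complement in the upper half-plane is a
hull. -/
theorem isHHull_of_isOpen {F : Set ℂ} (hF : F ⊆ UHP) (ho : IsOpen (UHP \ F))
    (hs : SimplyConnectedSpace ↥(UHP \ F)) : IsHHull F := by
  refine ⟨hF, fun z hz => ?_, ?_, hs⟩
  · by_contra hzF
    have h1 : UHP \ F ∈ 𝓝 z := ho.mem_nhds ⟨hz.2, hzF⟩
    obtain ⟨w, hw, hwF⟩ := mem_closure_iff_nhds.1 hz.1 _ h1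
    exact hw.2 hwF
  · exact (isPathConnected_iff_pathConnectedSpace.2 inferInstance).isConnected

theorem sdiff_sdiff_sdiff_slits {ι : Type*} {a b : ι → ℂ} {S : Set ℂ}
    (hS : S ⊆ UHP \ slits a b) :
    (UHP \ ((UHP \ slits a b) \ S)) \ slits a b = S := by
  ext z
  constructor
  · rintro ⟨⟨h1, h2⟩, h3⟩
    by_contra h
    exact h2 ⟨⟨h1, h3⟩, h⟩
  · exact fun h => ⟨⟨(hS h).1, fun h' => h'.2 h⟩, (hS h).2⟩

theorem IsSlitFamily.mono_sdiff {ι : Type*} {a b : ι → ℂ} (h : IsSlitFamily UHP a b) (S : Set ℂ) :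
    IsSlitFamily (UHP \ ((UHP \ slits a b) \ S)) a b :=
  ⟨h.ne, fun j _ hz => ⟨h.sub j hz, fun h' => h'.1.2 (mem_iUnion.2 ⟨j, hz⟩)⟩, h.disj⟩

theorem SatisfiesH1.exists_norm_bound {D : Set ℂ} {f : ℂ → ℂ} (h : SatisfiesH1 D f) :
    ∃ η, 0 ≤ η ∧ HP η ⊆ D ∧ ∀ ε > 0, ∃ R, ∀ z ∈ HP η, R ≤ ‖z‖ → ‖f z - z‖ < ε := by
  obtain ⟨η, hη, hsub, hlim⟩ := h
  refine ⟨η, hη, hsub, fun ε hε => ?_⟩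
  have h1 := hlim.eventually (ball_mem_nhds 0 hε)
  rw [eventually_inf_principal, ← comap_norm_atTop, eventually_comap] at h1
  obtain ⟨R, hR⟩ := eventually_atTop.1 h1
  refine ⟨R, fun z hz hRz => ?_⟩
  have := hR _ hRz z rfl hz
  rwa [dist_zero_right] at this

/-- There are points of the domain arbitrarily far away which are moved only little. -/
theorem SatisfiesH1.exists_norm_sub_lt {D : Set ℂ} {f : ℂ → ℂ} (h : SatisfiesH1 D f) (M : ℝ)
    {ε : ℝ} (hε : 0 < ε) : ∃ z ∈ D, M < ‖z‖ ∧ ‖f z - z‖ < ε := by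
  obtain ⟨η, hη, hsub, hlim⟩ := h.exists_norm_bound
  obtain ⟨R, hR⟩ := hlim ε hε
  set y : ℝ := |R| + |M| + η + 1 with hy
  have hy0 : 0 < y := by positivity
  have hn : ‖(y * I : ℂ)‖ = y := by simp [abs_of_pos hy0]
  have hmem : (y * I : ℂ) ∈ HP η := by
    change η < _
    simp
    linarith [abs_nonneg R, abs_nonneg M]
  refine ⟨y * I, hsub hmem, ?_, hR _ hmem ?_⟩
  · rw [hn]; linarith [le_abs_self M, abs_nonneg R]
  · rw [hn]; linarith [le_abs_self R, abs_nonneg M]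

theorem SatisfiesH1.exists_large {D : Set ℂ} {f : ℂ → ℂ} (h : SatisfiesH1 D f) (M : ℝ) :
    ∃ z ∈ D, M < ‖z‖ ∧ M < ‖f z‖ := by
  obtain ⟨z, hz, h1, h2⟩ := h.exists_norm_sub_lt (M + 1) one_pos
  refine ⟨z, hz, by linarith, ?_⟩
  have := norm_sub_norm_le z (z - f z)
  rw [sub_sub_cancel, norm_sub_rev] at this
  linarith

section Hull

variable {ι κ : Type*} [Finite ι] [Finite κ] {a b : ι → ℂ} {c d : κ → ℂ} {f : ℂ → ℂ}

/-- Slits correspond to slits under a univalent map whose image is the complement of a hull. -/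
theorem exists_slitCorr (h : IsSlitFamily UHP a b) (h' : IsSlitFamily UHP c d)
    (hf : DifferentiableOn ℂ f (UHP \ slits a b)) (hi : InjOn f (UHP \ slits a b))
    (hm : MapsTo f (UHP \ slits a b) (UHP \ slits c d)) (h1 : SatisfiesH1 (UHP \ slits a b) f)
    (h3 : IsHHull ((UHP \ slits c d) \ f '' (UHP \ slits a b))) (j : ι) :
    ∃ k, SlitCorr f a b c d j k :=
  h.exists_slit_correspondence isOpen_UHP convex_UHP.isPreconnected (h'.mono_sdiff _)
    h3.isOpen_sdiff h3.2.2.2 hf hi (sdiff_sdiff_sdiff_slits hm.image_subset).symm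
    h1.exists_large j

/-- Slits correspond to slits also under the inverse map. -/
theorem exists_slitCorr_inv (h : IsSlitFamily UHP a b) (h' : IsSlitFamily UHP c d)
    (hf : DifferentiableOn ℂ f (UHP \ slits a b)) (hi : InjOn f (UHP \ slits a b))
    (hm : MapsTo f (UHP \ slits a b) (UHP \ slits c d)) (h1 : SatisfiesH1 (UHP \ slits a b) f)
    (h3 : IsHHull ((UHP \ slits c d) \ f '' (UHP \ slits a b))) (k : κ) :
    ∃ j, SlitCorr (Function.invFunOn f (UHP \ slits a b)) c d a b k j := by
  have heq := sdiff_sdiff_sdiff_slits hm.image_subset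
  have hinv : ∀ z ∈ UHP \ slits a b, Function.invFunOn f (UHP \ slits a b) (f z) = z :=
    fun z hz => hi.leftInvOn_invFunOn hz
  refine (h'.mono_sdiff _).exists_slit_correspondence h3.isOpen_sdiff
    h3.2.2.1.isPreconnected h isOpen_UHP simplyConnectedSpace_UHP ?_ ?_ ?_ ?_ k
  · rw [heq]
    exact differentiableOn_of_leftInvOn (h.isOpen_sdiff isOpen_UHP) hf hi hinv
  · rw [heq]
    rintro _ ⟨z, hz, rfl⟩ _ ⟨w, hw, rfl⟩ hzw
    rw [hinv z hz, hinv w hw] at hzw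
    rw [hzw]
  · rw [heq, image_image]
    exact (image_congr hinv).trans (image_id _)
  · intro M
    obtain ⟨z, hz, hz1, hz2⟩ := h1.exists_large M
    exact ⟨f z, by rw [heq]; exact mem_image_of_mem f hz, hz2, by rwa [hinv z hz]⟩

/-- Preimages of complements of hulls under a univalent map are complements of hulls. -/
theorem isHHull_sdiff_invFunOn_image (h : IsSlitFamily UHP a b) (h' : IsSlitFamily UHP c d)
    (hf : DifferentiableOn ℂ f (UHP \ slits a b)) (hi : InjOn f (UHP \ slits a b))
    (hm : MapsTo f (UHP \ slits a b) (UHP \ slits c d)) (h1 : SatisfiesH1 (UHP \ slits a b) f)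
    (h3 : IsHHull ((UHP \ slits c d) \ f '' (UHP \ slits a b))) {S : Set ℂ}
    (hS : S ⊆ f '' (UHP \ slits a b)) (hS3 : IsHHull ((UHP \ slits c d) \ S)) :
    IsHHull ((UHP \ slits a b) \ Function.invFunOn f (UHP \ slits a b) '' S) := by
  set X := UHP \ slits a b with hX
  set g := Function.invFunOn f X with hg
  have hXo : IsOpen X := h.isOpen_sdiff isOpen_UHP
  have hinv : ∀ z ∈ X, g (f z) = z := fun z hz => hi.leftInvOn_invFunOn hz
  have hSsub : S ⊆ UHP \ slits c d := hS.trans hm.image_subset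
  have heqS := sdiff_sdiff_sdiff_slits hSsub
  have hgS : g '' S = X ∩ f ⁻¹' S := by
    ext z
    constructor
    · rintro ⟨w, hw, rfl⟩
      obtain ⟨x, hx, rfl⟩ := hS hw
      rw [hinv x hx]
      exact ⟨hx, hw⟩
    · exact fun hz => ⟨f z, hz.2, hinv z hz.1⟩
  have hgX : g '' S ⊆ X := hgS ▸ inter_subset_left
  have heqW := sdiff_sdiff_sdiff_slits hgX
  have hVo : IsOpen (UHP \ ((UHP \ slits c d) \ S)) := hS3.isOpen_sdiff
  have hSo : IsOpen S := heqS ▸ (h'.mono_sdiff S).isOpen_sdiff hVo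
  have hgSo : IsOpen (g '' S) := hgS ▸ hf.continuousOn.isOpen_inter_preimage hXo hSo
  have hWo : IsOpen (UHP \ (X \ g '' S)) := by
    rw [isOpen_iff_mem_nhds]
    intro z hz
    by_cases hzs : z ∈ slits a b
    · obtain ⟨j, hj⟩ := mem_iUnion.1 hzs
      obtain ⟨k, hk⟩ := exists_slitCorr h h' hf hi hm h1 h3 j
      obtain ⟨t, ht, htm⟩ := hk _ hVo ((h'.mono_sdiff S).sub k)
      obtain ⟨s, hs1, hsV, hsd⟩ := h.exists_disjoint_ells (fun _ => isOpen_UHP) h.sub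
      have hlt : (1 : ℝ) < min t (s j) := lt_min ht (hs1 j)
      filter_upwards [(isOpen_focal_lt (a j) (b j) (min t (s j))).mem_nhds
        (lt_of_le_of_lt hj hlt)] with w hw
      have hwt : w ∈ ell (a j) (b j) t := (lt_of_lt_of_le hw (min_le_left _ _)).le
      have hws : w ∈ ell (a j) (b j) (s j) := (lt_of_lt_of_le hw (min_le_right _ _)).le
      refine ⟨hsV j hws, fun hwX => hwX.2 ?_⟩
      have hw1 : w ∉ ell (a j) (b j) 1 := fun hmem => hwX.1.2 (mem_iUnion.2 ⟨j, hmem⟩)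
      have hfw : f w ∈ S := heqS ▸ ⟨htm ⟨hwt, hw1⟩, (hm hwX.1).2⟩
      rw [hgS]
      exact ⟨hwX.1, hfw⟩
    · have : z ∈ g '' S := heqW ▸ ⟨hz, hzs⟩
      refine mem_of_superset (hgSo.mem_nhds this) fun w hw => ?_
      exact ⟨(hgX hw).1, fun h' => h'.2 hw⟩
  refine isHHull_of_isOpen (fun z hz => hz.1.1) hWo ?_
  have hfmem : MapsTo f (g '' S) S := fun z hz => (hgS ▸ hz : z ∈ X ∩ f ⁻¹' S).2
  refine simplyConnectedSpace_of_slitCorr (h.mono_sdiff (g '' S)) (h'.mono_sdiff S) hWo hVo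
    (f := f) (g := g) ?_ ?_ ?_ ?_ ?_ (exists_slitCorr h h' hf hi hm h1 h3)
    (exists_slitCorr_inv h h' hf hi hm h1 h3) hS3.2.2.2
  · rw [heqW]
    exact hf.continuousOn.mono hgX
  · rw [heqS]
    exact (differentiableOn_of_leftInvOn hXo hf hi hinv).continuousOn.mono hS
  · rw [heqW, heqS]
    exact hfmem
  · rw [heqW, heqS]
    exact mapsTo_image g S
  · rw [heqW]
    exact fun z hz => hinv z (hgX hz)

end Hull

/-- The imaginary part of a holomorphic function is constant if it attains its minimum. -/
theorem im_eq_of_isMinOn {U : Set ℂ} (hU : IsOpen U) (hUp : IsPreconnected U) {w : ℂ → ℂ}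
    (hw : DifferentiableOn ℂ w U) {p : ℂ} (hp : p ∈ U) (hmin : ∀ z ∈ U, (w p).im ≤ (w z).im) :
    ∀ z ∈ U, (w z).im = (w p).im := by
  have hn : ∀ z, ‖cexp (I * w z)‖ = Real.exp (-(w z).im) := fun z => by
    rw [norm_exp]; simp
  intro z hz
  have := norm_eqOn_of_isPreconnected_of_isMaxOn hUp hU ((hw.const_mul I).cexp) hp
    (fun z hz => by
      simpa [hn] using hmin z hz) hz
  simpa [hn] using this

/-- The imaginary part of a holomorphic function around a slit cannot be larger than its constant
limit value at the slit. -/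
theorem exists_im_le_of_tendsto_slit {a b : ℂ} (hab : a ≠ b) {s : ℝ} (hs : 1 < s) {w : ℂ → ℂ}
    (hw : DifferentiableOn ℂ w (ell a b s \ ell a b 1)) {m : ℝ}
    (hlim : ∀ ε > 0, ∃ t > 1, ∀ z ∈ ell a b t \ ell a b 1, (w z).im < m + ε) :
    ∃ z ∈ ell a b s \ ell a b 1, (w z).im ≤ m := by
  by_contra! hcon
  have hne0 : ∀ {ζ : ℂ}, 1 < ‖ζ‖ → ζ ≠ 0 := fun h => norm_pos_iff.1 (one_pos.trans h)
  have hmaps : ∀ {t : ℝ}, MapsTo (jouk a b) {ζ | 1 < ‖ζ‖ ∧ ‖ζ‖ < t} (ell a b t \ ell a b 1) := by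
    intro t ζ hζ
    refine ⟨?_, ?_⟩
    · change focal _ _ _ ≤ _
      rw [focal_jouk hab (hne0 hζ.1)]
      exact ((jlev_lt_self hζ.1).trans hζ.2).le
    · change ¬ focal _ _ _ ≤ _
      rw [focal_jouk hab (hne0 hζ.1), not_le]
      exact one_lt_jlev hζ.1
  set A : Set ℂ := {ζ | 1 < ‖ζ‖ ∧ ‖ζ‖ < s}
  have hAo : IsOpen A :=
    (isOpen_lt continuous_const continuous_norm).inter (isOpen_lt continuous_norm continuous_const)
  set F := w ∘ jouk a b with hF
  have hFd : DifferentiableOn ℂ F A := hw.comp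
    (fun ζ hζ => (differentiableAt_jouk _ _ (hne0 hζ.1)).differentiableWithinAt) hmaps
  have hsph : ∀ r, 1 < r → r < s → sphere (0 : ℂ) |r| ⊆ A := by
    intro r hr hr' ζ hζ
    rw [mem_sphere_zero_iff_norm, abs_of_pos (by linarith)] at hζ
    exact ⟨by linarith, by linarith⟩
  have hint : ∀ r, 1 < r → r < s → CircleIntegrable F 0 r := fun r hr hr' =>
    ContinuousOn.circleIntegrable' (hFd.continuousOn.mono (hsph r hr hr'))
  have havg : ∀ r R, 1 < r → r ≤ R → R < s →
      Real.circleAverage F 0 R = Real.circleAverage F 0 r := by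
    intro r R hr hrR hR
    rw [Real.circleAverage_eq_circleIntegral (by linarith),
      Real.circleAverage_eq_circleIntegral (by linarith),
      circleIntegral_sub_center_inv_smul_eq_of_differentiable_on_annulus_off_countable
        (by linarith) hrR countable_empty]
    · refine hFd.continuousOn.mono fun ζ hζ => ?_
      have h1 := mem_closedBall_zero_iff.1 hζ.1
      have h2 := not_lt.1 fun h => hζ.2 (mem_ball_zero_iff.2 h)
      exact ⟨by linarith, by linarith⟩
    · intro ζ hζ
      have h1 := mem_ball_zero_iff.1 hζ.1.1
      have h2 := not_le.1 fun h => hζ.1.2 (mem_closedBall_zero_iff.2 h)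
      exact hFd.differentiableAt (hAo.mem_nhds ⟨by linarith, by linarith⟩)
  have him : ∀ r, 1 < r → r < s →
      Real.circleAverage (fun ζ => (F ζ).im) 0 r = (Real.circleAverage F 0 r).im := fun r hr hr' =>
    imCLM.circleAverage_comp_comm (hint r hr hr')
  have hint' : ∀ r, 1 < r → r < s → CircleIntegrable (fun ζ => (F ζ).im) 0 r := fun r hr hr' =>
    ContinuousOn.circleIntegrable'
      (continuous_im.comp_continuousOn (hFd.continuousOn.mono (hsph r hr hr')))
  set R := (1 + s) / 2 with hR
  have hR1 : 1 < R := by linarith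
  have hRs : R < s := by linarith
  obtain ⟨p, hp, hpmin⟩ := (isCompact_sphere (0 : ℂ) |R|).exists_isMinOn
    (NormedSpace.sphere_nonempty.2 (abs_nonneg R))
    (continuous_im.comp_continuousOn (hFd.continuousOn.mono (hsph R hR1 hRs)))
  have hpm : m < (F p).im := hcon _ (hmaps (hsph R hR1 hRs hp))
  have hlow : (F p).im ≤ (Real.circleAverage F 0 R).im := by
    rw [← him R hR1 hRs]
    have := Real.circleAverage_mono (circleIntegrable_const (F p).im 0 R) (hint' R hR1 hRs) hpmin
    rwa [Real.circleAverage_const] at this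
  obtain ⟨t, ht, htm⟩ := hlim (((F p).im - m) / 2) (by linarith)
  set r := (1 + min t R) / 2 with hr
  have htR : 1 < min t R := lt_min ht hR1
  have hr1 : 1 < r := by linarith
  have hrt : r < t := by linarith [min_le_left t R]
  have hrR : r < R := by linarith [min_le_right t R]
  have hup : (Real.circleAverage F 0 r).im ≤ m + ((F p).im - m) / 2 := by
    rw [← him r hr1 (hrR.trans hRs)]
    refine Real.circleAverage_mono_on_of_le_circle (hint' r hr1 (hrR.trans hRs)) fun ζ hζ => ?_
    rw [mem_sphere_zero_iff_norm, abs_of_pos (by linarith)] at hζ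
    exact (htm _ (hmaps ⟨by linarith, by linarith⟩)).le
  rw [havg r R hr1 hrR.le hRs] at hlow
  linarith

section

variable {ι : Type*} [Finite ι] {a b : ι → ℂ} {f : ℂ → ℂ}

/-- A minimum principle for `Im (f z - z)`. -/
theorem le_im_sub_of_slits (h : IsSlitFamily UHP a b)
    (hf : DifferentiableOn ℂ f (UHP \ slits a b)) (hm : MapsTo f (UHP \ slits a b) UHP)
    (h1 : SatisfiesH1 (UHP \ slits a b) f) {m : ℝ} (hm0 : m ≤ 0)
    (hlim : ∀ j, ∀ ε > 0, ∃ t > 1, ∀ z ∈ ell (a j) (b j) t \ ell (a j) (b j) 1,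
      m - ε < (f z - z).im) :
    ∀ z ∈ UHP \ slits a b, m ≤ (f z - z).im := by
  set X := UHP \ slits a b with hX
  have hXo : IsOpen X := h.isOpen_sdiff isOpen_UHP
  have hXp : IsPreconnected X := h.isPreconnected_sdiff isOpen_UHP convex_UHP.isPreconnected
  intro z₀ hz₀
  by_contra! hlt
  have hnorm : ∀ z ∈ UHP, 1 < ‖z + I‖ := fun z hz => by
    have hz' : (0 : ℝ) < z.im := hz
    have h1 : 1 < (z + I).im := by simpa using hz'
    exact h1.trans_le ((le_abs_self _).trans (abs_im_le_norm _))
  have hlog : ∀ z ∈ UHP, 0 < Real.log ‖z + I‖ := fun z hz => Real.log_pos (hnorm z hz)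
  set η := (m - (f z₀ - z₀).im) / 2 with hη
  have hη0 : 0 < η := by linarith
  set ε := η / Real.log ‖z₀ + I‖ with hε
  have hε0 : 0 < ε := div_pos hη0 (hlog z₀ hz₀.1)
  set w : ℂ → ℂ := fun z => f z - z + ε * I * Complex.log (z + I) with hw
  have hwim : ∀ z, (w z).im = (f z - z).im + ε * Real.log ‖z + I‖ := fun z => by
    rw [hw, add_im, mul_assoc, im_ofReal_mul, I_mul_im, log_re]
  have hwd : DifferentiableOn ℂ w X := by
    refine (hf.sub differentiableOn_id).add ((DifferentiableOn.clog
      (differentiableOn_id.add_const I) fun z hz => ?_).const_mul _)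
    refine Or.inr (ne_of_gt ?_)
    have : (0 : ℝ) < z.im := hz.1
    simpa using by linarith
  have hw₀ : (w z₀).im = m - η := by
    rw [hwim, hε, div_mul_cancel₀ _ (hlog z₀ hz₀.1).ne']
    linarith
  obtain ⟨η₀, hη₀, hsub, hbd⟩ := h1.exists_norm_bound
  obtain ⟨R₁, hR₁⟩ := hbd 1 one_pos
  obtain ⟨s, hs1, hsV, hsd⟩ := h.exists_disjoint_ells (fun _ => isOpen_UHP) h.sub
  choose t ht1 ht using fun j => hlim j η hη0
  set R := max R₁ (Real.exp ((1 + η₀) / ε) + 1) with hR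
  have hgrow : ∀ z ∈ X, R < ‖z‖ → 0 < (w z).im := by
    intro z hz hRz
    have hzR₁ : R₁ ≤ ‖z‖ := (le_max_left _ _).trans hRz.le
    have h2 : Real.exp ((1 + η₀) / ε) < ‖z + I‖ := by
      have h3 : Real.exp ((1 + η₀) / ε) + 1 < ‖z‖ := (le_max_right _ _).trans_lt hRz
      have h4 := norm_sub_norm_le z (-I)
      rw [norm_neg, norm_I, sub_neg_eq_add] at h4
      linarith
    have h3 : (1 + η₀) / ε < Real.log ‖z + I‖ := (Real.lt_log_iff_exp_lt
      (one_pos.trans (hnorm z hz.1))).2 h2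
    rw [div_lt_iff₀ hε0, mul_comm] at h3
    rw [hwim]
    by_cases hzη : z ∈ HP η₀
    · have := (abs_im_le_norm (f z - z)).trans (hR₁ z hzη hzR₁).le
      linarith [(abs_le.1 this).1]
    · have h4 : z.im ≤ η₀ := not_lt.1 hzη
      have h5 : 0 < (f z).im := hm hz
      rw [sub_im]
      linarith
  set L : Set ℂ := (closedBall 0 R ∩ {z | η ≤ z.im}) \
    ⋃ j, {z | focal (a j) (b j) z < min (t j) (s j)} with hL
  have hts : ∀ j, 1 < min (t j) (s j) := fun j => lt_min (ht1 j) (hs1 j)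
  have hLc : IsCompact L := ((isCompact_closedBall _ _).inter_right
    (isClosed_le continuous_const continuous_im)).diff (isOpen_iUnion fun j => isOpen_focal_lt _ _ _)
  have hLX : L ⊆ X := by
    rintro z ⟨⟨-, hz⟩, hz'⟩
    refine ⟨hη0.trans_le hz, fun hmem => ?_⟩
    obtain ⟨j, hj⟩ := mem_iUnion.1 hmem
    exact hz' (mem_iUnion.2 ⟨j, lt_of_le_of_lt hj (hts j)⟩)
  have hout : ∀ z ∈ X, z ∉ L → m - η < (w z).im := by
    intro z hz hzL
    by_contra! hle
    refine hzL ⟨⟨?_, ?_⟩, ?_⟩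
    · rw [mem_closedBall_zero_iff]
      by_contra! hRz
      linarith [hgrow z hz hRz]
    · have h5 : 0 < (f z).im := hm hz
      have h6 : 0 < ε * Real.log ‖z + I‖ := mul_pos hε0 (hlog z hz.1)
      rw [hwim, sub_im] at hle
      change η ≤ z.im
      linarith
    · intro hmem
      obtain ⟨j, hj⟩ := mem_iUnion.1 hmem
      have hj' : focal (a j) (b j) z < min (t j) (s j) := hj
      have h7 := ht j z ⟨(hj'.trans_le (min_le_left _ _)).le,
        fun h8 => hz.2 (mem_iUnion.2 ⟨j, h8⟩)⟩
      have h6 : 0 < ε * Real.log ‖z + I‖ := mul_pos hε0 (hlog z hz.1)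
      rw [hwim] at hle
      linarith
  have hz₀L : z₀ ∈ L := by
    by_contra hn
    linarith [hout z₀ hz₀ hn]
  obtain ⟨p, hpL, hp⟩ := hLc.exists_isMinOn ⟨z₀, hz₀L⟩
    (continuous_im.comp_continuousOn (hwd.continuousOn.mono hLX))
  have hp₀ : (w p).im ≤ m - η := hw₀ ▸ hp hz₀L
  have hpmin : ∀ z ∈ X, (w p).im ≤ (w z).im := by
    intro z hz
    by_cases hzL : z ∈ L
    · exact hp hzL
    · exact hp₀.trans (hout z hz hzL).le
  have hconst := im_eq_of_isMinOn hXo hXp hwd (hLX hpL) hpmin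
  obtain ⟨z, hz, hzR, -⟩ := h1.exists_norm_sub_lt R one_pos
  linarith [hgrow z hz hzR, hconst z hz]

/-- A map of slit half-planes which extends to slits sends points upwards. -/
theorem im_le_im_of_slitCorr {κ : Type*} {c d : κ → ℂ} (h : IsSlitFamily UHP a b)
    (hy : ∀ j, ∀ z ∈ ell (a j) (b j) 1, z.im = (a j).im)
    (hy' : ∀ k, ∀ z ∈ ell (c k) (d k) 1, z.im = (c k).im)
    (hf : DifferentiableOn ℂ f (UHP \ slits a b)) (hm : MapsTo f (UHP \ slits a b) UHP)
    (h1 : SatisfiesH1 (UHP \ slits a b) f) (hc : ∀ j, ∃ k, SlitCorr f a b c d j k) :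
    ∀ z ∈ UHP \ slits a b, 0 ≤ (f z - z).im := by
  choose K hK using hc
  set v : ι → ℝ := fun j => (c (K j)).im - (a j).im with hv
  have hlim : ∀ j, ∀ ε > 0, ∃ t > 1, ∀ z ∈ ell (a j) (b j) t \ ell (a j) (b j) 1,
      v j - ε < (f z - z).im ∧ (f z - z).im < v j + ε := by
    intro j ε hε
    have hO : ∀ y : ℝ, IsOpen {z : ℂ | |z.im - y| < ε / 2} := fun y =>
      isOpen_lt (continuous_im.sub continuous_const).abs continuous_const
    obtain ⟨t, ht, htm⟩ := hK j {z : ℂ | |z.im - (c (K j)).im| < ε / 2} (hO _) fun z hz => by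
      change |z.im - (c (K j)).im| < ε / 2
      rw [hy' _ z hz, sub_self, abs_zero]
      linarith
    obtain ⟨t', ht', htm'⟩ := exists_ell_subset (h.ne j) (s := 1)
      (O := {z : ℂ | |z.im - (a j).im| < ε / 2}) (hO _) fun z hz => by
        change |z.im - (a j).im| < ε / 2
        rw [hy _ z hz, sub_self, abs_zero]
        linarith
    refine ⟨min t t', lt_min ht ht', fun z hz => ?_⟩
    have e0 : |(f z).im - (c (K j)).im| < ε / 2 := htm ⟨ell_mono (min_le_left _ _) hz.1, hz.2⟩
    have e0' : |z.im - (a j).im| < ε / 2 := htm' (ell_mono (min_le_right _ _) hz.1)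
    have e1 := abs_lt.1 e0
    have e2 := abs_lt.1 e0'
    rw [sub_im]
    constructor <;> simp only [hv] <;> linarith [e1.1, e1.2, e2.1, e2.2]
  by_cases hneg : ∀ j, 0 ≤ v j
  · refine le_im_sub_of_slits h hf hm h1 le_rfl fun j ε hε => ?_
    obtain ⟨t, ht, htm⟩ := hlim j ε hε
    exact ⟨t, ht, fun z hz => by linarith [(htm z hz).1, hneg j]⟩
  · exfalso
    push Not at hneg
    obtain ⟨i, hi⟩ := hneg
    have : Nonempty ι := ⟨i⟩
    obtain ⟨j, hj⟩ := Finite.exists_min v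
    have hj0 : v j < 0 := (hj i).trans_lt hi
    have hle := le_im_sub_of_slits h hf hm h1 hj0.le fun k ε hε => by
      obtain ⟨t, ht, htm⟩ := hlim k ε hε
      exact ⟨t, ht, fun z hz => by linarith [(htm z hz).1, hj k]⟩
    obtain ⟨s, hs1, hsV, hsd⟩ := h.exists_disjoint_ells (fun _ => isOpen_UHP) h.sub
    have hsub := ell_sdiff_subset (fun j => (hs1 j).le) hsV hsd j
    have hd : DifferentiableOn ℂ (fun z => f z - z) (UHP \ slits a b) :=
      hf.sub differentiableOn_id
    obtain ⟨p, hp, hpm⟩ := exists_im_le_of_tendsto_slit (h.ne j) (hs1 j) (hd.mono hsub)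
      fun ε hε => by
        obtain ⟨t, ht, htm⟩ := hlim j ε hε
        exact ⟨t, ht, fun z hz => (htm z hz).2⟩
    have hconst := im_eq_of_isMinOn (h.isOpen_sdiff isOpen_UHP)
      (h.isPreconnected_sdiff isOpen_UHP convex_UHP.isPreconnected) hd (hsub hp)
      fun z hz => hpm.trans (hle z hz)
    obtain ⟨z, hz, -, hzn⟩ := h1.exists_norm_sub_lt 0 (neg_pos.2 hj0)
    have h2 := (abs_im_le_norm (f z - z)).trans hzn.le
    have h3 := hconst z hz
    have h4 := (abs_im_le_norm (f z - z)).trans_lt hzn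
    linarith [neg_abs_le (f z - z).im]

end

/-- A map satisfying (H.1) takes all values near infinity, close to themselves. -/
theorem SatisfiesH1.exists_preimage {D : Set ℂ} {f : ℂ → ℂ} (h : SatisfiesH1 D f)
    (hf : DifferentiableOn ℂ f D) :
    ∃ η, 0 ≤ η ∧ ∀ ε > 0, ∃ R, ∀ w ∈ HP η, R ≤ ‖w‖ → ∃ u ∈ D, f u = w ∧ ‖u - w‖ < ε := by
  obtain ⟨η, hη, hsub, hlim⟩ := h.exists_norm_bound
  refine ⟨η + 1, by positivity, fun ε hε => ?_⟩
  set r : ℝ := min ε 1 / 2 with hr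
  have hr0 : 0 < r := by positivity
  have hrε : r < ε := by
    have := min_le_left ε 1
    linarith
  have hr1 : r < 1 := by
    have := min_le_right ε 1
    linarith
  obtain ⟨R, hR⟩ := hlim (r / 8) (by positivity)
  refine ⟨R + 1, fun w hw hRw => ?_⟩
  have hw' : η + 1 < w.im := hw
  have hball : closedBall w r ⊆ HP η := fun z hz => by
    change η < z.im
    have h1 : ‖z - w‖ ≤ r := by simpa [dist_eq_norm] using hz
    have h2 := (abs_le.1 ((abs_im_le_norm (z - w)).trans h1)).1
    rw [sub_im] at h2
    linarith
  have hclose : ∀ z ∈ closedBall w r, ‖f z - z‖ < r / 8 := fun z hz => by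
    refine hR z (hball hz) ?_
    have h1 : ‖z - w‖ ≤ r := by simpa [dist_eq_norm] using hz
    have h2 := norm_sub_norm_le w z
    rw [norm_sub_rev] at h2
    linarith
  have hself : w ∈ closedBall w r := mem_closedBall_self hr0.le
  have hsph : ∀ z ∈ sphere w r, 3 * r / 4 ≤ ‖f z - f w‖ := fun z hz => by
    have h1 : ‖z - w‖ = r := by simpa [dist_eq_norm] using hz
    have h2 := hclose z (sphere_subset_closedBall hz)
    have h3 := hclose w hself
    have h4 : ‖z - w‖ ≤ ‖f z - f w‖ + ‖f z - z‖ + ‖f w - w‖ := by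
      have : z - w = (f z - f w) - (f z - z) + (f w - w) := by ring
      calc ‖z - w‖ = ‖(f z - f w) - (f z - z) + (f w - w)‖ := by rw [← this]
        _ ≤ _ := (norm_add_le _ _).trans (by gcongr; exact norm_sub_le _ _)
    linarith
  have hd : DifferentiableOn ℂ f (closedBall w r) := hf.mono (hball.trans hsub)
  have hdc : DiffContOnCl ℂ f (ball w r) := hd.diffContOnCl_ball subset_rfl
  have hfreq : ∃ᶠ z in 𝓝 w, f z ≠ f w := by
    by_contra hc
    rw [not_frequently] at hc
    have hc' : ∀ᶠ z in 𝓝 w, f z = f w := hc.mono fun z hz => not_not.1 hz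
    have hA : AnalyticOnNhd ℂ f (ball w r) :=
      (hd.mono ball_subset_closedBall).analyticOnNhd isOpen_ball
    have hE := hA.eqOn_of_preconnected_of_eventuallyEq (g := fun _ => f w)
      analyticOnNhd_const (convex_ball w r).isPreconnected (mem_ball_self hr0) hc'
    have hz : w + (r / 2 : ℝ) ∈ ball w r := by
      rw [mem_ball, dist_eq_norm, add_sub_cancel_left, norm_real, Real.norm_eq_abs,
        abs_of_pos (by positivity)]
      linarith
    have h1 := hclose _ (ball_subset_closedBall hz)
    rw [hE hz] at h1
    have h2 := hclose w hself
    have h3 : ‖((r / 2 : ℝ) : ℂ)‖ ≤ ‖f w - w‖ + ‖f w - (w + (r / 2 : ℝ))‖ := by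
      have : ((r / 2 : ℝ) : ℂ) = (f w - w) - (f w - (w + (r / 2 : ℝ))) := by ring
      calc ‖((r / 2 : ℝ) : ℂ)‖ = ‖(f w - w) - (f w - (w + (r / 2 : ℝ)))‖ := by rw [← this]
        _ ≤ _ := norm_sub_le _ _
    rw [norm_real, Real.norm_eq_abs, abs_of_pos (by positivity)] at h3
    linarith
  have himg := hdc.ball_subset_image_closedBall hr0 hsph hfreq
  have hmem : w ∈ ball (f w) (3 * r / 4 / 2) := by
    rw [mem_ball, dist_eq_norm, norm_sub_rev]
    have := hclose w hself
    linarith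
  obtain ⟨u, hu, huw⟩ := himg hmem
  refine ⟨u, hsub (hball hu), huw, ?_⟩
  have h1 : ‖u - w‖ ≤ r := by simpa [dist_eq_norm] using hu
  linarith

/-- If `g ∘ φ = f`, where `f` and `g` satisfy (H.1) and `g` is univalent, then `φ` satisfies
(H.1). -/
theorem SatisfiesH1.of_comp {D E : Set ℂ} {f g φ : ℂ → ℂ} (hf : SatisfiesH1 D f)
    (hg : SatisfiesH1 E g) (hgd : DifferentiableOn ℂ g E) (hgi : InjOn g E)
    (hφ : MapsTo φ D E) (hc : EqOn (g ∘ φ) f D) : SatisfiesH1 D φ := by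
  obtain ⟨η, hη, hsub, hlim⟩ := hf.exists_norm_bound
  obtain ⟨η', hη', hinv⟩ := hg.exists_preimage hgd
  refine ⟨η + η' + 1, by positivity, fun z hz => hsub ?_, ?_⟩
  · change η < z.im
    have : η + η' + 1 < z.im := hz
    linarith
  rw [Metric.tendsto_nhds]
  intro ε hε
  rw [eventually_inf_principal, ← comap_norm_atTop, eventually_comap]
  obtain ⟨R, hR⟩ := hlim (min (ε / 2) 1) (by positivity)
  obtain ⟨R', hR'⟩ := hinv (ε / 2) (by positivity)
  filter_upwards [eventually_ge_atTop R, eventually_ge_atTop (R' + 1)] with x hx hx' z hzx hz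
  subst hzx
  have hz' : η + η' + 1 < z.im := hz
  have hzη : z ∈ HP η := by
    change η < z.im
    linarith
  have h1 := hR z hzη hx
  have h1a := h1.trans_le (min_le_left _ _)
  have h1b := h1.trans_le (min_le_right _ _)
  have him := (abs_lt.1 ((abs_im_le_norm _).trans_lt h1b)).1
  rw [sub_im] at him
  obtain ⟨u, hu, huf, hlt⟩ := hR' (f z) (by change η' < _; linarith) (by
    have := norm_sub_norm_le z (f z)
    rw [norm_sub_rev] at this
    linarith)
  have huφ : u = φ z := hgi hu (hφ (hsub hzη)) (huf.trans (hc (hsub hzη)).symm)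
  rw [dist_zero_right]
  rw [huφ] at hlt
  calc ‖φ z - z‖ = ‖(φ z - f z) + (f z - z)‖ := by congr 1; ring
    _ ≤ _ := norm_add_le _ _
    _ < ε := by linarith

theorem Sector.im_ge {θ : ℝ} (hθ : 0 < θ) {z : ℂ} (hz : z ∈ Sector θ) :
    ‖z‖ * Real.sin θ ≤ z.im := by
  rw [← norm_mul_sin_arg z]
  gcongr
  obtain ⟨h1, h2⟩ := hz
  rcases le_total z.arg (Real.pi / 2) with h | h
  · exact Real.sin_le_sin_of_le_of_le_pi_div_two (by linarith) h h1.le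
  · rw [← Real.sin_pi_sub z.arg]
    exact Real.sin_le_sin_of_le_of_le_pi_div_two (by linarith) (by linarith) (by linarith)

theorem cobounded_inf_sector_le {θ : ℝ} (hθ : 0 < θ) (hθ' : θ < Real.pi / 2) (η : ℝ) :
    cobounded ℂ ⊓ 𝓟 (Sector θ) ≤ cobounded ℂ ⊓ 𝓟 (HP η) := by
  refine le_inf inf_le_left (le_principal_iff.2 ?_)
  have hs : 0 < Real.sin θ := Real.sin_pos_of_pos_of_lt_pi hθ (by linarith [Real.pi_pos])
  change ∀ᶠ z in _, z ∈ HP η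
  rw [eventually_inf_principal, ← comap_norm_atTop, eventually_comap]
  filter_upwards [eventually_gt_atTop (η / Real.sin θ)] with x hx z hzx hz
  subst hzx
  exact ((div_lt_iff₀ hs).1 hx).trans_le (Sector.im_ge hθ hz)

theorem SatisfiesH1.tendsto_sector {D : Set ℂ} {f : ℂ → ℂ} (h : SatisfiesH1 D f) {θ : ℝ}
    (hθ : 0 < θ) (hθ' : θ < Real.pi / 2) :
    Tendsto (fun z => f z - z) (cobounded ℂ ⊓ 𝓟 (Sector θ)) (𝓝 0) := by
  obtain ⟨η, -, -, hlim⟩ := h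
  exact hlim.mono_left (cobounded_inf_sector_le hθ hθ' η)

theorem SatisfiesH1.eventually_mem_sector {D : Set ℂ} {f : ℂ → ℂ} (h : SatisfiesH1 D f) {θ : ℝ}
    (hθ : 0 < θ) (hθ' : θ < Real.pi / 2) :
    ∀ᶠ z in cobounded ℂ ⊓ 𝓟 (Sector θ), z ∈ D := by
  obtain ⟨η, -, hsub, -⟩ := h
  exact cobounded_inf_sector_le hθ hθ' η (mem_inf_of_right hsub)

theorem eventually_ne_zero_sector (θ : ℝ) :
    ∀ᶠ z in cobounded ℂ ⊓ 𝓟 (Sector θ), z ≠ 0 :=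
  Filter.Eventually.filter_mono inf_le_left (eventually_ne_cobounded 0)

theorem tendsto_div_sector {θ : ℝ} {g : ℂ → ℂ}
    (hg : Tendsto (fun z => g z - z) (cobounded ℂ ⊓ 𝓟 (Sector θ)) (𝓝 0)) :
    Tendsto (fun z => g z / z) (cobounded ℂ ⊓ 𝓟 (Sector θ)) (𝓝 1) := by
  have h1 : Tendsto (fun z : ℂ => z⁻¹) (cobounded ℂ ⊓ 𝓟 (Sector θ)) (𝓝 0) :=
    tendsto_inv₀_cobounded.mono_left inf_le_left
  have h2 := (hg.mul h1).const_add 1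
  rw [mul_zero, add_zero] at h2
  refine h2.congr' ((eventually_ne_zero_sector θ).mono fun z hz => ?_)
  field_simp
  ring

/-- A map asymptotic to the identity sends large points of a sector into slightly larger
sectors. -/
theorem tendsto_sector_of_sub {θ θ' : ℝ} (hθ' : 0 < θ') (hlt : θ' < θ) {g : ℂ → ℂ}
    (hg : Tendsto (fun z => g z - z) (cobounded ℂ ⊓ 𝓟 (Sector θ)) (𝓝 0)) :
    Tendsto g (cobounded ℂ ⊓ 𝓟 (Sector θ)) (cobounded ℂ ⊓ 𝓟 (Sector θ')) := by
  have hdiv := tendsto_div_sector hg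
  refine tendsto_inf.2 ⟨?_, tendsto_principal.2 ?_⟩
  · rw [← tendsto_norm_atTop_iff_cobounded]
    have h1 : Tendsto (fun z : ℂ => ‖z‖ - 1) (cobounded ℂ ⊓ 𝓟 (Sector θ)) atTop :=
      tendsto_atTop_add_const_right _ _ (tendsto_norm_cobounded_atTop.mono_left inf_le_left)
    refine tendsto_atTop_mono' _ ?_ h1
    filter_upwards [hg.eventually (ball_mem_nhds 0 one_pos)] with z hz
    rw [dist_zero_right] at hz
    have := norm_sub_norm_le z (g z)
    rw [norm_sub_rev] at this
    linarith
  · have harg : Tendsto (fun z => (g z / z).arg) (cobounded ℂ ⊓ 𝓟 (Sector θ)) (𝓝 0) := by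
      have := (continuousAt_arg (x := 1) (by simp)).tendsto.comp hdiv
      rwa [arg_one] at this
    filter_upwards [harg.eventually (ball_mem_nhds 0 (sub_pos.2 hlt)),
      eventually_ne_zero_sector θ, hdiv.eventually_ne one_ne_zero,
      (eventually_principal.2 fun z hz => hz : ∀ᶠ z in 𝓟 (Sector θ), z ∈ Sector θ).filter_mono
        inf_le_right] with z h1 hz0 hq hz
    rw [dist_zero_right, Real.norm_eq_abs, abs_lt] at h1
    obtain ⟨h2, h3⟩ := hz
    have h4 : (z * (g z / z)).arg = z.arg + (g z / z).arg :=
      arg_mul hz0 hq ⟨by linarith [Real.pi_pos], by linarith⟩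
    rw [mul_div_cancel₀ _ hz0] at h4
    change θ' < (g z).arg ∧ (g z).arg < Real.pi - θ'
    rw [h4]
    constructor <;> linarith

/-- If `g ∘ φ = f`, the angular residue of `φ` is the difference of those of `f` and `g`. -/
theorem SatisfiesH2.of_comp {D : Set ℂ} {f g φ : ℂ → ℂ} {c d : ℂ} (hf : SatisfiesH2 f c)
    (hg : SatisfiesH2 g d) (hφ : SatisfiesH1 D φ) (hc : EqOn (g ∘ φ) f D) :
    SatisfiesH2 φ (c - d) := by
  intro θ hθ hθ'
  have h0 := hφ.tendsto_sector hθ hθ'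
  have h1 := hf θ hθ hθ'
  have hS := tendsto_sector_of_sub (half_pos hθ) (half_lt_self hθ) h0
  have h2 := (hg (θ / 2) (half_pos hθ) (by linarith)).comp hS
  have h3 := (tendsto_div_sector h0).inv₀ one_ne_zero
  have h4 := h1.sub (h3.mul h2)
  rw [inv_one, one_mul, sub_neg_eq_add, neg_add_eq_sub, ← neg_sub c d] at h4
  refine h4.congr' ?_
  filter_upwards [hφ.eventually_mem_sector hθ hθ', eventually_ne_zero_sector θ,
    (hS.mono_right inf_le_left).eventually (eventually_ne_cobounded 0)] with z hz hz0 hφ0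
  have hcz : g (φ z) = f z := hc hz
  simp only [Function.comp_apply, hcz]
  field_simp
  ring

/-- The angular residue of a map which does not decrease imaginary parts has nonnegative real
part. -/
theorem SatisfiesH2.re_nonneg {D : Set ℂ} {f : ℂ → ℂ} {c : ℂ} (h1 : SatisfiesH1 D f)
    (h2 : SatisfiesH2 f c) (him : ∀ z ∈ D, 0 ≤ (f z - z).im) : 0 ≤ c.re := by
  have hθ : 0 < Real.pi / 4 := by positivity
  have hθ' : Real.pi / 4 < Real.pi / 2 := by linarith [Real.pi_pos]
  have hT : Tendsto (fun y : ℝ => (y * I : ℂ)) atTop (cobounded ℂ ⊓ 𝓟 (Sector (Real.pi / 4))) := by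
    refine tendsto_inf.2 ⟨?_, tendsto_principal.2 ?_⟩
    · rw [← tendsto_norm_atTop_iff_cobounded]
      refine tendsto_id.congr' ?_
      filter_upwards [eventually_gt_atTop 0] with y hy
      simp [abs_of_pos hy]
    · filter_upwards [eventually_gt_atTop 0] with y hy
      change _ < _ ∧ _ < _
      rw [arg_real_mul _ hy, arg_I]
      constructor <;> linarith [Real.pi_pos]
  have h3 := (continuous_re.tendsto _).comp ((h2 _ hθ hθ').comp hT)
  have h4 : (-c).re ≤ 0 := by
    refine le_of_tendsto h3 ?_
    filter_upwards [hT.eventually (h1.eventually_mem_sector hθ hθ'), eventually_gt_atTop 0]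
      with y hy hy0
    have := him _ hy
    have e : ((y * I : ℂ) * (f (y * I) - y * I)).re = -(y * (f (y * I) - y * I).im) := by
      rw [mul_assoc, re_ofReal_mul, I_mul_re, mul_neg]
    simp only [Function.comp_apply, e]
    exact neg_nonpos.2 (mul_nonneg hy0.le this)
  simpa using h4

theorem statement5 {T : ℝ} (hT : 0 < T) {I : Set ℝ}
    (hI : I = Set.Ico 0 T ∨ I = Set.Icc 0 T)
    {D : ℝ → Set ℂ} {Dcod : Set ℂ} {f : ℝ → ℂ → ℂ} {ell : ℝ → ℂ}
    (hLC : IsLoewnerChain I D Dcod f ell) :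
    IsEvolutionFamily I D
      (fun t s z => Function.invFunOn (f t) (D t) (f s z))
      (fun t => ell 0 - ell t) ∧
    ∀ t ∈ I, (ell 0 - ell t).re ≤ (ell 0).re := by
  have h0I : (0 : ℝ) ∈ I ∧ ∀ t ∈ I, 0 ≤ t := by
    rcases hI with rfl | rfl
    · exact ⟨⟨le_rfl, hT⟩, fun t ht => ht.1⟩
    · exact ⟨⟨le_rfl, hT.le⟩, fun t ht => ht.1⟩
  obtain ⟨h0, hnn⟩ := h0I
  have hmem : ∀ s ∈ I, ∀ t ∈ I, s ≤ t → ∀ z ∈ D s, f s z ∈ f t '' D t :=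
    fun s hs t ht hst z hz => hLC.lc1 s hs t ht hst (mem_image_of_mem _ hz)
  have hright : ∀ s ∈ I, ∀ t ∈ I, s ≤ t → ∀ z ∈ D s,
      f t (Function.invFunOn (f t) (D t) (f s z)) = f s z :=
    fun s hs t ht hst z hz => Function.invFunOn_eq (hmem s hs t ht hst z hz)
  have hmaps : ∀ s ∈ I, ∀ t ∈ I, s ≤ t →
      MapsTo (fun z => Function.invFunOn (f t) (D t) (f s z)) (D s) (D t) :=
    fun s hs t ht hst z hz => Function.invFunOn_mem (hmem s hs t ht hst z hz)
  have hopen : ∀ t ∈ I, IsOpen (D t) := fun t ht => by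
    obtain ⟨N, a, b, h, -, e⟩ := (hLC.slit t ht).exists_slits
    exact e ▸ h.isOpen_sdiff isOpen_UHP
  have hH1 : ∀ s ∈ I, ∀ t ∈ I, s ≤ t →
      SatisfiesH1 (D s) (fun z => Function.invFunOn (f t) (D t) (f s z)) :=
    fun s hs t ht hst => (hLC.h1 s hs).of_comp (hLC.h1 t ht) (hLC.holo t ht) (hLC.inj t ht)
      (hmaps s hs t ht hst) (hright s hs t ht hst)
  have hH2 : ∀ s ∈ I, ∀ t ∈ I, s ≤ t →
      SatisfiesH2 (fun z => Function.invFunOn (f t) (D t) (f s z)) (ell s - ell t) :=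
    fun s hs t ht hst => (hLC.h2 s hs).of_comp (hLC.h2 t ht) (hH1 s hs t ht hst)
      (hright s hs t ht hst)
  obtain ⟨M, c, d, hcd, hcd', rfl⟩ := hLC.slitcod.exists_slits
  refine ⟨⟨hLC.slit, hmaps, fun s hs t ht hst => ?_, fun s hs t ht hst z hz w hw e => ?_, hH1,
    fun s hs t ht hst => ⟨_, hH2 s hs t ht hst⟩, fun s hs t ht hst => ?_,
    fun t ht z hz => (hLC.inj t ht).leftInvOn_invFunOn hz, fun s hs t ht u hu hst htu z hz => ?_,
    fun t ht => hH2 0 h0 t ht (hnn t ht), continuousOn_const.sub hLC.lc2⟩, fun t ht => ?_⟩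
  · exact (differentiableOn_of_leftInvOn (hopen t ht) (hLC.holo t ht) (hLC.inj t ht)
      (hLC.inj t ht).leftInvOn_invFunOn).comp (hLC.holo s hs) (hmem s hs t ht hst)
  · refine hLC.inj s hs hz hw ?_
    rw [← hright s hs t ht hst z hz, ← hright s hs t ht hst w hw]
    exact congrArg (f t) e
  · obtain ⟨N, a, b, hab, -, e⟩ := (hLC.slit t ht).exists_slits
    have hf := hLC.holo t ht
    have hi := hLC.inj t ht
    have hm := hLC.mapsTo t ht
    have h1 := hLC.h1 t ht
    have h3 := hLC.h3 t ht
    have hS := hLC.lc1 s hs t ht hst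
    rw [← image_image (Function.invFunOn (f t) (D t)) (f s)]
    rw [e] at hf hi hm h1 h3 hS ⊢
    exact isHHull_sdiff_invFunOn_image hab hcd hf hi hm h1 h3 hS (hLC.h3 s hs)
  · simp only [hright s hs t ht hst z hz]
  · obtain ⟨N, a, b, hab, hab', e⟩ := (hLC.slit t ht).exists_slits
    have hf := hLC.holo t ht
    have hi := hLC.inj t ht
    have hm := hLC.mapsTo t ht
    have h1 := hLC.h1 t ht
    have h3 := hLC.h3 t ht
    have h2 := hLC.h2 t ht
    rw [e] at hf hi hm h1 h3
    have := h2.re_nonneg h1 (im_le_im_of_slitCorr hab hab' hcd' hf (hm.mono_right sdiff_subset) h1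
      (exists_slitCorr hab hcd hf hi hm h1 h3))
    rw [sub_re]
    linarith
end
end

section
/- Let D₁ and D₂ be parallel slit half-planes, each with N slits, and let F ⊆ D₂ be an ℍ-hull. If f and g are both holomorphic bijections from D₁ onto D₂ ∖ F, each satisfying (H.1) and (H.2) (with some finite angular residue), then f = g. -/
open Complex Set Filter Topology Bornology MeasureTheory Metric

noncomputable section

/-- The filter of neighbourhoods of infinity within the half-plane `HP η`. -/
def hpInfty (η : ℝ) : Filter ℂ := cobounded ℂ ⊓ 𝓟 (HP η)

theorem HP_mono {η η' : ℝ} (h : η ≤ η') : HP η' ⊆ HP η := fun _ hz => h.trans_lt hz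

theorem isOpen_HP (η : ℝ) : IsOpen (HP η) := isOpen_lt continuous_const continuous_im

theorem convex_HP (η : ℝ) : Convex ℝ (HP η) := convex_halfSpace_im_gt η

theorem hpInfty_mono {η η' : ℝ} (h : η ≤ η') : hpInfty η' ≤ hpInfty η :=
  inf_le_inf_left _ (principal_mono.2 (HP_mono h))

theorem closedBall_subset_HP {η r : ℝ} {c : ℂ} (hc : c ∈ HP (η + r)) :
    closedBall c r ⊆ HP η := by
  intro z hz
  have h1 : |(z - c).im| ≤ r := (abs_im_le_norm _).trans (by simpa [dist_eq_norm] using hz)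
  have h2 : η + r < c.im := hc
  have h3 := (abs_le.1 h1).1
  rw [sub_im] at h3
  change η < z.im
  linarith

theorem eventually_hpInfty {η : ℝ} {p : ℂ → Prop} :
    (∀ᶠ z in hpInfty η, p z) ↔ ∃ R : ℝ, ∀ z : ℂ, R < ‖z‖ → η < z.im → p z := by
  have h : (hpInfty η).HasBasis (fun _ : ℝ => True)
      (fun R => norm ⁻¹' Ioi R ∩ HP η) := by
    unfold hpInfty
    rw [← comap_norm_atTop]
    exact (atTop_basis_Ioi.comap _).inf_principal _
  rw [h.eventually_iff]
  simp [HP]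

theorem norm_lt_of_tendsto_hpInfty {f : ℂ → ℂ} {η : ℝ}
    (hf : Tendsto (fun z => f z - z) (hpInfty η) (𝓝 0)) {r : ℝ} (hr : 0 < r) :
    ∃ R : ℝ, ∀ z : ℂ, R < ‖z‖ → η < z.im → ‖f z - z‖ < r :=
  eventually_hpInfty.1 (by simpa using hf.eventually (ball_mem_nhds 0 hr))

theorem tendsto_hpInfty_self {f : ℂ → ℂ} {η : ℝ}
    (hf : Tendsto (fun z => f z - z) (hpInfty η) (𝓝 0)) :
    Tendsto f (hpInfty (η + 1)) (hpInfty η) := by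
  obtain ⟨R, hR⟩ := norm_lt_of_tendsto_hpInfty hf one_pos
  intro s hs
  obtain ⟨S, hS⟩ := eventually_hpInfty.1 (show ∀ᶠ z in hpInfty η, z ∈ s from hs)
  refine eventually_hpInfty.2 ⟨max R (S + 1), fun z hz hz' => ?_⟩
  have h1 := hR z ((le_max_left _ _).trans_lt hz) (by linarith)
  have h2 := (le_max_right _ _).trans_lt hz
  refine hS _ ?_ ?_
  · have := norm_sub_norm_le z (f z)
    rw [norm_sub_rev] at this
    linarith
  · exact closedBall_subset_HP (show z ∈ HP (η + 1) from hz')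
      (by simpa [dist_eq_norm] using h1.le)

theorem tendsto_comp_hpInfty {f k : ℂ → ℂ} {η : ℝ}
    (hf : Tendsto (fun z => f z - z) (hpInfty η) (𝓝 0))
    (hk : Tendsto (fun z => k z - z) (hpInfty η) (𝓝 0)) :
    Tendsto (fun z => k (f z) - z) (hpInfty (η + 1)) (𝓝 0) := by
  have h := (hk.comp (tendsto_hpInfty_self hf)).add
    (hf.mono_left (hpInfty_mono (by linarith : η ≤ η + 1)))
  simpa using h

section Inverse

variable {D : Set ℂ} {f : ℂ → ℂ}

theorem not_eventually_eq_of_injOn {a : ℂ} (hD : D ∈ 𝓝 a) (hf : InjOn f D) :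
    ∃ᶠ z in 𝓝 a, f z ≠ f a := by
  have h : ∃ᶠ z in 𝓝[≠] a, z ∈ D :=
    Eventually.frequently (mem_nhdsWithin_of_mem_nhds hD)
  rw [frequently_nhdsWithin_iff] at h
  exact h.mono fun z hz e => hz.2 (hf hz.1 (mem_of_mem_nhds hD) e)

theorem nhds_le_map_of_injOn_s7 (hD : IsOpen D) (hfd : DifferentiableOn ℂ f D) (hf : InjOn f D)
    {a : ℂ} (ha : a ∈ D) : 𝓝 (f a) ≤ map f (𝓝 a) :=
  (hfd.analyticAt (hD.mem_nhds ha)).eventually_constant_or_nhds_le_map_nhds.resolve_left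
    fun h => not_eventually_eq_of_injOn (hD.mem_nhds ha) hf (h.mono fun _ => not_not_intro)

theorem continuousAt_invFunOn (hD : IsOpen D) (hfd : DifferentiableOn ℂ f D) (hf : InjOn f D)
    {a : ℂ} (ha : a ∈ D) : ContinuousAt (Function.invFunOn f D) (f a) := by
  intro s hs
  rw [hf.leftInvOn_invFunOn ha] at hs
  have h := nhds_le_map_of_injOn_s7 hD hfd hf ha (image_mem_map (inter_mem hs (hD.mem_nhds ha)))
  refine mem_map.2 (mem_of_superset h ?_)
  rintro _ ⟨z, ⟨hzs, hzD⟩, rfl⟩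
  rwa [mem_preimage, hf.leftInvOn_invFunOn hzD]

theorem image_mem_nhds_of_injOn (hD : IsOpen D) (hfd : DifferentiableOn ℂ f D)
    (hf : InjOn f D) {a : ℂ} (ha : a ∈ D) : f '' D ∈ 𝓝 (f a) :=
  nhds_le_map_of_injOn_s7 hD hfd hf ha (image_mem_map (hD.mem_nhds ha))

theorem differentiableAt_invFunOn_of_deriv_ne_zero (hD : IsOpen D)
    (hfd : DifferentiableOn ℂ f D) (hf : InjOn f D) {a : ℂ} (ha : a ∈ D)
    (h0 : deriv f a ≠ 0) : DifferentiableAt ℂ (Function.invFunOn f D) (f a) := by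
  have h1 : HasDerivAt f (deriv f a) (Function.invFunOn f D (f a)) := by
    rw [hf.leftInvOn_invFunOn ha]
    exact (hfd.differentiableAt (hD.mem_nhds ha)).hasDerivAt
  refine (h1.of_local_left_inverse (continuousAt_invFunOn hD hfd hf ha) h0 ?_).differentiableAt
  filter_upwards [image_mem_nhds_of_injOn hD hfd hf ha] with w hw
  exact Function.invFunOn_eq hw

theorem eventually_deriv_ne_zero_of_injOn (hD : IsOpen D)
    (hfd : DifferentiableOn ℂ f D) (hf : InjOn f D) {a : ℂ} (ha : a ∈ D) :
    ∀ᶠ z in 𝓝[≠] a, deriv f z ≠ 0 := by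
  refine (hfd.deriv hD |>.analyticAt (hD.mem_nhds ha)).eventually_eq_zero_or_eventually_ne_zero
    |>.resolve_left fun h => ?_
  obtain ⟨r, hr, hball⟩ := Metric.eventually_nhds_iff_ball.1 (h.and (hD.eventually_mem ha))
  refine not_eventually_eq_of_injOn (hD.mem_nhds ha) hf ?_
  filter_upwards [ball_mem_nhds a hr] with z hz
  have := (convex_ball a r).norm_image_sub_le_of_norm_deriv_le (f := f) (C := 0)
    (fun x hx => hfd.differentiableAt (hD.mem_nhds (hball x hx).2))
    (fun x hx => by simp [(hball x hx).1]) (mem_ball_self hr) hz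
  rw [zero_mul, norm_le_zero_iff, sub_eq_zero] at this
  simpa using this

/-- The inverse of an injective holomorphic function on an open set is holomorphic. -/
theorem differentiableOn_invFunOn (hD : IsOpen D) (hfd : DifferentiableOn ℂ f D)
    (hf : InjOn f D) : DifferentiableOn ℂ (Function.invFunOn f D) (f '' D) := by
  rintro _ ⟨a, ha, rfl⟩
  refine DifferentiableAt.differentiableWithinAt ?_
  have hcont := continuousAt_invFunOn hD hfd hf ha
  refine (analyticAt_of_differentiable_on_punctured_nhds_of_continuousAt ?_
    hcont).differentiableAt
  have h1 := eventually_deriv_ne_zero_of_injOn hD hfd hf ha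
  rw [eventually_nhdsWithin_iff] at h1 ⊢
  have h2 : Tendsto (Function.invFunOn f D) (𝓝 (f a)) (𝓝 a) := by
    simpa [ContinuousAt, hf.leftInvOn_invFunOn ha] using hcont
  filter_upwards [h2.eventually h1, image_mem_nhds_of_injOn hD hfd hf ha]
  rintro _ hz ⟨z, hzD, rfl⟩ hne
  rw [hf.leftInvOn_invFunOn hzD] at hz
  exact differentiableAt_invFunOn_of_deriv_ne_zero hD hfd hf hzD
    (hz fun h => hne (congrArg f h))

/-- The inverse of a hydrodynamically normalized injective holomorphic function is itself
hydrodynamically normalized. -/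
theorem tendsto_invFunOn_hpInfty (hD : IsOpen D) (hfd : DifferentiableOn ℂ f D)
    (hf : InjOn f D) {η : ℝ} (hη : HP η ⊆ D)
    (hlim : Tendsto (fun z => f z - z) (hpInfty η) (𝓝 0)) :
    Tendsto (fun z => Function.invFunOn f D z - z) (hpInfty (η + 1)) (𝓝 0) := by
  rw [(nhds_basis_closedBall (x := (0 : ℂ))).tendsto_right_iff]
  intro ε hε
  set r := min ε 1
  have hr : 0 < r := lt_min hε one_pos
  obtain ⟨R, hR⟩ := norm_lt_of_tendsto_hpInfty hlim (show 0 < r / 5 by positivity)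
  refine eventually_hpInfty.2 ⟨R + 1, fun w hw hw' => ?_⟩
  have hr1 : r ≤ 1 := min_le_right _ _
  have hsub : closedBall w r ⊆ HP η := closedBall_subset_HP (show η + r < w.im by linarith)
  have hclose : ∀ z ∈ closedBall w r, ‖f z - z‖ < r / 5 := by
    intro z hz
    refine hR z ?_ (hsub hz)
    have h1 := norm_sub_norm_le w z
    have h2 : ‖z - w‖ ≤ r := by simpa [dist_eq_norm] using hz
    rw [norm_sub_rev] at h1
    linarith
  have hww := hclose w (mem_closedBall_self hr.le)
  have hdc : DiffContOnCl ℂ f (ball w r) := by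
    refine (hfd.mono ?_).diffContOnCl
    rw [closure_ball _ hr.ne']
    exact hsub.trans hη
  have hcov := hdc.ball_subset_image_closedBall (ε := 3 * r / 5) hr ?_
    (not_eventually_eq_of_injOn (hD.mem_nhds (hη (hsub (mem_closedBall_self hr.le)))) hf)
  · obtain ⟨z, hz, hzw⟩ := hcov (show w ∈ ball (f w) (3 * r / 5 / 2) by
      rw [mem_ball, dist_eq_norm, norm_sub_rev]; linarith)
    rw [← hzw, hf.leftInvOn_invFunOn (hη (hsub hz)), hzw, mem_closedBall, dist_zero_right]
    have h2 : ‖z - w‖ ≤ r := by simpa [dist_eq_norm] using hz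
    exact h2.trans (min_le_left _ _)
  · intro z hz
    have h1 := hclose z (sphere_subset_closedBall hz)
    have h2 : ‖z - w‖ = r := by simpa [dist_eq_norm] using hz
    have h3 : z - w = (f z - f w) - (f z - z) + (f w - w) := by ring
    have h4 : ‖z - w‖ ≤ ‖f z - f w‖ + ‖f z - z‖ + ‖f w - w‖ := by
      conv_lhs => rw [h3]
      exact (norm_add_le _ _).trans (add_le_add_left (norm_sub_le _ _) _)
    linarith

end Inverse

/-- If `φ` maps `HP M` holomorphically into the upper half-plane and `φ (i y) - i y → 0`, then
`φ` lowers imaginary parts by at most `M + 1`. -/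
theorem im_sub_le_im_of_tendsto {M : ℝ} {φ : ℂ → ℂ}
    (hd : DifferentiableOn ℂ φ (HP M)) (hpos : ∀ z ∈ HP M, 0 < (φ z).im)
    (hlim : Tendsto (fun y : ℝ => φ (y * I) - y * I) atTop (𝓝 0)) {z : ℂ} (hz : M < z.im) :
    z.im - (M + 1) ≤ (φ z).im := by
  rcases le_or_gt z.im (M + 1) with h | h
  · linarith [hpos z hz]
  let m : ℂ → ℂ := fun ζ => ζ * I + (M + 1 : ℝ) * I
  have hm_im : ∀ ζ, (m ζ).im = ζ.re + (M + 1) := fun ζ => by simp [m]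
  have hmem : ∀ ζ : ℂ, 0 ≤ ζ.re → m ζ ∈ HP M := fun ζ hζ => by
    change M < _
    rw [hm_im]; linarith
  let G : ℂ → ℂ := fun ζ => exp ((φ (m ζ) - m ζ) * I)
  have hG : ∀ ζ, ‖G ζ‖ = Real.exp (ζ.re + (M + 1) - (φ (m ζ)).im) := fun ζ => by
    simp only [G, norm_exp, mul_I_re, sub_im, hm_im]
    congr 1; ring
  have hG' : ∀ ζ : ℂ, 0 ≤ ζ.re → ‖G ζ‖ ≤ Real.exp (ζ.re + (M + 1)) := fun ζ hζ => by
    rw [hG, Real.exp_le_exp]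
    linarith [hpos _ (hmem ζ hζ)]
  have hmd : Differentiable ℂ m := by fun_prop
  have key : ‖G ((z - (M + 1 : ℝ) * I) / I)‖ ≤ Real.exp (M + 1) := by
    refine PhragmenLindelof.right_half_plane_of_bounded_on_real ?_
      ⟨1, one_lt_two, 1, ?_⟩ ?_ ?_ ?_
    · refine DifferentiableOn.diffContOnCl ?_
      rw [closure_setOfPred_lt_re]
      intro ζ hζ
      have h1 : DifferentiableAt ℂ φ (m ζ) :=
        hd.differentiableAt ((isOpen_HP M).mem_nhds (hmem ζ hζ))
      have h2 : DifferentiableAt ℂ (fun ζ => φ (m ζ)) ζ := h1.comp ζ (hmd ζ)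
      exact ((h2.sub (hmd ζ)).mul_const I).cexp.differentiableWithinAt
    · refine Asymptotics.IsBigO.of_bound (Real.exp (M + 1))
        (eventually_inf_principal.2 (Eventually.of_forall fun ζ hζ => ?_))
      refine (hG' ζ (le_of_lt hζ)).trans ?_
      rw [Real.norm_eq_abs, Real.abs_exp, ← Real.exp_add, Real.exp_le_exp, Real.rpow_one]
      linarith [re_le_norm ζ]
    · have h1 : Tendsto (fun x : ℝ => x + (M + 1)) atTop atTop :=
        tendsto_atTop_add_const_right _ _ tendsto_id
      have h2 : Tendsto (fun x : ℝ => G x) atTop (𝓝 (exp (0 * I))) := by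
        refine (continuous_exp.tendsto _).comp ((hlim.comp h1).mul_const I |>.congr fun x => ?_)
        simp [m, add_mul]
      exact h2.norm.isBoundedUnder_le
    · intro x
      simpa using hG' (x * I) (by simp)
    · simp [div_I]; linarith
  have hmz : m ((z - (M + 1 : ℝ) * I) / I) = z := by
    simp only [m]; field_simp; ring
  rw [hG, hmz, Real.exp_le_exp, ← hm_im, hmz] at key
  linarith

/-- If `φ` distorts imaginary parts in `HP M` by at most `B`, then `φ - id` is a contraction
deep inside `HP M`. -/
theorem norm_sub_sub_le_of_abs_im_sub_le {M B : ℝ} {φ : ℂ → ℂ}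
    (hd : DifferentiableOn ℂ φ (HP M)) (hB : ∀ z ∈ HP M, |(φ z).im - z.im| ≤ B) {z w : ℂ}
    (hz : z ∈ HP (M + 2 * Real.exp (2 * B))) (hw : w ∈ HP (M + 2 * Real.exp (2 * B))) :
    ‖φ w - w - (φ z - z)‖ ≤ 1 / 2 * ‖w - z‖ := by
  set R := 2 * Real.exp (2 * B) with hR
  have hR0 : 0 < R := by positivity
  have hda : ∀ c ∈ HP M, DifferentiableAt ℂ (fun z => φ z - z) c := fun c hc =>
    (hd.differentiableAt ((isOpen_HP M).mem_nhds hc)).sub differentiableAt_id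
  refine (convex_HP (M + R)).norm_image_sub_le_of_norm_deriv_le (f := fun z => φ z - z)
    (fun c hc => hda c (HP_mono (by linarith) hc)) (fun c hc => ?_) hz hw
  have hcM : c ∈ HP M := HP_mono (by linarith) hc
  let G : ℂ → ℂ := fun ζ => exp ((φ ζ - ζ) * I)
  have hG : ∀ ζ, ‖G ζ‖ = Real.exp (-((φ ζ).im - ζ.im)) := fun ζ => by
    simp [G, norm_exp]
  have hGd : ∀ c ∈ HP M,
      HasDerivAt G (G c * (deriv (fun z => φ z - z) c * I)) c := fun c hc =>
    ((hda c hc).hasDerivAt.mul_const I).cexp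
  have hsub := closedBall_subset_HP hc
  have hest : ‖deriv G c‖ ≤ Real.exp B / R := by
    refine norm_deriv_le_of_forall_mem_sphere_norm_le hR0 ?_ fun ζ hζ => ?_
    · refine DifferentiableOn.diffContOnCl ?_
      rw [closure_ball _ hR0.ne']
      exact fun ζ hζ => (hGd ζ (hsub hζ)).differentiableAt.differentiableWithinAt
    · rw [hG, Real.exp_le_exp]
      linarith [(abs_le.1 (hB ζ (hsub (sphere_subset_closedBall hζ)))).1]
  rw [(hGd c hcM).deriv, norm_mul, norm_mul, norm_I, mul_one, hG] at hest
  have h1 : Real.exp (-B) ≤ Real.exp (-((φ c).im - c.im)) := by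
    rw [Real.exp_le_exp]
    linarith [(abs_le.1 (hB c hcM)).2]
  have h2 := (mul_le_mul_of_nonneg_right h1 (norm_nonneg _)).trans hest
  have h3 : Real.exp B / R = Real.exp (-B) * (1 / 2) := by
    rw [hR, Real.exp_neg, show 2 * B = B + B by ring, Real.exp_add]
    field_simp
  rw [h3] at h2
  exact le_of_mul_le_mul_left h2 (Real.exp_pos _)

section SelfMap

variable {D : Set ℂ} {M : ℝ} {h k : ℂ → ℂ}

theorem tendsto_iterate_vertical (hlim : Tendsto (fun z => h z - z) (hpInfty M) (𝓝 0)) (n : ℕ) :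
    Tendsto (fun y : ℝ => h^[n] (y * I) - y * I) atTop (𝓝 0) := by
  induction n with
  | zero => simp
  | succ n ih =>
    have him : Tendsto (fun y : ℝ => (h^[n] (y * I)).im) atTop atTop := by
      have h1 : Tendsto (fun y : ℝ => (h^[n] (y * I) - y * I).im + y) atTop atTop :=
        Tendsto.add_atTop ((continuous_im.tendsto _).comp ih) tendsto_id
      simpa using h1
    have hinf : Tendsto (fun y : ℝ => h^[n] (y * I)) atTop (hpInfty M) := by
      refine tendsto_inf.2 ⟨?_, tendsto_principal.2 (him.eventually_gt_atTop M)⟩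
      rw [← tendsto_norm_atTop_iff_cobounded]
      exact tendsto_atTop_mono (fun y => im_le_norm _) him
    have h2 := (hlim.comp hinf).add ih
    simpa [Function.iterate_succ_apply'] using h2

theorem im_sub_le_im_iterate (hDH : D ⊆ UHP) (hMD : HP M ⊆ D)
    (hd : DifferentiableOn ℂ h D) (hm : MapsTo h D D)
    (hlim : Tendsto (fun z => h z - z) (hpInfty M) (𝓝 0)) (n : ℕ) {z : ℂ} (hz : z ∈ D) :
    z.im - (M + 1) ≤ (h^[n] z).im := by
  rcases le_or_gt z.im M with hzM | hzM
  · have : 0 < (h^[n] z).im := hDH (hm.iterate n hz)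
    linarith
  · exact im_sub_le_im_of_tendsto ((hd.iterate hm n).mono hMD)
      (fun w hw => hDH (hm.iterate n (hMD hw))) (tendsto_iterate_vertical hlim n) hzM

/-- A hydrodynamically normalized automorphism of a domain between `HP M` and the upper half-plane
is the identity near infinity. -/
theorem eq_self_of_automorphism (hM : 0 ≤ M) (hDH : D ⊆ UHP) (hMD : HP M ⊆ D)
    (hhd : DifferentiableOn ℂ h D) (hhm : MapsTo h D D)
    (hh : Tendsto (fun z => h z - z) (hpInfty M) (𝓝 0))
    (hkd : DifferentiableOn ℂ k D) (hkm : MapsTo k D D)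
    (hk : Tendsto (fun z => k z - z) (hpInfty M) (𝓝 0)) (hkh : LeftInvOn k h D) {z : ℂ}
    (hz : M + 2 * Real.exp (2 * (M + 1)) + (M + 1) < z.im) : h z = z := by
  have hlow : ∀ n : ℕ, ∀ w ∈ D, w.im - (M + 1) ≤ (h^[n] w).im := fun n w hw =>
    im_sub_le_im_iterate hDH hMD hhd hhm hh n hw
  have hinv : ∀ n : ℕ, ∀ w ∈ D, k^[n] (h^[n] w) = w := by
    intro n
    induction n with
    | zero => simp
    | succ n ih =>
      intro w hw
      rw [Function.iterate_succ_apply', Function.iterate_succ_apply, ih _ (hhm hw), hkh hw]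
  have habs : ∀ n : ℕ, ∀ w ∈ D, |(h^[n] w).im - w.im| ≤ M + 1 := by
    intro n w hw
    have h1 := hlow n w hw
    have h2 := im_sub_le_im_iterate hDH hMD hkd hkm hk n (hhm.iterate n hw)
    rw [hinv n w hw] at h2
    rw [abs_le]
    constructor <;> linarith
  have hexp := Real.exp_pos (2 * (M + 1))
  have hzD : z ∈ D := hMD (show M < z.im by linarith)
  set δ := h z - z with hδ
  have hstep : ∀ n : ℕ, ‖h (h^[n] z) - h^[n] z - δ‖ ≤ 1 / 2 * ‖δ‖ := by
    intro n
    have h1 : z.im - (M + 1) ≤ (h z).im := hlow 1 z hzD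
    have := norm_sub_sub_le_of_abs_im_sub_le ((hhd.iterate hhm n).mono hMD)
      (fun w hw => habs n w (hMD hw))
      (show M + 2 * Real.exp (2 * (M + 1)) < z.im by linarith)
      (show M + 2 * Real.exp (2 * (M + 1)) < (h z).im by linarith)
    rw [← Function.iterate_succ_apply, Function.iterate_succ_apply'] at this
    convert this using 2
    rw [hδ]; ring
  have hsum : ∀ n : ℕ, ‖h^[n] z - z - n * δ‖ ≤ n * (1 / 2 * ‖δ‖) := by
    intro n
    induction n with
    | zero => simp
    | succ n ih =>
      have e : h^[n + 1] z - z - (n + 1 : ℕ) * δ =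
          (h^[n] z - z - n * δ) + (h (h^[n] z) - h^[n] z - δ) := by
        rw [Function.iterate_succ_apply']; push_cast; ring
      rw [e]
      refine (norm_add_le _ _).trans ((add_le_add ih (hstep n)).trans_eq ?_)
      push_cast; ring
  by_contra hne
  have hδ0 : 0 < ‖δ‖ := norm_pos_iff.2 (sub_ne_zero.2 hne)
  have hnorm : Tendsto (fun n : ℕ => ‖h^[n] z‖) atTop atTop := by
    have h1 : Tendsto (fun n : ℕ => (n : ℝ) * (1 / 2 * ‖δ‖) - ‖z‖) atTop atTop :=
      tendsto_atTop_add_const_right _ _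
        (tendsto_natCast_atTop_atTop.atTop_mul_const (by positivity))
    refine tendsto_atTop_mono (fun n => ?_) h1
    have h2 : (n : ℂ) * δ = h^[n] z - z - (h^[n] z - z - n * δ) := by ring
    have h3 : ‖(n : ℂ) * δ‖ ≤ ‖h^[n] z‖ + ‖z‖ + ‖h^[n] z - z - n * δ‖ := by
      conv_lhs => rw [h2]
      exact (norm_sub_le _ _).trans (add_le_add_left (norm_sub_le _ _) _)
    rw [norm_mul, norm_natCast] at h3
    linarith [hsum n]
  have hinf : Tendsto (fun n : ℕ => h^[n] z) atTop (hpInfty M) := by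
    refine tendsto_inf.2 ⟨tendsto_norm_atTop_iff_cobounded.1 hnorm,
      tendsto_principal.2 (Eventually.of_forall fun n => ?_)⟩
    have := hlow n z hzD
    change M < _
    linarith
  have h0 : Tendsto (fun n : ℕ => ‖h (h^[n] z) - h^[n] z - δ‖) atTop (𝓝 ‖δ‖) := by
    simpa using ((hh.comp hinf).sub_const δ).norm
  linarith [le_of_tendsto' h0 hstep]

end SelfMap

section SlitHalfPlane

variable {N : ℕ} {D : Set ℂ}

theorem IsParallelSlitHalfPlaneN.subset_UHP (hD : IsParallelSlitHalfPlaneN N D) : D ⊆ UHP := by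
  obtain ⟨C, -, -, rfl⟩ := hD
  exact sdiff_subset

theorem IsHorizontalSlit.isClosed {C : Set ℂ} (hC : IsHorizontalSlit C) : IsClosed C := by
  obtain ⟨y, xl, xr, -, -, rfl⟩ := hC
  exact (isClosed_eq continuous_im continuous_const).inter (isClosed_Icc.preimage continuous_re)

theorem IsParallelSlitHalfPlaneN.isOpen (hD : IsParallelSlitHalfPlaneN N D) : IsOpen D := by
  obtain ⟨C, hC, -, rfl⟩ := hD
  exact (isOpen_HP 0).sdiff (isClosed_iUnion_of_finite fun j => (hC j).isClosed)

/-- A sufficiently flat ray to the right which starts outside a horizontal slit avoids it. -/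
theorem IsHorizontalSlit.eventually_ray_notMem {C : Set ℂ} (hC : IsHorizontalSlit C) {z : ℂ}
    (hz : z ∉ C) : ∀ᶠ ε : ℝ in 𝓝[>] 0, ∀ t : ℝ, 0 ≤ t → z + t * (1 + ε * I) ∉ C := by
  obtain ⟨y, xl, xr, -, -, rfl⟩ := hC
  have hre : ∀ ε t : ℝ, (z + t * (1 + ε * I)).re = z.re + t := fun ε t => by simp
  have him : ∀ ε t : ℝ, (z + t * (1 + ε * I)).im = z.im + t * ε := fun ε t => by simp
  simp only [mem_ofPred_eq, hre, him]
  rcases le_or_gt y z.im with h | h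
  · filter_upwards [self_mem_nhdsWithin] with ε hε t ht hmem
    have hε' : 0 < ε := hε
    have ht0 : t = 0 := by
      by_contra hne
      have := mul_pos (lt_of_le_of_ne ht (Ne.symm hne)) hε'
      linarith [hmem.1]
    subst ht0
    exact hz (by simpa using hmem)
  · have hlim : Tendsto (fun ε : ℝ => (xr - z.re) * ε) (𝓝[>] 0) (𝓝 0) := by
      refine Tendsto.mono_left ?_ nhdsWithin_le_nhds
      exact Continuous.tendsto' (by fun_prop) _ _ (by simp)
    filter_upwards [self_mem_nhdsWithin, hlim.eventually_lt_const (sub_pos.2 h)]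
      with ε hε hlt t ht hmem
    have hε' : 0 < ε := hε
    have : t * ε ≤ (xr - z.re) * ε :=
      mul_le_mul_of_nonneg_right (by linarith [hmem.2.2]) hε'.le
    linarith [hmem.1]

theorem IsParallelSlitHalfPlaneN.isPreconnected (hD : IsParallelSlitHalfPlaneN N D) {M : ℝ}
    (hM : HP M ⊆ D) : IsPreconnected D := by
  have hx : ((M + 1 : ℝ) * I : ℂ) ∈ HP M := by simp [HP]
  refine isPreconnected_of_forall ((M + 1 : ℝ) * I : ℂ) fun z hz => ?_
  obtain ⟨C, hC, -, rfl⟩ := hD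
  have hev : ∀ᶠ ε : ℝ in 𝓝[>] 0, ∀ j, ∀ t : ℝ, 0 ≤ t → z + t * (1 + ε * I) ∉ C j :=
    eventually_all.2 fun j =>
      (hC j).eventually_ray_notMem fun h => hz.2 (mem_iUnion_of_mem j h)
  obtain ⟨ε, hε, hpos⟩ := (hev.and self_mem_nhdsWithin).exists
  have hpos' : 0 < ε := hpos
  have him : ∀ t : ℝ, (z + t * (1 + ε * I)).im = z.im + t * ε := fun t => by simp
  let ray : ℝ → ℂ := fun t => z + t * (1 + ε * I)
  have hray : IsPreconnected (ray '' Ici 0) :=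
    isPreconnected_Ici.image _ (by fun_prop)
  have hz0 : 0 < z.im := hz.1
  let T := |M - z.im| / ε + 1 / ε
  have hT : 0 ≤ T := by positivity
  have hTM : ray T ∈ HP M := by
    change M < _
    rw [him]
    have : T * ε = |M - z.im| + 1 := by simp only [T]; field_simp
    linarith [le_abs_self (M - z.im)]
  refine ⟨ray '' Ici 0 ∪ HP M, union_subset ?_ hM, Or.inr hx, Or.inl ⟨0, by simp, by simp [ray]⟩,
    hray.union (ray T) (mem_image_of_mem _ hT) hTM (convex_HP M).isPreconnected⟩
  rintro _ ⟨t, ht, rfl⟩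
  refine ⟨?_, fun h => ?_⟩
  · change 0 < (z + t * (1 + ε * I)).im
    rw [him]
    have := mul_nonneg (show 0 ≤ t from ht) hpos'.le
    linarith
  · obtain ⟨j, hj⟩ := mem_iUnion.1 h
    exact hε j t ht hj

end SlitHalfPlane

/-- uniqueness of the mapping-out function of an ℍ-hull under
(H.1) and (H.2). -/
theorem statement7 {N : ℕ} {D₁ D₂ : Set ℂ}
    (h₁ : IsParallelSlitHalfPlaneN N D₁) (h₂ : IsParallelSlitHalfPlaneN N D₂)
    {F : Set ℂ} (hF : F ⊆ D₂) (hFh : IsHHull F)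
    {f g : ℂ → ℂ}
    (hfd : DifferentiableOn ℂ f D₁) (hfb : Set.BijOn f D₁ (D₂ \ F))
    (hgd : DifferentiableOn ℂ g D₁) (hgb : Set.BijOn g D₁ (D₂ \ F))
    (hf1 : SatisfiesH1 D₁ f) (hf2 : ∃ c : ℂ, SatisfiesH2 f c)
    (hg1 : SatisfiesH1 D₁ g) (hg2 : ∃ c : ℂ, SatisfiesH2 g c) :
    Set.EqOn f g D₁ := by
  have hDo := h₁.isOpen
  have hDH := h₁.subset_UHP
  obtain ⟨ηf, hηf, hfD, hflim⟩ := hf1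
  obtain ⟨ηg, hηg, hgD, hglim⟩ := hg1
  set η := max ηf ηg
  have hη : 0 ≤ η := hηf.trans (le_max_left _ _)
  have hηD : HP η ⊆ D₁ := (HP_mono (le_max_left _ _)).trans hfD
  have hf_lim : Tendsto (fun z => f z - z) (hpInfty η) (𝓝 0) :=
    hflim.mono_left (hpInfty_mono (le_max_left _ _))
  have hg_lim : Tendsto (fun z => g z - z) (hpInfty η) (𝓝 0) :=
    hglim.mono_left (hpInfty_mono (le_max_right _ _))
  have hinv : ∀ u v : ℂ → ℂ, DifferentiableOn ℂ u D₁ → BijOn u D₁ (D₂ \ F) →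
      Tendsto (fun z => u z - z) (hpInfty η) (𝓝 0) → DifferentiableOn ℂ v D₁ →
      BijOn v D₁ (D₂ \ F) → Tendsto (fun z => v z - z) (hpInfty η) (𝓝 0) →
      DifferentiableOn ℂ (Function.invFunOn u D₁ ∘ v) D₁ ∧
      MapsTo (Function.invFunOn u D₁ ∘ v) D₁ D₁ ∧
      Tendsto (fun z => (Function.invFunOn u D₁ ∘ v) z - z) (hpInfty (η + 2)) (𝓝 0) := by
    intro u v hud hub hu hvd hvb hv
    refine ⟨?_, fun z hz => ?_, ?_⟩
    · refine (differentiableOn_invFunOn hDo hud hub.injOn).comp hvd ?_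
      rw [hub.image_eq]
      exact hvb.mapsTo
    · exact Function.invFunOn_mem (hub.surjOn (hvb.mapsTo hz))
    · have h := tendsto_comp_hpInfty (hv.mono_left (hpInfty_mono (by linarith)))
        (tendsto_invFunOn_hpInfty hDo hud hub.injOn hηD hu)
      rwa [show η + 1 + 1 = η + 2 by ring] at h
  obtain ⟨hhd, hhm, hh⟩ := hinv f g hfd hfb hf_lim hgd hgb hg_lim
  obtain ⟨hkd, hkm, hk⟩ := hinv g f hgd hgb hg_lim hfd hfb hf_lim
  have hfh : ∀ z ∈ D₁, f (Function.invFunOn f D₁ (g z)) = g z := fun z hz =>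
    Function.invFunOn_eq (hfb.surjOn (hgb.mapsTo hz))
  have hkh : LeftInvOn (Function.invFunOn g D₁ ∘ f) (Function.invFunOn f D₁ ∘ g) D₁ := by
    intro z hz
    simp only [Function.comp_apply]
    rw [hfh z hz, hgb.injOn.leftInvOn_invFunOn hz]
  have hM : HP (η + 2) ⊆ D₁ := (HP_mono (by linarith)).trans hηD
  set L := η + 2 + 2 * Real.exp (2 * (η + 2 + 1)) + (η + 2 + 1) with hL
  have hηL : η ≤ L := by
    have := Real.exp_pos (2 * (η + 2 + 1))
    linarith
  have heq : EqOn f g (HP L) := by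
    intro z hz
    have h := eq_self_of_automorphism (by linarith) hDH hM hhd hhm hh hkd hkm hk hkh hz
    rw [← hfh z (hηD (HP_mono hηL hz))]
    exact congrArg f h.symm
  have hmem : ((L + 1 : ℝ) * I : ℂ) ∈ HP L := by simp [HP]
  exact (hfd.analyticOnNhd hDo).eqOn_of_preconnected_of_eventuallyEq (hgd.analyticOnNhd hDo)
    (h₁.isPreconnected hηD) (hηD (HP_mono hηL hmem))
    (heq.eventuallyEq_of_mem ((isOpen_HP L).mem_nhds hmem))
end
end

section
/- Let D ⊆ ℂ be a domain and f : D → ℂ a univalent function satisfying (H.1), i.e., ℍ_η ⊆ D for some η ≥ 0 and f(z) − z → 0 as z → ∞ with Im z > η. Then the inverse f^{-1} : f(D) → D also satisfies (H.1): there exists η' ≥ 0 such that ℍ_{η'} ⊆ f(D) and f^{-1}(w) − w → 0 as w → ∞ with Im w > η'. -/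
open Complex Set Filter Topology Bornology MeasureTheory Metric

noncomputable section

/-- If `f` is univalent on `D` and within `r / 5` of the identity on a closed disc of radius `r`
contained in `D`, then the centre of the disc is a value of `f` on the disc. -/
theorem mem_image_closedBall_of_near_id {D : Set ℂ} (hD : IsOpen D) {f : ℂ → ℂ}
    (hfd : DifferentiableOn ℂ f D) (hfi : Set.InjOn f D) {w : ℂ} {r : ℝ} (hr : 0 < r)
    (hsub : closedBall w r ⊆ D) (hclose : ∀ z ∈ closedBall w r, ‖f z - z‖ < r / 5) :
    w ∈ f '' closedBall w r := by
  have hw : w ∈ closedBall w r := mem_closedBall_self hr.le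
  have hdiff : DiffContOnCl ℂ f (ball w r) := by
    refine DifferentiableOn.diffContOnCl (hfd.mono ?_)
    exact closure_ball_subset_closedBall.trans hsub
  have hsphere : ∀ z ∈ sphere w r, 3 * r / 5 ≤ ‖f z - f w‖ := by
    intro z hz
    have hzr : ‖z - w‖ = r := by rwa [mem_sphere, dist_eq_norm] at hz
    have hz' := hclose z (sphere_subset_closedBall hz)
    have hw' := hclose w hw
    have htri : ‖z - w‖ ≤ ‖f z - f w‖ + ‖f z - z‖ + ‖f w - w‖ := by
      calc ‖z - w‖ = ‖(f z - f w) - (f z - z) + (f w - w)‖ := by congr 1; ring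
        _ ≤ ‖(f z - f w) - (f z - z)‖ + ‖f w - w‖ := norm_add_le _ _
        _ ≤ _ := by gcongr; exact norm_sub_le _ _
    linarith
  have hfreq : ∃ᶠ z in 𝓝 w, f z ≠ f w := by
    have hev : ∀ᶠ z in 𝓝[≠] w, f z ≠ f w := by
      filter_upwards [self_mem_nhdsWithin, mem_nhdsWithin_of_mem_nhds (hD.mem_nhds (hsub hw))]
        with z hz hzD heq
      exact hz (hfi hzD (hsub hw) heq)
    exact hev.frequently.filter_mono nhdsWithin_le_nhds
  refine hdiff.ball_subset_image_closedBall hr hsphere hfreq ?_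
  rw [mem_ball, dist_comm, dist_eq_norm]
  linarith [hclose w hw]

/-- Under (H.1), every point far from the origin and at distance more than `r` above the line
`Im z = η` is attained by `f` within distance `r` of itself. -/
theorem eventually_mem_image_closedBall {D : Set ℂ} (hD : IsOpen D) {f : ℂ → ℂ}
    (hfd : DifferentiableOn ℂ f D) (hfi : Set.InjOn f D) {η : ℝ} (hη : HP η ⊆ D)
    (hlim : Tendsto (fun z => f z - z) (cobounded ℂ ⊓ 𝓟 (HP η)) (𝓝 0)) {r : ℝ} (hr : 0 < r) :
    ∃ R : ℝ, ∀ w : ℂ, R < ‖w‖ → η + r < w.im →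
      ∃ z ∈ closedBall w r, z ∈ D ∧ f z = w := by
  have hev : ∀ᶠ z in cobounded ℂ, z ∈ HP η → ‖f z - z‖ < r / 5 := by
    rw [← eventually_inf_principal]
    simpa using hlim.eventually (ball_mem_nhds (0 : ℂ) (by positivity : 0 < r / 5))
  rw [← comap_norm_atTop] at hev
  obtain ⟨R, -, hR⟩ := ((atTop_basis_Ioi (α := ℝ)).comap norm).eventually_iff.mp hev
  refine ⟨R + r, fun w hwR hwim => ?_⟩
  have hHP : closedBall w r ⊆ HP η := by
    intro z hz
    rw [mem_closedBall, dist_eq_norm] at hz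
    have him := (abs_le.mp ((abs_im_le_norm (z - w)).trans hz)).1
    rw [sub_im] at him
    change η < z.im
    linarith
  obtain ⟨z, hz, hzw⟩ := mem_image_closedBall_of_near_id hD hfd hfi hr (hHP.trans hη) (by
    intro z hz
    refine hR ?_ (hHP hz)
    rw [mem_closedBall, dist_comm, dist_eq_norm] at hz
    have := norm_sub_norm_le w z
    change R < ‖z‖
    linarith)
  exact ⟨z, hz, hη (hHP hz), hzw⟩

/-- the inverse of a univalent function with (H.1) satisfies
(H.1). -/
theorem statement8 {D : Set ℂ} (hD : IsOpen D) (hDc : IsConnected D)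
    {f : ℂ → ℂ} (hfd : DifferentiableOn ℂ f D) (hfi : Set.InjOn f D)
    (h1 : SatisfiesH1 D f) :
    SatisfiesH1 (f '' D) (Function.invFunOn f D) := by
  obtain ⟨η, hη0, hη, hlim⟩ := h1
  obtain ⟨R, hR⟩ := eventually_mem_image_closedBall hD hfd hfi hη hlim one_pos
  refine ⟨max R (η + 1), le_max_of_le_right (by linarith), ?_, ?_⟩
  · intro w hw
    obtain ⟨hwR, hwη⟩ := max_lt_iff.mp (show max R (η + 1) < w.im from hw)
    obtain ⟨z, -, hzD, hzw⟩ := hR w (hwR.trans_le (im_le_norm w)) hwη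
    exact ⟨z, hzD, hzw⟩
  · rw [Metric.tendsto_nhds]
    intro ε hε
    have hr : 0 < min 1 (ε / 2) := by positivity
    obtain ⟨S, hS⟩ := eventually_mem_image_closedBall hD hfd hfi hη hlim hr
    rw [eventually_inf_principal]
    filter_upwards [tendsto_norm_cobounded_atTop.eventually_gt_atTop S] with w hwS hw
    have hwη := (max_lt_iff.mp (show max R (η + 1) < w.im from hw)).2
    obtain ⟨z, hz, hzD, rfl⟩ := hS w hwS (by linarith [min_le_left 1 (ε / 2)])
    rw [hfi.leftInvOn_invFunOn hzD, dist_zero_right, ← dist_eq_norm]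
    exact (mem_closedBall.mp hz).trans_lt ((min_le_right _ _).trans_lt (half_lt_self hε))
end
end

section
/- Let D ⊆ ℂ be a domain and f : D → ℂ a univalent function satisfying (H.1) and also (H.2) with angular residue c ∈ ℂ. Then the inverse f^{-1} satisfies (H.2) with angular residue −c: for every θ ∈ (0, π/2) there exists R > 0 such that △_θ ∖ closedBall(0, R) ⊆ f(D), and w·(f^{-1}(w) − w) → c as w → ∞ within △_θ. -/
open Complex Set Filter Topology Bornology MeasureTheory Metric

noncomputable section

theorem mem_sector_iff {θ : ℝ} (h0 : 0 < θ) (h1 : θ < Real.pi / 2) {z : ℂ} :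
    z ∈ Sector θ ↔ Real.sin θ * ‖z‖ < z.im := by
  have hs : 0 < Real.sin θ := Real.sin_pos_of_pos_of_lt_pi h0 (by linarith)
  have him : ‖z‖ * Real.sin z.arg = z.im := Complex.norm_mul_sin_arg z
  constructor
  · rintro ⟨ha, hb⟩
    have hz : 0 < ‖z‖ := by
      refine norm_pos_iff.2 fun h => ?_
      rw [h, Complex.arg_zero] at ha
      linarith
    have hlt : Real.sin θ < Real.sin z.arg := by
      rcases le_total z.arg (Real.pi / 2) with h | h
      · exact Real.sin_lt_sin_of_lt_of_le_pi_div_two (by linarith) h ha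
      · rw [← Real.sin_pi_sub z.arg]
        exact Real.sin_lt_sin_of_lt_of_le_pi_div_two (by linarith) (by linarith) (by linarith)
    nlinarith
  · intro h
    have hle : 0 ≤ Real.sin θ * ‖z‖ := by positivity
    have hz : 0 < ‖z‖ := lt_of_lt_of_le (hle.trans_lt h) (Complex.im_le_norm z)
    have harg : 0 ≤ z.arg := Complex.arg_nonneg_iff.2 (hle.trans h.le)
    have hlt : Real.sin θ < Real.sin z.arg := by
      by_contra! hcon
      nlinarith
    constructor
    · by_contra! hcon
      exact absurd hlt (not_lt.2
        (Real.sin_le_sin_of_le_of_le_pi_div_two (by linarith) h1.le hcon))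
    · by_contra! hcon
      have := Real.sin_le_sin_of_le_of_le_pi_div_two (x := Real.pi - z.arg) (y := θ)
        (by linarith [Complex.arg_le_pi z]) h1.le (by linarith)
      rw [Real.sin_pi_sub] at this
      linarith

/-- Far out in a sector, unit balls stay inside any strictly larger sector and inside any given
half-plane. -/
theorem exists_closedBall_subset_sector_inter_HP {θ θ' : ℝ} (h0 : 0 < θ') (hlt : θ' < θ)
    (h1 : θ < Real.pi / 2) (η M : ℝ) :
    ∃ R : ℝ, 0 < R ∧ ∀ w ∈ Sector θ, R < ‖w‖ → ∀ z ∈ closedBall w 1,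
      z ∈ Sector θ' ∧ z ∈ HP η ∧ M < ‖z‖ := by
  have hs' : 0 < Real.sin θ' := Real.sin_pos_of_pos_of_lt_pi h0 (by linarith)
  have hss : Real.sin θ' < Real.sin θ :=
    Real.sin_lt_sin_of_lt_of_le_pi_div_two (by linarith) h1.le hlt
  have hs : 0 < Real.sin θ := hs'.trans hss
  have hd : 0 < Real.sin θ - Real.sin θ' := sub_pos.2 hss
  refine ⟨max (2 / (Real.sin θ - Real.sin θ')) (max ((η + 1) / Real.sin θ) (M + 1)),
    lt_max_of_lt_left (by positivity), fun w hw hR z hz => ?_⟩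
  rw [mem_sector_iff (h0.trans hlt) h1] at hw
  rw [max_lt_iff, max_lt_iff, div_lt_iff₀ hd, div_lt_iff₀ hs] at hR
  obtain ⟨hR1, hR2, hR3⟩ := hR
  rw [mem_closedBall, dist_eq_norm] at hz
  have him : w.im - 1 ≤ z.im := by
    have h := (Complex.abs_im_le_norm (z - w)).trans hz
    rw [Complex.sub_im] at h
    linarith [neg_abs_le (z.im - w.im)]
  have hn1 : ‖z‖ ≤ ‖w‖ + 1 := by linarith [norm_le_norm_add_norm_sub w z, norm_sub_rev w z]
  have hn2 : ‖w‖ - 1 ≤ ‖z‖ := by linarith [norm_le_norm_add_norm_sub z w, norm_sub_rev w z]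
  refine ⟨?_, ?_, by linarith⟩
  · rw [mem_sector_iff h0 (by linarith)]
    nlinarith [Real.sin_le_one θ']
  · change η < z.im
    nlinarith

/-- A holomorphic function `1/8`-close to the identity on a closed
unit ball attains the value of the center. -/
theorem exists_mem_closedBall_eq_center {f : ℂ → ℂ} {w : ℂ}
    (hf : DifferentiableOn ℂ f (closedBall w 1))
    (hclose : ∀ z ∈ closedBall w 1, ‖f z - z‖ ≤ 1 / 8) :
    ∃ z ∈ closedBall w 1, f z = w := by
  have hw : w ∈ closedBall w 1 := mem_closedBall_self zero_le_one
  have hsph : ∀ z ∈ sphere w 1, (3 / 4 : ℝ) ≤ ‖f z - f w‖ := by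
    intro z hz
    have e : z - w = (f z - f w) - (f z - z) + (f w - w) := by ring
    have h1 : ‖z - w‖ = 1 := by rwa [mem_sphere, dist_eq_norm] at hz
    have h2 := norm_add_le ((f z - f w) - (f z - z)) (f w - w)
    rw [← e] at h2
    linarith [norm_sub_le (f z - f w) (f z - z), hclose z (sphere_subset_closedBall hz),
      hclose w hw]
  have hd : DiffContOnCl ℂ f (ball w 1) :=
    DifferentiableOn.diffContOnCl (by rwa [closure_ball w one_ne_zero])
  have hfreq : ∃ᶠ z in 𝓝 w, f z ≠ f w := by
    intro hcon
    simp only [ne_eq, not_not] at hcon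
    have han : AnalyticOnNhd ℂ f (ball w 1) :=
      (hf.mono ball_subset_closedBall).analyticOnNhd isOpen_ball
    have heq : EqOn f (fun _ => f w) (ball w 1) :=
      han.eqOn_of_preconnected_of_eventuallyEq analyticOnNhd_const
        (convex_ball w 1).isPreconnected (mem_ball_self one_pos) hcon
    have hp : w + (1 / 2 : ℝ) ∈ ball w 1 := by
      rw [mem_ball, dist_eq_norm, add_sub_cancel_left, Complex.norm_real]
      norm_num
    have e : ((1 / 2 : ℝ) : ℂ) = (f w - w) - (f (w + (1 / 2 : ℝ)) - (w + (1 / 2 : ℝ))) := by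
      rw [heq hp]; ring
    have h1 := norm_sub_le (f w - w) (f (w + (1 / 2 : ℝ)) - (w + (1 / 2 : ℝ)))
    rw [← e, Complex.norm_real] at h1
    have h2 := hclose _ (ball_subset_closedBall hp)
    have h3 := hclose w hw
    norm_num at h1 h2 h3
    linarith
  have hsub := hd.ball_subset_image_closedBall one_pos hsph hfreq
  obtain ⟨z, hz, hzw⟩ := hsub (show w ∈ ball (f w) (3 / 4 / 2) by
    rw [mem_ball, dist_comm, dist_eq_norm]
    linarith [hclose w hw])
  exact ⟨z, hz, hzw⟩

theorem SatisfiesH2.tendsto_sub {f : ℂ → ℂ} {c : ℂ} (h : SatisfiesH2 f c) {θ : ℝ}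
    (h0 : 0 < θ) (h1 : θ < Real.pi / 2) :
    Tendsto (fun z => f z - z) (cobounded ℂ ⊓ 𝓟 (Sector θ)) (𝓝 0) := by
  have hinv : Tendsto (fun z : ℂ => z⁻¹) (cobounded ℂ ⊓ 𝓟 (Sector θ)) (𝓝 0) :=
    tendsto_inv₀_cobounded.mono_left inf_le_left
  have hmul := hinv.mul (h θ h0 h1)
  rw [zero_mul] at hmul
  refine hmul.congr' ?_
  have hne : ∀ᶠ z : ℂ in cobounded ℂ ⊓ 𝓟 (Sector θ), z ≠ 0 :=
    (eventually_ne_cobounded 0).filter_mono inf_le_left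
  filter_upwards [hne] with z hz
  rw [inv_mul_cancel_left₀ hz]

/-- Preimages under `f` of far-out points of a sector exist in a strictly larger sector, within
distance one. -/
theorem exists_preimage_near_of_mem_sector {D : Set ℂ} {f : ℂ → ℂ}
    (hfd : DifferentiableOn ℂ f D) {η : ℝ} (hHP : HP η ⊆ D)
    {c : ℂ} (h2 : SatisfiesH2 f c) {θ θ' : ℝ} (h0 : 0 < θ') (hlt : θ' < θ)
    (h1 : θ < Real.pi / 2) :
    ∃ R : ℝ, 0 < R ∧ ∀ w ∈ Sector θ, R < ‖w‖ →
      ∃ z ∈ D, f z = w ∧ z ∈ Sector θ' ∧ ‖z - w‖ ≤ 1 := by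
  have hev : ∀ᶠ z in cobounded ℂ ⊓ 𝓟 (Sector θ'), ‖f z - z‖ < 1 / 8 := by
    have h := (h2.tendsto_sub h0 (hlt.trans h1)).norm
    rw [norm_zero] at h
    exact h.eventually_lt_const (by norm_num)
  rw [eventually_inf_principal, ← comap_norm_atTop, eventually_comap] at hev
  obtain ⟨M, hM⟩ := eventually_atTop.1 hev
  obtain ⟨R, hR, hball⟩ := exists_closedBall_subset_sector_inter_HP h0 hlt h1 η M
  refine ⟨R, hR, fun w hw hwR => ?_⟩
  have hb := hball w hw hwR
  obtain ⟨z, hz, hzw⟩ := exists_mem_closedBall_eq_center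
    (hfd.mono fun z hz => hHP (hb z hz).2.1)
    (fun z hz => (hM ‖z‖ (hb z hz).2.2.le z rfl (hb z hz).1).le)
  exact ⟨z, hHP (hb z hz).2.1, hzw, (hb z hz).1, by rwa [mem_closedBall, dist_eq_norm] at hz⟩

/-- the inverse of a univalent function with (H.1) and (H.2)
(residue `c`) satisfies (H.2) with angular residue `-c`. -/
theorem statement9 {D : Set ℂ} (hD : IsOpen D) (hDc : IsConnected D)
    {f : ℂ → ℂ} (hfd : DifferentiableOn ℂ f D) (hfi : Set.InjOn f D)
    (h1 : SatisfiesH1 D f) {c : ℂ} (h2 : SatisfiesH2 f c) :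
    ∀ θ : ℝ, 0 < θ → θ < Real.pi / 2 →
      (∃ R : ℝ, 0 < R ∧ Sector θ \ Metric.closedBall 0 R ⊆ f '' D) ∧
      Tendsto (fun w => w * (Function.invFunOn f D w - w))
        (cobounded ℂ ⊓ 𝓟 (Sector θ)) (𝓝 c) := by
  intro θ h0 hθ
  obtain ⟨η, -, hHP, -⟩ := h1
  obtain ⟨R, hR, hpre⟩ := exists_preimage_near_of_mem_sector hfd hHP h2
    (half_pos h0) (half_lt_self h0) hθ
  refine ⟨⟨R, hR, fun w hw => ?_⟩, ?_⟩
  · obtain ⟨z, hz, hzw, -⟩ := hpre w hw.1 (by simpa using hw.2)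
    exact ⟨z, hz, hzw⟩
  set g := Function.invFunOn f D with hg
  have hlarge : ∀ᶠ w : ℂ in cobounded ℂ ⊓ 𝓟 (Sector θ), w ∈ Sector θ ∧ R < ‖w‖ :=
    (eventually_inf_principal.2 (Eventually.of_forall fun _ h => h)).and
      ((tendsto_norm_cobounded_atTop.eventually_gt_atTop R).filter_mono inf_le_left)
  have hkey : ∀ᶠ w : ℂ in cobounded ℂ ⊓ 𝓟 (Sector θ),
      f (g w) = w ∧ g w ∈ Sector (θ / 2) ∧ ‖g w - w‖ ≤ 1 := by
    filter_upwards [hlarge] with w hw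
    obtain ⟨z, hz, rfl, hzs, hzn⟩ := hpre w hw.1 hw.2
    rw [hg, hfi.leftInvOn_invFunOn hz]
    exact ⟨rfl, hzs, hzn⟩
  have hgt : Tendsto g (cobounded ℂ ⊓ 𝓟 (Sector θ)) (cobounded ℂ ⊓ 𝓟 (Sector (θ / 2))) := by
    refine tendsto_inf.2 ⟨?_, tendsto_principal.2 (hkey.mono fun w hw => hw.2.1)⟩
    rw [← tendsto_norm_atTop_iff_cobounded]
    have hn : Tendsto (fun w : ℂ => ‖w‖ + -1) (cobounded ℂ ⊓ 𝓟 (Sector θ)) atTop :=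
      tendsto_atTop_add_const_right _ _ (tendsto_norm_cobounded_atTop.mono_left inf_le_left)
    refine tendsto_atTop_mono' _ (hkey.mono fun w hw => ?_) hn
    linarith [norm_le_norm_add_norm_sub (g w) w, hw.2.2]
  have hhalf : θ / 2 < Real.pi / 2 := (half_lt_self h0).trans hθ
  have hA := (h2 (θ / 2) (half_pos h0) hhalf).comp hgt
  have hB := (h2.tendsto_sub (half_pos h0) hhalf).comp hgt
  have hlim := hA.neg.sub (hB.pow 2)
  rw [neg_neg, zero_pow two_ne_zero, sub_zero] at hlim
  refine hlim.congr' (hkey.mono fun w hw => ?_)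
  simp only [Function.comp_apply, hw.1]
  ring
end
end
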